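/- arXiv:1211.1940 — 2 statements merged into one kernel-verified Lean document; each statement's English description precedes it below -/
import Mathlib

section
/- Let f ∈ ℝ[x₁,…,xₙ] and let h = (h₁,…,h_{m₁}), g = (g₁,…,g_{m₂}) be tuples of polynomials in ℝ[x₁,…,xₙ]. If the real variety V_ℝ(h) is a finite set, then Lasserre's hierarchy has finite convergence: there exists N ∈ ℕ such that f_k = f_min (as extended real numbers) for all k ≥ N. -/
open MvPolynomial Pointwise

/-- A polynomial is a sum of squares. -/
def IsSOS {n : ℕ} (p : MvPolynomial (Fin n) ℝ) : Prop :=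
  ∃ (m : ℕ) (q : Fin m → MvPolynomial (Fin n) ℝ), p = ∑ i, q i ^ 2

/-- The `2k`-th truncated ideal generated by the tuple `h`. -/
def truncIdeal {n m : ℕ} (h : Fin m → MvPolynomial (Fin n) ℝ) (k : ℕ) :
    Set (MvPolynomial (Fin n) ℝ) :=
  {p | ∃ φ : Fin m → MvPolynomial (Fin n) ℝ,
    (∀ i, (φ i * h i).totalDegree ≤ 2 * k) ∧ p = ∑ i, φ i * h i}

/-- The `k`-th truncated quadratic module generated by the tuple `g` (with `g₀ = 1`). -/
def truncQM {n m : ℕ} (g : Fin m → MvPolynomial (Fin n) ℝ) (k : ℕ) :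
    Set (MvPolynomial (Fin n) ℝ) :=
  {p | ∃ σ : Fin (m + 1) → MvPolynomial (Fin n) ℝ,
    (∀ j, IsSOS (σ j) ∧
      (σ j * (Fin.cons 1 g : Fin (m + 1) → MvPolynomial (Fin n) ℝ) j).totalDegree ≤ 2 * k) ∧
    p = ∑ j, σ j * (Fin.cons 1 g : Fin (m + 1) → MvPolynomial (Fin n) ℝ) j}

/-- The feasible set `K` of the problem `h = 0, g ≥ 0`. -/
def feasSet {n m₁ m₂ : ℕ} (h : Fin m₁ → MvPolynomial (Fin n) ℝ)
    (g : Fin m₂ → MvPolynomial (Fin n) ℝ) : Set (Fin n → ℝ) :=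
  {x | (∀ i, eval x (h i) = 0) ∧ ∀ j, 0 ≤ eval x (g j)}

/-- The real variety `V_ℝ(h)`. -/
def realVariety {n m : ℕ} (h : Fin m → MvPolynomial (Fin n) ℝ) : Set (Fin n → ℝ) :=
  {x | ∀ i, eval x (h i) = 0}

/-- The vanishing ideal `I(S)` of a set `S ⊆ ℝⁿ`. -/
def vanishIdeal {n : ℕ} (S : Set (Fin n → ℝ)) : Set (MvPolynomial (Fin n) ℝ) :=
  {p | ∀ u ∈ S, eval u p = 0}

/-- The `k`-th Lasserre bound `f_k` (an extended real). -/
noncomputable def lasserreBound {n m₁ m₂ : ℕ} (f : MvPolynomial (Fin n) ℝ)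
    (h : Fin m₁ → MvPolynomial (Fin n) ℝ) (g : Fin m₂ → MvPolynomial (Fin n) ℝ)
    (k : ℕ) : EReal :=
  sSup {γ : EReal | ∃ r : ℝ, γ = (r : EReal) ∧ f - C r ∈ truncIdeal h k + truncQM g k}

/-- `f_min`, the infimum of `f` over `K`, as an extended real (`⊤` if `K = ∅`). -/
noncomputable def fMin {n : ℕ} (f : MvPolynomial (Fin n) ℝ) (K : Set (Fin n → ℝ)) : EReal :=
  ⨅ x ∈ K, (eval x f : EReal)

/-- An ordered field has the intermediate value property for polynomials. -/
def PolynomialIVT (R : Type*) [Field R] [LinearOrder R] : Prop :=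
  ∀ (p : Polynomial R) (a b : R), a < b → p.eval a * p.eval b < 0 →
    ∃ c, a < c ∧ c < b ∧ p.eval c = 0

namespace PolynomialIVT

variable {R : Type*} [Field R] [LinearOrder R] [IsStrictOrderedRing R]

/-- Rolle's theorem between two consecutive roots. -/
theorem rolle_of_consecutive (hR : PolynomialIVT R) {p : Polynomial R} {a b : R} (hab : a < b)
    (hp : p ≠ 0) (ha : p.eval a = 0) (hb : p.eval b = 0)
    (hno : ∀ c, a < c → c < b → p.eval c ≠ 0) :
    ∃ c, a < c ∧ c < b ∧ p.derivative.eval c = 0 := by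
  obtain ⟨r, hr, hra⟩ := Polynomial.exists_eq_pow_rootMultiplicity_mul_and_not_dvd p hp a
  have hr0 : r ≠ 0 := by rintro rfl; simp at hra
  obtain ⟨q, hq, hqb⟩ := Polynomial.exists_eq_pow_rootMultiplicity_mul_and_not_dvd r hr0 b
  have hm : 0 < p.rootMultiplicity a := (Polynomial.rootMultiplicity_pos hp).2 ha
  have hrb : r.eval b = 0 := by
    rw [hr, Polynomial.eval_mul] at hb
    refine (mul_eq_zero.1 hb).resolve_left ?_
    simp [sub_eq_zero, hab.ne']
  have hn : 0 < r.rootMultiplicity b := (Polynomial.rootMultiplicity_pos hr0).2 hrb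
  obtain ⟨m, hm'⟩ := Nat.exists_eq_succ_of_ne_zero hm.ne'
  obtain ⟨k, hk'⟩ := Nat.exists_eq_succ_of_ne_zero hn.ne'
  rw [hm'] at hr
  rw [hk'] at hq
  have hqa0 : q.eval a ≠ 0 := fun h => hra <| by
    rw [hq]; exact Dvd.dvd.mul_left (Polynomial.dvd_iff_isRoot.2 h) _
  have hqb0 : q.eval b ≠ 0 := fun h => hqb (Polynomial.dvd_iff_isRoot.2 h)
  have hpq : p = (Polynomial.X - Polynomial.C a) ^ (m + 1) *
      ((Polynomial.X - Polynomial.C b) ^ (k + 1) * q) := by rw [← Nat.succ_eq_add_one k, ← hq, hr]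
  have hqab : 0 < q.eval a * q.eval b := by
    by_contra hneg
    obtain ⟨c, hac, hcb, hc⟩ := hR q a b hab
      (lt_of_le_of_ne (not_lt.1 hneg) (mul_ne_zero hqa0 hqb0))
    exact hno c hac hcb (by rw [hpq]; simp [hc])
  set s : Polynomial R :=
    Polynomial.C ((m : R) + 1) * (Polynomial.X - Polynomial.C b) * q +
    Polynomial.C ((k : R) + 1) * (Polynomial.X - Polynomial.C a) * q +
    (Polynomial.X - Polynomial.C a) * (Polynomial.X - Polynomial.C b) * q.derivative with hs
  have hder : p.derivative = (Polynomial.X - Polynomial.C a) ^ m *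
      (Polynomial.X - Polynomial.C b) ^ k * s := by
    rw [hpq, hs]
    simp only [Polynomial.derivative_mul, Polynomial.derivative_X_sub_C_pow, Nat.add_sub_cancel,
      Nat.cast_add, Nat.cast_one, map_add, map_one, map_natCast]
    ring
  have hsa : s.eval a = ((m : R) + 1) * (a - b) * q.eval a := by simp [hs]
  have hsb : s.eval b = ((k : R) + 1) * (b - a) * q.eval b := by simp [hs]
  obtain ⟨c, hac, hcb, hc⟩ := hR s a b hab (by
    rw [hsa, hsb]
    have h1 : (0 : R) < (m : R) + 1 := by positivity
    have h2 : (0 : R) < (k : R) + 1 := by positivity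
    have h3 : 0 < b - a := sub_pos.2 hab
    have : 0 < ((m : R) + 1) * ((k : R) + 1) * (b - a) * (b - a) * (q.eval a * q.eval b) := by
      positivity
    linarith)
  exact ⟨c, hac, hcb, by rw [hder]; simp [hc]⟩

theorem rolle (hR : PolynomialIVT R) {p : Polynomial R} {a b : R} (hab : a < b)
    (ha : p.eval a = 0) (hb : p.eval b = 0) :
    ∃ c, a < c ∧ c < b ∧ p.derivative.eval c = 0 := by
  by_cases hp : p = 0
  · obtain ⟨c, hac, hcb⟩ := exists_between hab
    exact ⟨c, hac, hcb, by simp [hp]⟩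
  classical
  let Z := p.roots.toFinset.filter (fun c => a < c)
  have hbZ : b ∈ Z := by simp [Z, hp, hb, hab]
  let d := Z.min' ⟨b, hbZ⟩
  have hdZ : d ∈ Z := Z.min'_mem _
  have hd : p.eval d = 0 ∧ a < d := by simpa [Z, hp] using hdZ
  have hdb : d ≤ b := Z.min'_le b hbZ
  obtain ⟨c, hac, hcd, hc⟩ := hR.rolle_of_consecutive hd.2 hp ha hd.1 fun c hac hcd h0 =>
    (Z.min'_le c (by simp [Z, hp, h0, hac])).not_gt hcd
  exact ⟨c, hac, hcd.trans_le hdb, hc⟩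

theorem exists_derivative_eq (hR : PolynomialIVT R) (p : Polynomial R) {a b : R} (hab : a < b) :
    ∃ c, a < c ∧ c < b ∧ p.eval b - p.eval a = p.derivative.eval c * (b - a) := by
  have hba : b - a ≠ 0 := (sub_pos.2 hab).ne'
  set t := (p.eval b - p.eval a) / (b - a) with ht
  obtain ⟨c, hac, hcb, hc⟩ := hR.rolle
    (p := p - Polynomial.C (p.eval a) - Polynomial.C t * (Polynomial.X - Polynomial.C a))
    hab (by simp) (by simp [ht]; field_simp; ring)
  have h1 : p.derivative.eval c = t := by simpa [sub_eq_zero] using hc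
  exact ⟨c, hac, hcb, by rw [h1, ht, div_mul_cancel₀ _ hba]⟩

/-- If the derivative has constant sign between two points, it is the sign of the increment. -/
theorem sign_eval₂_sub (hR : PolynomialIVT R) {K : Type*} [Field K] (φ : K →+* R)
    (p : Polynomial K) {a b : R} (hab : a < b) {s : SignType}
    (hs : ∀ x, a < x → x < b → SignType.sign (p.derivative.eval₂ φ x) = s) :
    SignType.sign (p.eval₂ φ b - p.eval₂ φ a) = s := by
  obtain ⟨c, hac, hcb, hc⟩ := hR.exists_derivative_eq (p.map φ) hab
  rw [Polynomial.derivative_map, Polynomial.eval_map, Polynomial.eval_map,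
    Polynomial.eval_map] at hc
  rw [hc, sign_mul, hs c hac hcb, sign_pos (sub_pos.2 hab), mul_one]

/-- A polynomial without roots between two points has the same sign there. -/
theorem sign_eval₂_eq (hR : PolynomialIVT R) {K : Type*} [Field K] (φ : K →+* R)
    (p : Polynomial K) {a b : R} (hab : a ≤ b)
    (h : ∀ x, a ≤ x → x ≤ b → p.eval₂ φ x ≠ 0) :
    SignType.sign (p.eval₂ φ a) = SignType.sign (p.eval₂ φ b) := by
  rcases hab.eq_or_lt with rfl | hlt
  · rfl
  by_contra hne
  have ha := h a le_rfl hab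
  have hb := h b hab le_rfl
  have hlt0 : p.eval₂ φ a * p.eval₂ φ b < 0 := by
    rcases ha.lt_or_gt with h1 | h1 <;> rcases hb.lt_or_gt with h2 | h2
    · simp [sign_neg h1, sign_neg h2] at hne
    · exact mul_neg_of_neg_of_pos h1 h2
    · exact mul_neg_of_pos_of_neg h1 h2
    · simp [sign_pos h1, sign_pos h2] at hne
  obtain ⟨c, h1, h2, h3⟩ := hR (p.map φ) a b hlt (by simpa [Polynomial.eval_map] using hlt0)
  exact h c h1.le h2.le (by simpa [Polynomial.eval_map] using h3)

end PolynomialIVT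

/-- A polynomial with positive leading coefficient is eventually positive. -/
theorem Polynomial.exists_forall_ge_eval_pos {R : Type*} [Field R] [LinearOrder R]
    [IsStrictOrderedRing R] (p : Polynomial R) (hp : 0 < p.leadingCoeff) :
    ∃ δ > 0, ∃ M, ∀ x ≥ M, δ ≤ p.eval x := by
  induction h : p.natDegree generalizing p with
  | zero =>
    rw [Polynomial.eq_C_of_natDegree_eq_zero h] at hp ⊢
    exact ⟨_, by simpa using hp, 0, fun x _ => by simp⟩
  | succ n ih =>
    have hd : p.divX.natDegree = n := by
      rw [Polynomial.natDegree_divX_eq_natDegree_tsub_one, h]; rfl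
    have hl : p.divX.leadingCoeff = p.leadingCoeff := by
      rw [Polynomial.leadingCoeff, hd, Polynomial.coeff_divX, Polynomial.leadingCoeff, h]
    obtain ⟨δ, hδ, M, hM⟩ := ih p.divX (hl ▸ hp) hd
    refine ⟨1, one_pos, max M (max 0 ((1 - p.coeff 0) / δ)), fun x hx => ?_⟩
    have h1 : δ ≤ p.divX.eval x := hM x ((le_max_left _ _).trans hx)
    have h2 : 0 ≤ x := ((le_max_left _ _).trans (le_max_right _ _)).trans hx
    have h3 : (1 - p.coeff 0) / δ ≤ x := ((le_max_right _ _).trans (le_max_right _ _)).trans hx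
    rw [div_le_iff₀ hδ] at h3
    rw [← Polynomial.divX_mul_X_add p]
    simp only [Polynomial.eval_add, Polynomial.eval_mul, Polynomial.eval_X, Polynomial.eval_C]
    nlinarith [mul_le_mul_of_nonneg_right h1 h2]

/-- A polynomial whose derivative is positive on a ray is somewhere positive on this ray. -/
theorem Polynomial.exists_ge_eval_pos_of_derivative_pos {R : Type*} [Field R] [LinearOrder R]
    [IsStrictOrderedRing R] (p : Polynomial R) (c : R)
    (h : ∀ x ≥ c, 0 < p.derivative.eval x) : ∃ x ≥ c, 0 < p.eval x := by
  have hd0 : p.derivative ≠ 0 := fun h0 => by simpa [h0] using h c le_rfl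
  have hlc : 0 < p.derivative.leadingCoeff := by
    refine lt_of_le_of_ne ?_ (Polynomial.leadingCoeff_ne_zero.2 hd0).symm
    by_contra hneg
    obtain ⟨δ, hδ, M, hM⟩ := Polynomial.exists_forall_ge_eval_pos (-p.derivative)
      (by simpa using not_le.1 hneg)
    have h1 := hM (max M c) (le_max_left _ _)
    have h2 := h (max M c) (le_max_right _ _)
    simp only [Polynomial.eval_neg] at h1
    linarith
  have hl : 0 < p.leadingCoeff := by
    rw [Polynomial.leadingCoeff_derivative] at hlc
    exact pos_of_mul_pos_left hlc (Nat.cast_nonneg _)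
  obtain ⟨δ, hδ, M, hM⟩ := p.exists_forall_ge_eval_pos hl
  exact ⟨max M c, le_max_right _ _, hδ.trans_le (hM _ (le_max_left _ _))⟩

section SignMatching

variable {K R₁ R₂ : Type*} [Field K]
  [Field R₁] [LinearOrder R₁] [Field R₂] [LinearOrder R₂]

/-- The polynomials of `S` have the same signs at the points `a` and `b`. -/
def SameSign {R₁ R₂ : Type*} [Field R₁] [LinearOrder R₁] [Field R₂] [LinearOrder R₂]
    (φ₁ : K →+* R₁) (φ₂ : K →+* R₂) (S : Set (Polynomial K)) (a : R₁) (b : R₂) : Prop :=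
  ∀ p ∈ S, SignType.sign (p.eval₂ φ₁ a) = SignType.sign (p.eval₂ φ₂ b)

/-- The sets on which all polynomials of `S` have given signs are convex. -/
def SignConvex {R : Type*} [Field R] [LinearOrder R] (φ : K →+* R) (S : Set (Polynomial K)) :
    Prop :=
  ∀ a b c, a ≤ b → b ≤ c → SameSign φ φ S a c → SameSign φ φ S a b

/-- The sign diagrams of `S` over two ordered fields agree. -/
structure SignMatch {R₁ R₂ : Type*} [Field R₁] [LinearOrder R₁] [Field R₂] [LinearOrder R₂]
    (φ₁ : K →+* R₁) (φ₂ : K →+* R₂) (S : Set (Polynomial K)) : Prop where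
  convex_left : SignConvex φ₁ S
  convex_right : SignConvex φ₂ S
  lt : ∀ a₁ b₁ a₂ b₂, SameSign φ₁ φ₂ S a₁ a₂ → SameSign φ₁ φ₂ S b₁ b₂ →
    ¬ SameSign φ₁ φ₁ S a₁ b₁ → a₁ < b₁ → a₂ < b₂
  exists_right : ∀ a₁, ∃ a₂, SameSign φ₁ φ₂ S a₁ a₂
  exists_left : ∀ a₂, ∃ a₁, SameSign φ₁ φ₂ S a₁ a₂

variable {φ₁ : K →+* R₁} {φ₂ : K →+* R₂} {S : Set (Polynomial K)} {p : Polynomial K}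

theorem SameSign.symm {a : R₁} {b : R₂} (h : SameSign φ₁ φ₂ S a b) : SameSign φ₂ φ₁ S b a :=
  fun p hp => (h p hp).symm

theorem SameSign.trans {R₃ : Type*} [Field R₃] [LinearOrder R₃] {φ₃ : K →+* R₃} {a : R₁} {b : R₂}
    {c : R₃} (h : SameSign φ₁ φ₂ S a b) (h' : SameSign φ₂ φ₃ S b c) : SameSign φ₁ φ₃ S a c :=
  fun p hp => (h p hp).trans (h' p hp)

theorem SameSign.eq_zero {a : R₁} {b : R₂} (h : SameSign φ₁ φ₂ S a b) (hp : p ∈ S)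
    (h0 : p.eval₂ φ₁ a = 0) : p.eval₂ φ₂ b = 0 := by
  simpa [h0] using (h p hp).symm

theorem SameSign.refl (φ : K →+* R₁) (S : Set (Polynomial K)) (a : R₁) : SameSign φ φ S a a :=
  fun _ _ => rfl

theorem sameSign_insert {a : R₁} {b : R₂} : SameSign φ₁ φ₂ (insert p S) a b ↔
    SignType.sign (p.eval₂ φ₁ a) = SignType.sign (p.eval₂ φ₂ b) ∧ SameSign φ₁ φ₂ S a b := by
  simp [SameSign]

theorem SignMatch.symm (M : SignMatch φ₁ φ₂ S) : SignMatch φ₂ φ₁ S where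
  convex_left := M.convex_right
  convex_right := M.convex_left
  lt a₂ b₂ a₁ b₁ ha hb hne hlt := by
    have hne' : ¬ SameSign φ₁ φ₁ S a₁ b₁ := fun h => hne (ha.trans (h.trans hb.symm))
    rcases lt_trichotomy a₁ b₁ with h | rfl | h
    · exact h
    · exact absurd (SameSign.refl _ _ _) hne'
    · exact absurd (M.lt _ _ _ _ hb.symm ha.symm (fun h' => hne' h'.symm) h) hlt.not_gt
  exists_right a := (M.exists_left a).imp fun _ h => h.symm
  exists_left a := (M.exists_right a).imp fun _ h => h.symm

theorem eval₂_comp_neg_X {R : Type*} [Field R] (φ : K →+* R) (p : Polynomial K) (a : R) :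
    (p.comp (-Polynomial.X)).eval₂ φ a = p.eval₂ φ (-a) := by
  simp [Polynomial.eval₂_comp]

theorem sameSign_image_comp_neg {a : R₁} {b : R₂} :
    SameSign φ₁ φ₂ ((fun q : Polynomial K => q.comp (-Polynomial.X)) '' S) a b ↔
      SameSign φ₁ φ₂ S (-a) (-b) := by
  simp [SameSign, eval₂_comp_neg_X]

variable [IsStrictOrderedRing R₁] [IsStrictOrderedRing R₂]

theorem SignConvex.insert (hR : PolynomialIVT R₁) (hS : SignConvex φ₁ S)
    (hd : p.derivative ∈ S) : SignConvex φ₁ (insert p S) := by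
  intro a b c hab hbc h
  rw [sameSign_insert] at h ⊢
  refine ⟨?_, hS a b c hab hbc h.2⟩
  rcases hab.eq_or_lt with rfl | hab'
  · rfl
  rcases hbc.eq_or_lt with rfl | hbc'
  · exact h.1
  have hs : ∀ x, a ≤ x → x ≤ c → SignType.sign (p.derivative.eval₂ φ₁ x) =
      SignType.sign (p.derivative.eval₂ φ₁ a) := fun x h1 h2 => (hS a x c h1 h2 h.2 _ hd).symm
  have e1 := hR.sign_eval₂_sub φ₁ p hab' fun x h1 h2 => hs x h1.le (h2.le.trans hbc)
  have e2 := hR.sign_eval₂_sub φ₁ p hbc' fun x h1 h2 => hs x (hab.trans h1.le) h2.le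
  rcases lt_trichotomy (p.derivative.eval₂ φ₁ a) 0 with h0 | h0 | h0
  · rw [sign_neg h0, sign_eq_neg_one_iff] at e1 e2
    exact le_antisymm (h.1.le.trans (SignType.sign.monotone (by linarith)))
      (SignType.sign.monotone (by linarith))
  · rw [h0, sign_zero, sign_eq_zero_iff] at e1
    rw [sub_eq_zero.1 e1]
  · rw [sign_pos h0, sign_eq_one_iff] at e1 e2
    exact le_antisymm (SignType.sign.monotone (by linarith))
      ((SignType.sign.monotone (by linarith)).trans h.1.ge)

theorem SignMatch.lt_insert (h₁ : PolynomialIVT R₁) (h₂ : PolynomialIVT R₂)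
    (M : SignMatch φ₁ φ₂ S) (hd : p.derivative ∈ S) (a₁ b₁ : R₁) (a₂ b₂ : R₂)
    (ha : SameSign φ₁ φ₂ (insert p S) a₁ a₂) (hb : SameSign φ₁ φ₂ (insert p S) b₁ b₂)
    (hne : ¬ SameSign φ₁ φ₁ (insert p S) a₁ b₁) (hlt : a₁ < b₁) : a₂ < b₂ := by
  rw [sameSign_insert] at ha hb hne
  by_cases hS : SameSign φ₁ φ₁ S a₁ b₁
  swap
  · exact M.lt _ _ _ _ ha.2 hb.2 hS hlt
  have hp : SignType.sign (p.eval₂ φ₁ a₁) ≠ SignType.sign (p.eval₂ φ₁ b₁) := fun h => hne ⟨h, hS⟩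
  by_contra hle
  have hlt₂ : b₂ < a₂ := lt_of_le_of_ne (not_lt.1 hle) fun h => hp (by rw [ha.1, hb.1, h])
  have hS₂ : SameSign φ₂ φ₂ S b₂ a₂ := hb.2.symm.trans (hS.symm.trans ha.2)
  have e1 := h₁.sign_eval₂_sub φ₁ p hlt fun x h1 h2 =>
    ((M.convex_left _ x _ h1.le h2.le hS) _ hd).symm
  have e2 := h₂.sign_eval₂_sub φ₂ p hlt₂ fun x h1 h2 =>
    ((M.convex_right _ x _ h1.le h2.le hS₂) _ hd).symm
  rw [hS₂ _ hd, ← ha.2 _ hd] at e2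
  rcases lt_trichotomy (p.derivative.eval₂ φ₁ a₁) 0 with h0 | h0 | h0
  · rw [sign_neg h0, sign_eq_neg_one_iff] at e1 e2
    refine hp (le_antisymm ?_ (SignType.sign.monotone (by linarith)))
    rw [ha.1, hb.1]
    exact SignType.sign.monotone (by linarith)
  · rw [h0, sign_zero, sign_eq_zero_iff] at e1
    exact hp (by rw [sub_eq_zero.1 e1])
  · rw [sign_pos h0, sign_eq_one_iff] at e1 e2
    refine hp (le_antisymm (SignType.sign.monotone (by linarith)) ?_)
    rw [ha.1, hb.1]
    exact SignType.sign.monotone (by linarith)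

/-- Points not separated by a root of a polynomial in `S` see the same signs. -/
theorem SameSign.of_forall_ne_zero (hR : PolynomialIVT R₁) {a b : R₁} (hab : a ≤ b)
    (h : ∀ x, a ≤ x → x ≤ b → ∀ q ∈ S, q ≠ 0 → q.eval₂ φ₁ x ≠ 0) : SameSign φ₁ φ₁ S a b := by
  intro q hq
  by_cases hq0 : q = 0
  · simp [hq0]
  · exact hR.sign_eval₂_eq φ₁ q hab fun x h1 h2 => h x h1 h2 q hq hq0

/-- A nonzero polynomial in `S` cannot vanish at two points seeing the same signs. -/
theorem SignConvex.eq_of_sameSign (hS : SignConvex φ₁ S) {q : Polynomial K} (hq : q ∈ S)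
    (hq0 : q ≠ 0) {a b : R₁} (hab : a ≤ b) (h : SameSign φ₁ φ₁ S a b) (ha : q.eval₂ φ₁ a = 0) :
    a = b := by
  by_contra hne
  have hlt := lt_of_le_of_ne hab hne
  refine hq0 ((Polynomial.map_eq_zero φ₁).1 (Polynomial.eq_zero_of_infinite_isRoot _
    ((Set.Icc_infinite hlt).mono ?_)))
  rintro x ⟨h1, h2⟩
  simpa [Polynomial.IsRoot, Polynomial.eval_map] using (hS a x b h1 h2 h).eq_zero hq ha

/-- The set of roots of the nonzero members of a finite set of polynomials is finite. -/
theorem finite_roots_of_finite {R : Type*} [Field R] (φ : K →+* R) (hfin : S.Finite) :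
    {x : R | ∃ q ∈ S, q ≠ 0 ∧ q.eval₂ φ x = 0}.Finite := by
  have : {x : R | ∃ q ∈ S, q ≠ 0 ∧ q.eval₂ φ x = 0} ⊆
      ⋃ q ∈ S, {x | x ∈ (q.map φ).roots} := by
    rintro x ⟨q, hq, hq0, hx⟩
    simp only [Set.mem_iUnion]
    refine ⟨q, hq, ?_⟩
    simp [Polynomial.mem_roots', Polynomial.map_eq_zero, hq0, Polynomial.IsRoot,
      Polynomial.eval_map, hx]
  refine (hfin.biUnion fun q _ => ?_).subset this
  exact Multiset.finite_toSet _

theorem SignMatch.exists_sign_le (h₁ : PolynomialIVT R₁) (h₂ : PolynomialIVT R₂)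
    (M : SignMatch φ₁ φ₂ S) (hfin : S.Finite) (hd : p.derivative ∈ S) (y₁ : R₁)
    (hy : ∀ q ∈ S, q ≠ 0 → q.eval₂ φ₁ y₁ ≠ 0)
    (hroot : ∀ z₁ z₂, SameSign φ₁ φ₂ S z₁ z₂ → (∃ q ∈ S, q ≠ 0 ∧ q.eval₂ φ₁ z₁ = 0) →
      SignType.sign (p.eval₂ φ₁ z₁) = SignType.sign (p.eval₂ φ₂ z₂))
    (hpos : 0 < p.derivative.eval₂ φ₁ y₁) :
    ∃ y₂, SameSign φ₁ φ₂ S y₁ y₂ ∧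
      SignType.sign (p.eval₂ φ₁ y₁) ≤ SignType.sign (p.eval₂ φ₂ y₂) := by
  obtain ⟨y₂, hy₂⟩ := M.exists_right y₁
  have hy₂' : ∀ q ∈ S, q ≠ 0 → q.eval₂ φ₂ y₂ ≠ 0 := fun q hq hq0 h =>
    hy q hq hq0 (hy₂.symm.eq_zero hq h)
  suffices ∃ x, SameSign φ₂ φ₂ S y₂ x ∧
      SignType.sign (p.eval₂ φ₁ y₁) ≤ SignType.sign (p.eval₂ φ₂ x) by
    obtain ⟨x, hx, hx'⟩ := this
    exact ⟨x, hy₂.trans hx, hx'⟩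
  have hpos_of : ∀ x, SameSign φ₂ φ₂ S y₂ x → 0 < p.derivative.eval₂ φ₂ x := fun x hx => by
    rw [← sign_eq_one_iff, ← (hy₂.trans hx) _ hd, sign_eq_one_iff]
    exact hpos
  rcases lt_or_ge (p.eval₂ φ₁ y₁) 0 with hneg | hnn
  · refine ⟨y₂, SameSign.refl _ _ _, ?_⟩
    rw [sign_neg hneg]
    exact SignType.neg_one_le _
  suffices ∃ x, SameSign φ₂ φ₂ S y₂ x ∧ 0 < p.eval₂ φ₂ x by
    obtain ⟨x, hx, hx'⟩ := this
    refine ⟨x, hx, ?_⟩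
    rw [sign_pos hx']
    exact SignType.le_one _
  have hZfin := (finite_roots_of_finite φ₂ hfin).inter_of_left {x | y₂ < x}
  by_cases hZ : ({x : R₂ | ∃ q ∈ S, q ≠ 0 ∧ q.eval₂ φ₂ x = 0} ∩ {x | y₂ < x}).Nonempty
  swap
  · have hall : ∀ x ≥ y₂, SameSign φ₂ φ₂ S y₂ x := fun x hx =>
      SameSign.of_forall_ne_zero h₂ hx fun w h1 _ q hq hq0 hw => by
        rcases h1.eq_or_lt with rfl | h1
        · exact hy₂' q hq hq0 hw
        · exact hZ ⟨w, ⟨q, hq, hq0, hw⟩, h1⟩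
    obtain ⟨x, hx, hpx⟩ := (p.map φ₂).exists_ge_eval_pos_of_derivative_pos y₂ fun x hx => by
      rw [Polynomial.derivative_map, Polynomial.eval_map]
      exact hpos_of x (hall x hx)
    exact ⟨x, hall x hx, by rwa [Polynomial.eval_map] at hpx⟩
  obtain ⟨z₂, ⟨⟨q, hq, hq0, hqz⟩, hyz⟩, hmin⟩ := Set.exists_min_image _ id hZfin hZ
  simp only [id, Set.mem_ofPred_eq] at hmin hyz
  have hcell₂ : ∀ x, y₂ ≤ x → x < z₂ → SameSign φ₂ φ₂ S y₂ x := fun x hx hxz =>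
    SameSign.of_forall_ne_zero h₂ hx fun w h1 h2 r hr hr0 hw => by
      rcases h1.eq_or_lt with rfl | h1
      · exact hy₂' r hr hr0 hw
      · exact (hmin w ⟨⟨r, hr, hr0, hw⟩, h1⟩).not_gt (h2.trans_lt hxz)
  obtain ⟨z₁, hz⟩ := M.exists_left z₂
  have hqz₁ : q.eval₂ φ₁ z₁ = 0 := hz.symm.eq_zero hq hqz
  have hyz₁ : y₁ < z₁ := M.symm.lt _ _ _ _ hy₂.symm hz.symm
    (fun h => hy₂' q hq hq0 (h.symm.eq_zero hq hqz)) hyz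
  have hcell₁ : ∀ x, y₁ ≤ x → x < z₁ → SameSign φ₁ φ₁ S y₁ x := fun x hx hxz =>
    SameSign.of_forall_ne_zero h₁ hx fun w h1 h2 r hr hr0 hw => by
      rcases h1.eq_or_lt with rfl | h1
      · exact hy r hr hr0 hw
      have hwz := h2.trans_lt hxz
      obtain ⟨w₂, hw₂⟩ := M.exists_right w
      have hyw : y₂ < w₂ := M.lt _ _ _ _ hy₂ hw₂
        (fun h => hy r hr hr0 (h.symm.eq_zero hr hw)) h1
      have hwz₂ : w₂ < z₂ := M.lt _ _ _ _ hw₂ hz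
        (fun h => hwz.ne (M.convex_left.eq_of_sameSign hr hr0 hwz.le h hw)) hwz
      exact (hmin w₂ ⟨⟨r, hr, hr0, hw₂.eq_zero hr hw⟩, hyw⟩).not_gt hwz₂
  have hinc := h₁.sign_eval₂_sub φ₁ p hyz₁ (s := 1) fun x h1 h2 => by
    rw [← hcell₁ x h1.le h2 _ hd, sign_pos hpos]
  rw [sign_eq_one_iff] at hinc
  have hpz₁ : 0 < p.eval₂ φ₁ z₁ := by linarith
  have hpz₂ : 0 < p.eval₂ φ₂ z₂ := by
    rw [← sign_eq_one_iff, ← hroot z₁ z₂ hz ⟨q, hq, hq0, hqz₁⟩, sign_pos hpz₁]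
  rcases lt_or_ge 0 (p.eval₂ φ₂ y₂) with hp0 | hp0
  · exact ⟨y₂, SameSign.refl _ _ _, hp0⟩
  obtain ⟨c, hyc, hcz, hc⟩ : ∃ c, y₂ ≤ c ∧ c < z₂ ∧ p.eval₂ φ₂ c = 0 := by
    rcases hp0.eq_or_lt with h0 | h0
    · exact ⟨y₂, le_rfl, hyz, h0⟩
    · obtain ⟨c, h1, h2, h3⟩ := h₂ (p.map φ₂) y₂ z₂ hyz
        (by rw [Polynomial.eval_map, Polynomial.eval_map]; exact mul_neg_of_neg_of_pos h0 hpz₂)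
      exact ⟨c, h1.le, h2, by rwa [Polynomial.eval_map] at h3⟩
  obtain ⟨x, hcx, hxz⟩ := exists_between hcz
  have hinc₂ := h₂.sign_eval₂_sub φ₂ p hcx (s := 1) fun w h1 h2 =>
    sign_pos (hpos_of w (hcell₂ w (hyc.trans h1.le) (h2.trans hxz)))
  rw [sign_eq_one_iff] at hinc₂
  exact ⟨x, hcell₂ x (hyc.trans hcx.le) hxz, by linarith⟩

/-- Reflection at the origin preserves sign matchings. -/
theorem SignMatch.comp_neg (M : SignMatch φ₁ φ₂ S) :
    SignMatch φ₁ φ₂ ((fun q : Polynomial K => q.comp (-Polynomial.X)) '' S) where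
  convex_left a b c hab hbc h := by
    rw [sameSign_image_comp_neg] at h ⊢
    exact h.trans (M.convex_left _ _ _ (neg_le_neg hbc) (neg_le_neg hab) h.symm)
  convex_right a b c hab hbc h := by
    rw [sameSign_image_comp_neg] at h ⊢
    exact h.trans (M.convex_right _ _ _ (neg_le_neg hbc) (neg_le_neg hab) h.symm)
  lt a₁ b₁ a₂ b₂ ha hb hne hlt := by
    rw [sameSign_image_comp_neg] at ha hb hne
    exact neg_lt_neg_iff.1 (M.lt _ _ _ _ hb ha (fun h => hne h.symm) (neg_lt_neg hlt))
  exists_right a := by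
    obtain ⟨b, hb⟩ := M.exists_right (-a)
    exact ⟨-b, by rwa [sameSign_image_comp_neg, neg_neg]⟩
  exists_left a := by
    obtain ⟨b, hb⟩ := M.exists_left (-a)
    exact ⟨-b, by rwa [sameSign_image_comp_neg, neg_neg]⟩

theorem SignMatch.exists_sign_ge (h₁ : PolynomialIVT R₁) (h₂ : PolynomialIVT R₂)
    (M : SignMatch φ₁ φ₂ S) (hfin : S.Finite) (hd : p.derivative ∈ S) (y₁ : R₁)
    (hy : ∀ q ∈ S, q ≠ 0 → q.eval₂ φ₁ y₁ ≠ 0)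
    (hroot : ∀ z₁ z₂, SameSign φ₁ φ₂ S z₁ z₂ → (∃ q ∈ S, q ≠ 0 ∧ q.eval₂ φ₁ z₁ = 0) →
      SignType.sign (p.eval₂ φ₁ z₁) = SignType.sign (p.eval₂ φ₂ z₂))
    (hpos : 0 < p.derivative.eval₂ φ₁ y₁) :
    ∃ y₂, SameSign φ₁ φ₂ S y₁ y₂ ∧
      SignType.sign (p.eval₂ φ₂ y₂) ≤ SignType.sign (p.eval₂ φ₁ y₁) := by
  have hder : (-(p.comp (-Polynomial.X))).derivative = p.derivative.comp (-Polynomial.X) := by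
    simp [Polynomial.derivative_comp]
  obtain ⟨y₂, hy₂, hle⟩ := SignMatch.exists_sign_le (p := -(p.comp (-Polynomial.X))) h₁ h₂
    M.comp_neg (hfin.image _) (by rw [hder]; exact ⟨_, hd, rfl⟩) (-y₁)
    (by
      rintro _ ⟨q, hq, rfl⟩ hq0
      simp only [eval₂_comp_neg_X, neg_neg]
      exact hy q hq (by rintro rfl; simp at hq0))
    (by
      rintro z₁ z₂ hz ⟨_, ⟨q, hq, rfl⟩, hq0, hqz⟩
      simp only [Polynomial.eval₂_neg, eval₂_comp_neg_X, Left.sign_neg] at hqz ⊢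
      rw [hroot _ _ (sameSign_image_comp_neg.1 hz) ⟨q, hq, by rintro rfl; simp at hq0, hqz⟩])
    (by rwa [hder, eval₂_comp_neg_X, neg_neg])
  rw [sameSign_image_comp_neg, neg_neg] at hy₂
  refine ⟨-y₂, hy₂, ?_⟩
  simp only [Polynomial.eval₂_neg, eval₂_comp_neg_X, Left.sign_neg, neg_neg] at hle
  have key : ∀ s t : SignType, -s ≤ -t → t ≤ s := by decide
  exact key _ _ hle

theorem SignMatch.exists_right_insert_of_pos (h₁ : PolynomialIVT R₁) (h₂ : PolynomialIVT R₂)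
    (M : SignMatch φ₁ φ₂ S) (hfin : S.Finite) (hd : p.derivative ∈ S) (y₁ : R₁)
    (hy : ∀ q ∈ S, q ≠ 0 → q.eval₂ φ₁ y₁ ≠ 0)
    (hroot : ∀ z₁ z₂, SameSign φ₁ φ₂ S z₁ z₂ → (∃ q ∈ S, q ≠ 0 ∧ q.eval₂ φ₁ z₁ = 0) →
      SignType.sign (p.eval₂ φ₁ z₁) = SignType.sign (p.eval₂ φ₂ z₂))
    (hpos : 0 < p.derivative.eval₂ φ₁ y₁) :
    ∃ y₂, SignType.sign (p.eval₂ φ₁ y₁) = SignType.sign (p.eval₂ φ₂ y₂) ∧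
      SameSign φ₁ φ₂ S y₁ y₂ := by
  obtain ⟨u, hu, hule⟩ := M.exists_sign_le h₁ h₂ hfin hd y₁ hy hroot hpos
  obtain ⟨v, hv, hvle⟩ := M.exists_sign_ge h₁ h₂ hfin hd y₁ hy hroot hpos
  by_cases hu' : SignType.sign (p.eval₂ φ₁ y₁) = SignType.sign (p.eval₂ φ₂ u)
  · exact ⟨u, hu', hu⟩
  by_cases hv' : SignType.sign (p.eval₂ φ₁ y₁) = SignType.sign (p.eval₂ φ₂ v)
  · exact ⟨v, hv', hv⟩
  have key : ∀ s t r : SignType, s ≤ t → r ≤ s → s ≠ t → s ≠ r → s = 0 ∧ t = 1 ∧ r = -1 := by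
    decide
  obtain ⟨k0, k1, k2⟩ := key _ _ _ hule hvle hu' hv'
  rw [sign_eq_one_iff] at k1
  rw [sign_eq_neg_one_iff] at k2
  have huv : u ≠ v := by rintro rfl; exact k1.not_gt k2
  have hsame : SameSign φ₂ φ₂ S u v := hu.symm.trans hv
  rcases huv.lt_or_gt with h | h
  · obtain ⟨c, h1, h2, h3⟩ := h₂ (p.map φ₂) u v h
      (by rw [Polynomial.eval_map, Polynomial.eval_map]; exact mul_neg_of_pos_of_neg k1 k2)
    rw [Polynomial.eval_map] at h3
    exact ⟨c, by rw [k0, h3, sign_zero], hu.trans (M.convex_right _ _ _ h1.le h2.le hsame)⟩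
  · obtain ⟨c, h1, h2, h3⟩ := h₂ (p.map φ₂) v u h
      (by rw [Polynomial.eval_map, Polynomial.eval_map]; exact mul_neg_of_neg_of_pos k2 k1)
    rw [Polynomial.eval_map] at h3
    exact ⟨c, by rw [k0, h3, sign_zero], hv.trans (M.convex_right _ _ _ h1.le h2.le hsame.symm)⟩

theorem sameSign_image_neg {a : R₁} {b : R₂} :
    SameSign φ₁ φ₂ (Neg.neg '' S) a b ↔ SameSign φ₁ φ₂ S a b := by
  have key : ∀ s t : SignType, -s = -t ↔ s = t := by decide
  simp only [SameSign, Set.forall_mem_image, Polynomial.eval₂_neg, Left.sign_neg, key]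

theorem SignMatch.neg (M : SignMatch φ₁ φ₂ S) : SignMatch φ₁ φ₂ (Neg.neg '' S) := by
  constructor <;> simp only [SignConvex, sameSign_image_neg]
  exacts [M.convex_left, M.convex_right, M.lt, M.exists_right, M.exists_left]

theorem SignMatch.exists_right_insert (h₁ : PolynomialIVT R₁) (h₂ : PolynomialIVT R₂)
    (hφ : ∀ k, SignType.sign (φ₁ k) = SignType.sign (φ₂ k))
    (M : SignMatch φ₁ φ₂ S) (hfin : S.Finite) (hd : p.derivative ∈ S)
    (hmod : ∀ q ∈ S, q ≠ 0 → p % q ∈ S) (y₁ : R₁) :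
    ∃ y₂, SameSign φ₁ φ₂ (insert p S) y₁ y₂ := by
  simp only [sameSign_insert]
  have hroot : ∀ z₁ z₂, SameSign φ₁ φ₂ S z₁ z₂ → (∃ q ∈ S, q ≠ 0 ∧ q.eval₂ φ₁ z₁ = 0) →
      SignType.sign (p.eval₂ φ₁ z₁) = SignType.sign (p.eval₂ φ₂ z₂) := by
    rintro z₁ z₂ hz ⟨q, hq, hq0, hqz⟩
    have hqz₂ := hz.eq_zero hq hqz
    rw [← EuclideanDomain.mod_add_div p q]
    simpa [Polynomial.eval₂_add, Polynomial.eval₂_mul, hqz, hqz₂] using hz _ (hmod q hq hq0)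
  by_cases hy : ∃ q ∈ S, q ≠ 0 ∧ q.eval₂ φ₁ y₁ = 0
  · obtain ⟨y₂, hy₂⟩ := M.exists_right y₁
    exact ⟨y₂, hroot _ _ hy₂ hy, hy₂⟩
  push Not at hy
  rcases lt_trichotomy (p.derivative.eval₂ φ₁ y₁) 0 with h0 | h0 | h0
  · obtain ⟨y₂, hs, hy₂⟩ := SignMatch.exists_right_insert_of_pos (p := -p) h₁ h₂ M.neg
      (hfin.image _) (by rw [Polynomial.derivative_neg]; exact ⟨_, hd, rfl⟩) y₁
      (by
        rintro _ ⟨q, hq, rfl⟩ hq0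
        simpa using hy q hq (by simpa using hq0))
      (by
        rintro z₁ z₂ hz ⟨_, ⟨q, hq, rfl⟩, hq0, hqz⟩
        rw [Polynomial.eval₂_neg, Polynomial.eval₂_neg, Left.sign_neg, Left.sign_neg,
          hroot z₁ z₂ (sameSign_image_neg.1 hz) ⟨q, hq, by simpa using hq0, by simpa using hqz⟩])
      (by simpa using h0)
    have key : ∀ s t : SignType, -s = -t → s = t := by decide
    simp only [Polynomial.eval₂_neg, Left.sign_neg] at hs
    exact ⟨y₂, key _ _ hs, sameSign_image_neg.1 hy₂⟩
  · by_cases hp0 : p.derivative = 0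
    · obtain ⟨y₂, hy₂⟩ := M.exists_right y₁
      have := φ₁.charZero
      rw [Polynomial.derivative_eq_zero] at hp0
      refine ⟨y₂, ?_, hy₂⟩
      rw [Polynomial.eq_C_of_natDegree_eq_zero hp0, Polynomial.eval₂_C, Polynomial.eval₂_C, hφ]
    · exact absurd h0 (hy _ hd hp0)
  · exact M.exists_right_insert_of_pos h₁ h₂ hfin hd y₁ hy hroot h0

theorem SignMatch.insert (h₁ : PolynomialIVT R₁) (h₂ : PolynomialIVT R₂)
    (hφ : ∀ k, SignType.sign (φ₁ k) = SignType.sign (φ₂ k))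
    (M : SignMatch φ₁ φ₂ S) (hfin : S.Finite) (hd : p.derivative ∈ S)
    (hmod : ∀ q ∈ S, q ≠ 0 → p % q ∈ S) : SignMatch φ₁ φ₂ (insert p S) where
  convex_left := M.convex_left.insert h₁ hd
  convex_right := M.convex_right.insert h₂ hd
  lt := M.lt_insert h₁ h₂ hd
  exists_right := M.exists_right_insert h₁ h₂ hφ hfin hd hmod
  exists_left y₂ := by
    obtain ⟨y₁, h⟩ := M.symm.exists_right_insert h₂ h₁ (fun k => (hφ k).symm) hfin hd hmod y₂
    exact ⟨y₁, h.symm⟩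

/-- The closure of a set of polynomials under derivatives and remainders. -/
inductive SturmClosure (S : Set (Polynomial K)) : Polynomial K → Prop
  | basic {r : Polynomial K} : r ∈ S → SturmClosure S r
  | zero : SturmClosure S 0
  | derivative {r : Polynomial K} : SturmClosure S r → SturmClosure S r.derivative
  | mod {r q : Polynomial K} : SturmClosure S r → SturmClosure S q → q ≠ 0 →
      q.degree ≤ r.degree → SturmClosure S (r % q)

theorem SturmClosure.degree_lt {d : ℕ} (hS : ∀ p ∈ S, p.degree < d) (h : SturmClosure S p) :
    p.degree < d := by
  induction h with
  | basic h => exact hS _ h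
  | zero => exact Polynomial.degree_zero (R := K) ▸ WithBot.bot_lt_coe d
  | derivative _ ih => exact Polynomial.degree_derivative_le.trans_lt ih
  | mod _ _ hq0 _ _ ih => exact (EuclideanDomain.mod_lt _ hq0).trans ih

theorem SturmClosure.finite (hfin : S.Finite) : {r | SturmClosure S r}.Finite := by
  obtain ⟨d, hd⟩ : ∃ d : ℕ, ∀ p ∈ S, p.degree < d := by
    obtain ⟨d, hd⟩ := (hfin.image Polynomial.natDegree).bddAbove
    refine ⟨d + 1, fun p hp => Polynomial.degree_le_natDegree.trans_lt ?_⟩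
    exact_mod_cast Nat.lt_succ_of_le (hd ⟨p, hp, rfl⟩)
  have key : ∀ k ≤ d, {p | SturmClosure S p ∧ ((d - k : ℕ) : WithBot ℕ) ≤ p.degree}.Finite := by
    intro k
    induction k with
    | zero =>
      intro _
      refine Set.finite_empty.subset ?_
      rintro p ⟨hp, hle⟩
      exact absurd (SturmClosure.degree_lt hd hp) hle.not_gt
    | succ k ih =>
      intro hk
      have ih := ih (by omega)
      set T := {p | SturmClosure S p ∧ ((d - k : ℕ) : WithBot ℕ) ≤ p.degree} with hT
      have hstep : ∀ r q : Polynomial K, ((d - (k + 1) : ℕ) : WithBot ℕ) ≤ r.degree →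
          r.degree < q.degree → ((d - k : ℕ) : WithBot ℕ) ≤ q.degree := by
        intro r q h1 h2
        have h3 := h1.trans_lt h2
        have hq0 : q ≠ 0 := by rintro rfl; simp at h3
        rw [Polynomial.degree_eq_natDegree hq0] at h3 ⊢
        have h4 : d - (k + 1) < q.natDegree := by exact_mod_cast h3
        exact_mod_cast (by omega : d - k ≤ q.natDegree)
      refine ((hfin.union (ih.image Polynomial.derivative)).union
        (Set.Finite.image2 (fun p q : Polynomial K => p % q) ih ih)).subset ?_
      rintro p ⟨hp, hle⟩
      cases hp with
      | basic h => exact Or.inl (Or.inl h)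
      | zero => simp at hle
      | @derivative p hp =>
        refine Or.inl (Or.inr ⟨p, ⟨hp, ?_⟩, rfl⟩)
        refine hstep _ _ hle (Polynomial.degree_derivative_lt ?_)
        rintro rfl
        simp at hle
      | @mod p q hp hq hq0 hdeg =>
        have hq' := hstep _ _ hle (EuclideanDomain.mod_lt p hq0)
        exact Or.inr ⟨p, ⟨hp, hq'.trans hdeg⟩, q, ⟨hq, hq'⟩, rfl⟩
  refine ((key d le_rfl).union (Set.finite_singleton 0)).subset fun p hp => ?_
  by_cases h0 : p = 0
  · exact Or.inr h0
  · refine Or.inl ⟨hp, ?_⟩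
    rw [Polynomial.degree_eq_natDegree h0]
    simp

theorem signMatch_of_subset_sturmClosure (h₁ : PolynomialIVT R₁) (h₂ : PolynomialIVT R₂)
    (hφ : ∀ k, SignType.sign (φ₁ k) = SignType.sign (φ₂ k)) (T : Finset (Polynomial K))
    (hT : ∀ p ∈ T, SturmClosure S p)
    (hinit : ∀ p ∈ T, ∀ q, SturmClosure S q → q.degree < p.degree → q ∈ T) :
    SignMatch φ₁ φ₂ (T : Set (Polynomial K)) := by
  classical
  induction h : T.card generalizing T with
  | zero =>
    rw [Finset.card_eq_zero] at h
    subst h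
    refine ⟨?_, ?_, ?_, fun _ => ⟨0, ?_⟩, fun _ => ⟨0, ?_⟩⟩ <;> simp [SignConvex, SameSign]
  | succ n ih =>
    obtain ⟨p, hp, hmax⟩ := T.exists_max_image Polynomial.degree (Finset.card_pos.1 (by omega))
    have hM := ih (T.erase p) (fun q hq => hT q (Finset.mem_of_mem_erase hq))
      (fun q hq r hr hlt => Finset.mem_erase.2 ⟨by
        rintro rfl
        exact (hmax q (Finset.mem_of_mem_erase hq)).not_gt hlt,
        hinit q (Finset.mem_of_mem_erase hq) r hr hlt⟩)
      (by rw [Finset.card_erase_of_mem hp, h]; rfl)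
    have hmem : ∀ r, SturmClosure S r → r.degree < p.degree → r ∈ T.erase p := fun r hr hlt =>
      Finset.mem_erase.2 ⟨by rintro rfl; exact lt_irrefl _ hlt, hinit p hp r hr hlt⟩
    rw [← Finset.insert_erase hp, Finset.coe_insert]
    by_cases hp0 : p = 0
    · have hlt0 : T.erase p = ∅ := by
        refine Finset.eq_empty_of_forall_notMem fun q hq => ?_
        have := hmax q (Finset.mem_of_mem_erase hq)
        rw [hp0, Polynomial.degree_zero, le_bot_iff, Polynomial.degree_eq_bot] at this
        exact Finset.ne_of_mem_erase hq (this.trans hp0.symm)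
      rw [hlt0, hp0]
      refine ⟨?_, ?_, ?_, fun _ => ⟨0, ?_⟩, fun _ => ⟨0, ?_⟩⟩ <;> simp [SignConvex, SameSign]
    · refine hM.insert h₁ h₂ hφ (Finset.finite_toSet _)
        (hmem _ (.derivative (hT p hp)) (Polynomial.degree_derivative_lt hp0)) ?_
      intro q hq hq0
      have hqT := Finset.mem_of_mem_erase (Finset.mem_coe.1 hq)
      exact hmem _ (.mod (hT p hp) (hT q hqT) hq0 (hmax q hqT))
        ((EuclideanDomain.mod_lt p hq0).trans_le (hmax q hqT))

/-- Points of one field with polynomial intermediate values can be imitated in any other one, as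
far as the signs of finitely many polynomials with common coefficients are concerned. -/
theorem exists_sameSign (h₁ : PolynomialIVT R₁) (h₂ : PolynomialIVT R₂)
    (hφ : ∀ k, SignType.sign (φ₁ k) = SignType.sign (φ₂ k)) (hfin : S.Finite) (a : R₁) :
    ∃ b, SameSign φ₁ φ₂ S a b := by
  have hcl := SturmClosure.finite hfin
  have M := signMatch_of_subset_sturmClosure (S := S) h₁ h₂ hφ hcl.toFinset 
    (fun p hp => by simpa using hp) (fun _ _ q hq _ => by simpa using hq)
  obtain ⟨b, hb⟩ := M.exists_right a
  exact ⟨b, fun p hp => hb p (by simpa using SturmClosure.basic hp)⟩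

end SignMatching

section Transfer

theorem PolynomialIVT.real : PolynomialIVT ℝ := by
  have key : ∀ (p : Polynomial ℝ) (a b : ℝ), a < b → p.eval a < 0 → 0 < p.eval b →
      ∃ c, a < c ∧ c < b ∧ p.eval c = 0 := by
    intro p a b hab ha hb
    obtain ⟨c, hc, h0⟩ := intermediate_value_Ioo hab.le p.continuous.continuousOn ⟨ha, hb⟩
    exact ⟨c, hc.1, hc.2, h0⟩
  intro p a b hab h
  rcases mul_neg_iff.1 h with ⟨ha, hb⟩ | ⟨ha, hb⟩
  · obtain ⟨c, h1, h2, h0⟩ := key (-p) a b hab (by simpa) (by simpa)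
    exact ⟨c, h1, h2, by simpa using h0⟩
  · exact key p a b hab ha hb

variable {ι : Type*} {U : Ultrafilter ι}

theorem Filter.Germ.sign_coe_eq_iff {f : ι → ℝ} {s : SignType} :
    SignType.sign (f : Germ (U : Filter ι) ℝ) = s ↔
      ∀ᶠ i in (U : Filter ι), SignType.sign (f i) = s := by
  rcases s with _ | _ | _
  · change SignType.sign _ = 0 ↔ ∀ᶠ i in (U : Filter ι), SignType.sign (f i) = 0
    simp only [sign_eq_zero_iff]
    exact Germ.coe_eq (g := fun _ => (0 : ℝ))
  · change SignType.sign _ = -1 ↔ ∀ᶠ i in (U : Filter ι), SignType.sign (f i) = -1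
    simp only [sign_eq_neg_one_iff]
    exact Germ.coe_lt (g := fun _ => (0 : ℝ))
  · change SignType.sign _ = 1 ↔ ∀ᶠ i in (U : Filter ι), SignType.sign (f i) = 1
    simp only [sign_eq_one_iff]
    exact Germ.coe_pos

theorem Filter.Germ.coeRingHom_surjective {l : Filter ι} :
    Function.Surjective (coeRingHom (R := ℝ) l) :=
  Quot.exists_rep

theorem PolynomialIVT.germ : PolynomialIVT (Filter.Germ (U : Filter ι) ℝ) := by
  intro p a b hab h
  obtain ⟨P, rfl⟩ := Polynomial.map_surjective _ Filter.Germ.coeRingHom_surjective p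
  obtain ⟨a, rfl⟩ := Filter.Germ.coeRingHom_surjective a
  obtain ⟨b, rfl⟩ := Filter.Germ.coeRingHom_surjective b
  have hev : ∀ (c : ι → ℝ) i, (P.eval c) i = (P.map (Pi.evalRingHom _ i)).eval (c i) :=
    fun c i => by
      rw [← Pi.evalRingHom_apply (fun _ => ℝ) i c, Polynomial.eval_map, Polynomial.eval₂_hom]
      rfl
  simp only [Polynomial.eval_map, Polynomial.eval₂_hom, ← map_mul] at h ⊢
  have hc : ∀ᶠ i in (U : Filter ι), ∃ c, a i < c ∧ c < b i ∧
      (P.map (Pi.evalRingHom _ i)).eval c = 0 := by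
    filter_upwards [Filter.Germ.coe_lt.1 hab,
      Filter.Germ.coe_lt (g := fun _ => (0 : ℝ)).1 h] with i h1 h2
    refine PolynomialIVT.real _ _ _ h1 ?_
    simpa [hev] using h2
  obtain ⟨c, hc⟩ := hc.choice
  refine ⟨Filter.Germ.coeRingHom _ c, Filter.Germ.coe_lt.2 (hc.mono fun _ h => h.1),
    Filter.Germ.coe_lt.2 (hc.mono fun _ h => h.2.1), ?_⟩
  rw [Polynomial.eval₂_hom]
  exact Filter.Germ.coe_eq (g := fun _ => (0 : ℝ)).2 (hc.mono fun i h => (hev c i).trans h.2.2)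

theorem sign_div_eq_sign_mul {R : Type*} [Field R] [LinearOrder R] [IsStrictOrderedRing R]
    (x y : R) : SignType.sign (x / y) = SignType.sign (x * y) := by
  rcases eq_or_ne y 0 with rfl | hy
  · simp
  · rw [show x / y = x * y * (y⁻¹) ^ 2 by field_simp, sign_mul,
      sign_pos (show 0 < (y⁻¹) ^ 2 by positivity), mul_one]

theorem exists_sign_eval₂_eq {A R₁ R₂ : Type*} [CommRing A]
    [Field R₁] [LinearOrder R₁] [IsStrictOrderedRing R₁]
    [Field R₂] [LinearOrder R₂] [IsStrictOrderedRing R₂]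
    (h₁ : PolynomialIVT R₁) (h₂ : PolynomialIVT R₂) (χ₁ : A →+* R₁) (χ₂ : A →+* R₂)
    (hχ : ∀ a, SignType.sign (χ₁ a) = SignType.sign (χ₂ a)) {S : Set (Polynomial A)}
    (hS : S.Finite) (a : R₁) :
    ∃ b, ∀ p ∈ S, SignType.sign (p.eval₂ χ₁ a) = SignType.sign (p.eval₂ χ₂ b) := by
  have hker : ∀ a, χ₁ a = 0 ↔ χ₂ a = 0 := fun a => by
    rw [← sign_eq_zero_iff, hχ, sign_eq_zero_iff]
  let I := RingHom.ker χ₁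
  let B := A ⧸ I
  have : I.IsPrime := RingHom.ker_isPrime χ₁
  let ψ₁ : B →+* R₁ := Ideal.Quotient.lift I χ₁ fun _ h => h
  let ψ₂ : B →+* R₂ := Ideal.Quotient.lift I χ₂ fun a h => (hker a).1 h
  have hψ₁ : Function.Injective ψ₁ := RingHom.lift_injective_of_ker_le_ideal _ _ le_rfl
  have hψ₂ : Function.Injective ψ₂ :=
    RingHom.lift_injective_of_ker_le_ideal _ _ fun a h => (hker a).2 h
  let K := FractionRing B
  let φ₁ : K →+* R₁ := IsFractionRing.lift hψ₁
  let φ₂ : K →+* R₂ := IsFractionRing.lift hψ₂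
  let θ : A →+* K := (algebraMap B K).comp (Ideal.Quotient.mk I)
  have e₁ : φ₁.comp θ = χ₁ := by
    ext a
    simpa [φ₁, θ] using Ideal.Quotient.lift_mk _ _ _
  have e₂ : φ₂.comp θ = χ₂ := by
    ext a
    simpa [φ₂, θ] using Ideal.Quotient.lift_mk _ _ _
  have hψ : ∀ b, SignType.sign (ψ₁ b) = SignType.sign (ψ₂ b) := fun b => by
    obtain ⟨a, rfl⟩ := Ideal.Quotient.mk_surjective b
    exact hχ a
  have hφ : ∀ k, SignType.sign (φ₁ k) = SignType.sign (φ₂ k) := fun k => by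
    obtain ⟨b, c, hc, rfl⟩ := IsFractionRing.div_surjective (A := B) k
    simp only [map_div₀, φ₁, φ₂, IsFractionRing.lift_algebraMap]
    rw [sign_div_eq_sign_mul, sign_div_eq_sign_mul, ← map_mul, ← map_mul, hψ]
  obtain ⟨b, hb⟩ := exists_sameSign h₁ h₂ hφ (hS.image (Polynomial.map θ)) a
  refine ⟨b, fun p hp => ?_⟩
  have := hb _ ⟨p, hp, rfl⟩
  rwa [Polynomial.eval₂_map, Polynomial.eval₂_map, e₁, e₂] at this

theorem exists_forall_sign_eval_eq {R : Type*} [Field R] [LinearOrder R] [IsStrictOrderedRing R]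
    (hR : PolynomialIVT R) (ψ : ℝ →+* R) {n : ℕ} (x : Fin n → R)
    (S : Finset (MvPolynomial (Fin n) ℝ)) :
    ∃ y : Fin n → ℝ, ∀ p ∈ S, SignType.sign (eval₂ ψ x p) = SignType.sign (eval y p) := by
  have hψ : ∀ c, SignType.sign (ψ c) = SignType.sign c := by
    have hpos : ∀ c, 0 < c → 0 < ψ c := fun c hc => by
      rw [← Real.sq_sqrt hc.le, map_pow]
      have := (map_ne_zero ψ).2 (Real.sqrt_pos.2 hc).ne'
      positivity
    intro c
    rcases lt_trichotomy c 0 with h | rfl | h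
    · rw [sign_neg h, sign_neg (by simpa using hpos (-c) (by simpa))]
    · simp
    · rw [sign_pos h, sign_pos (hpos c h)]
  induction n with
  | zero =>
    refine ⟨0, fun p _ => ?_⟩
    rw [eq_C_of_isEmpty p]
    simpa using hψ _
  | succ n ih =>
    choose Y hY using ih (Fin.tail x)
    let U := Ultrafilter.of (Filter.atTop : Filter (Finset (MvPolynomial (Fin n) ℝ)))
    let χ₁ : MvPolynomial (Fin n) ℝ →+* R := eval₂Hom ψ (Fin.tail x)
    let χ₂ : MvPolynomial (Fin n) ℝ →+* Filter.Germ (U : Filter _) ℝ :=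
      (Filter.Germ.coeRingHom _).comp (RingHom.pi fun s => eval (Y s))
    have hχ : ∀ a, SignType.sign (χ₁ a) = SignType.sign (χ₂ a) := fun a => by
      refine (Filter.Germ.sign_coe_eq_iff.2 ?_).symm
      refine Ultrafilter.of_le _ ?_
      filter_upwards [Filter.eventually_ge_atTop {a}] with s hs
      exact (hY s a (hs (Finset.mem_singleton_self a))).symm
    obtain ⟨b, hb⟩ := exists_sign_eval₂_eq hR PolynomialIVT.germ χ₁ χ₂ hχ
      (S.finite_toSet.image (finSuccEquiv ℝ n)) (x 0)
    obtain ⟨β, rfl⟩ := Filter.Germ.coeRingHom_surjective b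
    have e₁ : (Polynomial.eval₂RingHom χ₁ (x 0)).comp (finSuccEquiv ℝ n : _ →+* _) =
        eval₂Hom ψ x := by
      refine ringHom_ext (by simp [χ₁, finSuccEquiv_apply]) fun i => ?_
      refine Fin.cases ?_ (fun j => ?_) i <;> simp [χ₁, finSuccEquiv_apply, Fin.tail]
    have e₂ : (Polynomial.eval₂RingHom χ₂ (Filter.Germ.coeRingHom _ β)).comp
        (finSuccEquiv ℝ n : _ →+* _) = (Filter.Germ.coeRingHom _).comp
          (RingHom.pi fun s => eval (Fin.cons (β s) (Y s))) := by
      refine ringHom_ext (fun r => ?_) fun i => ?_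
      · simp only [χ₂, RingHom.comp_apply, RingHom.coe_coe, finSuccEquiv_apply, eval₂Hom_C,
          Polynomial.coe_eval₂RingHom, Polynomial.eval₂_C]
        exact congrArg _ (funext fun s => by simp)
      · refine Fin.cases ?_ (fun j => ?_) i
        · simp only [RingHom.comp_apply, RingHom.coe_coe, finSuccEquiv_X_zero,
            Polynomial.coe_eval₂RingHom, Polynomial.eval₂_X]
          exact congrArg _ (funext fun s => by simp)
        · simp only [χ₂, RingHom.comp_apply, RingHom.coe_coe, finSuccEquiv_X_succ,
            Polynomial.coe_eval₂RingHom, Polynomial.eval₂_C]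
          exact congrArg _ (funext fun s => by simp)
    have hev : ∀ p ∈ S, ∀ᶠ s in (U : Filter _),
        SignType.sign (eval (Fin.cons (β s) (Y s)) p) = SignType.sign (eval₂ ψ x p) := by
      intro p hp
      have := hb _ ⟨p, hp, rfl⟩
      have h1 := congr($e₁ p)
      have h2 := congr($e₂ p)
      simp only [RingHom.comp_apply, Polynomial.coe_eval₂RingHom, RingHom.coe_coe] at h1 h2
      rw [h1, h2] at this
      exact Filter.Germ.sign_coe_eq_iff.1 this.symm
    obtain ⟨s, hs⟩ := ((Filter.eventually_all_finset S).2 hev).exists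
    exact ⟨_, fun p hp => (hs p hp).symm⟩

end Transfer

section RealClosure

universe u

theorem IsSumSq.map {R S : Type*} [Semiring R] [Semiring S] (f : R →+* S) {a : R}
    (h : IsSumSq a) : IsSumSq (f a) := by
  induction h with
  | zero => simp [IsSumSq.zero]
  | sq_add b _ ih => simpa using ih.sq_add (f b)

theorem IsSumSq.div {F : Type*} [Field F] {a b : F} (ha : IsSumSq a) (hb : IsSumSq b) :
    IsSumSq (a / b) := by
  rcases eq_or_ne b 0 with rfl | h0
  · simp [IsSumSq.zero]
  · rw [show a / b = a * b * (b⁻¹ * b⁻¹) by field_simp]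
    exact (ha.mul hb).mul (.mul_self _)

/-- A field in which `-1` is not a sum of squares, and which cannot be enlarged by a root of an
irreducible polynomial without losing this property. -/
structure IsMaximalSemireal (R : Type u) [Field R] : Prop where
  not_isSumSq : ¬ IsSumSq (-1 : R)
  exists_root : ∀ p : Polynomial R, Irreducible p → ¬ IsSumSq (-1 : AdjoinRoot p) →
    ∃ r, p.eval r = 0

theorem exists_maximal_subfield {Ω : Type u} [Field Ω] (L₀ : Subfield Ω)
    (h₀ : ¬ IsSumSq (-1 : L₀)) :
    ∃ L, L₀ ≤ L ∧ Maximal (fun L : Subfield Ω => ¬ IsSumSq (-1 : L)) L := by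
  refine zorn_le_nonempty₀ {L : Subfield Ω | ¬ IsSumSq (-1 : L)} ?_ L₀ h₀
  intro c hc hchain L₁ hL₁
  have hmem : ∀ {x : Ω}, x ∈ sSup c ↔ ∃ s ∈ c, x ∈ s :=
    Subfield.mem_sSup_of_directedOn ⟨L₁, hL₁⟩ hchain.directedOn
  refine ⟨sSup c, ?_, fun z hz => le_sSup hz⟩
  have key : ∀ a : (sSup c : Subfield Ω), IsSumSq a →
      ∃ L ∈ c, ∃ b : L, IsSumSq b ∧ (b : Ω) = a := by
    intro a ha
    induction ha with
    | zero => exact ⟨L₁, hL₁, 0, .zero, rfl⟩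
    | sq_add x _ ih =>
      obtain ⟨L, hL, b, hb, hba⟩ := ih
      obtain ⟨L', hL', hx⟩ := hmem.1 x.2
      obtain ⟨M, hM, hLM, hL'M⟩ := hchain.directedOn L hL L' hL'
      refine ⟨M, hM, ⟨x, hL'M hx⟩ * ⟨x, hL'M hx⟩ + Subfield.inclusion hLM b,
        (hb.map _).sq_add _, ?_⟩
      simp only [Subfield.coe_add, Subfield.coe_mul, ← hba]
      rfl
  intro hneg
  obtain ⟨L, hL, b, hb, hb1⟩ := key _ hneg
  refine hc hL ?_
  convert hb
  exact Subtype.ext (by simpa using hb1.symm)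

theorem exists_isMaximalSemireal {F : Type u} [Field F] (hF : ¬ IsSumSq (-1 : F)) :
    ∃ (R : Type u) (_ : Field R) (_ : F →+* R), IsMaximalSemireal R := by
  let Ω := AlgebraicClosure F
  obtain ⟨L, hL, hmax⟩ := exists_maximal_subfield (algebraMap F Ω).fieldRange (by
    intro h
    obtain ⟨e⟩ : Nonempty ((algebraMap F Ω).fieldRange →+* F) :=
      ⟨(algebraMap F Ω).rangeRestrictFieldEquiv.symm⟩
    exact hF (by simpa using h.map e))
  refine ⟨L, inferInstance, (algebraMap F Ω).codRestrict L fun x => hL ⟨x, rfl⟩, hmax.1, ?_⟩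
  intro p hp hreal
  have : Fact (Irreducible p) := ⟨hp⟩
  have hpΩ : (p.map (algebraMap L Ω)).degree ≠ 0 := by
    rw [Polynomial.degree_map]; exact hp.degree_pos.ne'
  obtain ⟨z, hz⟩ := IsAlgClosed.exists_root _ hpΩ
  let φ : AdjoinRoot p →+* Ω := AdjoinRoot.lift (algebraMap L Ω) z (by
    rwa [Polynomial.IsRoot, Polynomial.eval_map] at hz)
  have hle : L ≤ φ.fieldRange := fun x hx =>
    ⟨AdjoinRoot.of p ⟨x, hx⟩, by simp only [φ, AdjoinRoot.lift_of]; rfl⟩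
  have hback : φ.fieldRange ≤ L := by
    refine hmax.2 (fun h => hreal ?_) hle
    obtain ⟨e⟩ : Nonempty (φ.fieldRange →+* AdjoinRoot p) := ⟨φ.rangeRestrictFieldEquiv.symm⟩
    simpa using h.map e
  refine ⟨⟨z, hback ⟨AdjoinRoot.root p, by simp [φ]⟩⟩, ?_⟩
  have hinj : Function.Injective (algebraMap L Ω) := (algebraMap L Ω).injective
  apply hinj
  rw [map_zero, ← Polynomial.eval₂_at_apply, ← Polynomial.eval_map]
  exact hz

variable {R : Type u} [Field R]

theorem IsMaximalSemireal.eq_zero (hR : IsMaximalSemireal R) {a : R} (h : IsSumSq a)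
    (h' : IsSumSq (-a)) : a = 0 := by
  by_contra h0
  refine hR.not_isSumSq ?_
  rw [show (-1 : R) = -a / a by field_simp]
  exact h'.div h

theorem IsMaximalSemireal.total (hR : IsMaximalSemireal R) (a : R) :
    IsSumSq a ∨ IsSumSq (-a) := by
  by_contra! hcon
  let p : Polynomial R := Polynomial.X ^ 2 - Polynomial.C a
  have hdeg : p.natDegree = 2 := Polynomial.natDegree_X_pow_sub_C
  have hmonic : p.Monic := Polynomial.monic_X_pow_sub_C a two_ne_zero
  have hroot : ∀ x, p.eval x ≠ 0 := fun x hx => by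
    refine hcon.1 ?_
    rw [show a = x * x by simp [p] at hx; linear_combination -hx]
    exact .mul_self x
  have hirr : Irreducible p :=
    Polynomial.irreducible_of_degree_le_three_of_not_isRoot (by simp [hdeg]) hroot
  have hneg : IsSumSq (-1 : AdjoinRoot p) := by
    by_contra h
    obtain ⟨r, hr⟩ := hR.exists_root p hirr h
    exact hroot r hr
  have hrep : ∀ y : AdjoinRoot p, ∃ b c : R,
      y = AdjoinRoot.mk p (Polynomial.C b + Polynomial.C c * Polynomial.X) := by
    intro y
    obtain ⟨f, rfl⟩ := AdjoinRoot.mk_surjective y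
    refine ⟨(f %ₘ p).coeff 0, (f %ₘ p).coeff 1, ?_⟩
    have hlt : (f %ₘ p).natDegree ≤ 1 := by
      have := Polynomial.natDegree_modByMonic_lt f hmonic (by intro h; simp [h] at hdeg)
      omega
    have := Polynomial.eq_X_add_C_of_natDegree_le_one hlt
    rw [add_comm (Polynomial.C _), ← this, AdjoinRoot.mk_eq_mk]
    exact ⟨f /ₘ p, by linear_combination -(Polynomial.modByMonic_add_div f p)⟩
  have hsq : AdjoinRoot.mk p (Polynomial.X ^ 2) = AdjoinRoot.mk p (Polynomial.C a) :=
    AdjoinRoot.mk_eq_mk.2 dvd_rfl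
  have key : ∀ y : AdjoinRoot p, IsSumSq y → ∃ B C c : R, IsSumSq B ∧ IsSumSq C ∧
      y = AdjoinRoot.mk p (Polynomial.C (B + a * C) + Polynomial.C c * Polynomial.X) := by
    intro y hy
    induction hy with
    | zero => exact ⟨0, 0, 0, .zero, .zero, by simp⟩
    | sq_add x _ ih =>
      obtain ⟨B, C, c, hB, hC, rfl⟩ := ih
      obtain ⟨u, v, rfl⟩ := hrep x
      refine ⟨u * u + B, v * v + C, 2 * u * v + c, hB.sq_add u, hC.sq_add v, ?_⟩
      simp only [map_add, map_mul, map_pow, map_ofNat] at hsq ⊢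
      linear_combination (AdjoinRoot.mk p (Polynomial.C v)) ^ 2 * hsq
  obtain ⟨B, C, c, hB, hC, h⟩ := key _ hneg
  have hzero : Polynomial.C c * Polynomial.X + Polynomial.C (1 + B + a * C) = 0 := by
    refine Polynomial.eq_zero_of_dvd_of_natDegree_lt (p := p) ?_ ?_
    · rw [← AdjoinRoot.mk_eq_zero]
      simp only [map_add, map_mul, map_one] at h ⊢
      linear_combination -h
    · exact (Polynomial.natDegree_linear_le).trans_lt (by omega)
  have h1 : 1 + B + a * C = 0 := by simpa using congr(Polynomial.coeff $hzero 0)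
  have hC0 : C ≠ 0 := by
    rintro rfl
    exact hR.not_isSumSq (by rwa [show (-1 : R) = B by linear_combination -h1])
  refine hcon.2 ?_
  rw [show -a = (1 + B) / C by field_simp; linear_combination -h1]
  exact (IsSumSq.one.add hB).div hC

theorem IsMaximalSemireal.exists_linearOrder (hR : IsMaximalSemireal R) :
    ∃ _ : LinearOrder R, IsStrictOrderedRing R := by
  classical
  let _ : LinearOrder R :=
    { le a b := IsSumSq (b - a)
      le_refl a := by simp [IsSumSq.zero]
      le_trans a b c h h' := by simpa using h'.add h
      le_antisymm a b h h' := (sub_eq_zero.1 (hR.eq_zero h (by simpa using h'))).symm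
      le_total a b := by simpa using hR.total (b - a)
      toDecidableLE := Classical.decRel _ }
  have hle : ∀ a b : R, a ≤ b ↔ IsSumSq (b - a) := fun _ _ => Iff.rfl
  have : IsOrderedAddMonoid R := { add_le_add_left := fun a b h c => by simpa [hle] using h }
  have : ZeroLEOneClass R := ⟨by simp [hle, IsSumSq.one]⟩
  have : IsOrderedRing R := .of_mul_nonneg fun a b ha hb => by
    simp only [hle, sub_zero] at ha hb ⊢
    exact ha.mul hb
  exact ⟨_, inferInstance⟩

variable [LinearOrder R] [IsStrictOrderedRing R]

theorem Polynomial.exists_irreducible_dvd_of_eval_mul_eval_neg {q : Polynomial R} {a b : R}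
    (h : q.eval a * q.eval b < 0) :
    ∃ p, Irreducible p ∧ p ∣ q ∧ p.eval a * p.eval b < 0 := by
  induction q using WfDvdMonoid.induction_on_irreducible with
  | zero => simp at h
  | unit u hu =>
    obtain ⟨c, _, rfl⟩ := Polynomial.isUnit_iff.1 hu
    simp only [Polynomial.eval_C] at h
    exact absurd h (mul_self_nonneg c).not_gt
  | mul q i _ hi ih =>
    by_cases h' : i.eval a * i.eval b < 0
    · exact ⟨i, hi, dvd_mul_right _ _, h'⟩
    · obtain ⟨p, hp, hpq, hneg⟩ := ih (by
        by_contra! h''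
        refine h.not_ge ?_
        rw [Polynomial.eval_mul, Polynomial.eval_mul, mul_mul_mul_comm]
        exact mul_nonneg (not_lt.1 h') h'')
      exact ⟨p, hp, hpq.mul_left _, hneg⟩

theorem AdjoinRoot.exists_mk_eq_of_isSumSq {p : Polynomial R} (hp : p ≠ 0) {x : AdjoinRoot p}
    (hx : IsSumSq x) : ∃ t : Polynomial R, AdjoinRoot.mk p t = x ∧
      t.natDegree ≤ 2 * (p.natDegree - 1) ∧ ∀ c, 0 ≤ t.eval c := by
  induction hx with
  | zero => exact ⟨0, by simp⟩
  | sq_add y _ ih =>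
    obtain ⟨t, rfl, hdeg, hpos⟩ := ih
    obtain ⟨f, rfl⟩ := AdjoinRoot.mk_surjective y
    have hf : AdjoinRoot.mk p (f % p) = AdjoinRoot.mk p f := by
      rw [AdjoinRoot.mk_eq_mk]
      exact ⟨-(f / p), by linear_combination EuclideanDomain.mod_add_div f p⟩
    have hlt : (f % p).natDegree ≤ p.natDegree - 1 := by
      rcases eq_or_ne (f % p) 0 with h0 | h0
      · simp [h0]
      · have := Polynomial.natDegree_lt_natDegree h0 (EuclideanDomain.mod_lt f hp)
        omega
    refine ⟨f % p * (f % p) + t, by rw [map_add, map_mul, hf], ?_, fun c => ?_⟩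
    · refine (Polynomial.natDegree_add_le _ _).trans (max_le ?_ hdeg)
      exact Polynomial.natDegree_mul_le.trans (by omega)
    · rw [Polynomial.eval_add, Polynomial.eval_mul]
      exact add_nonneg (mul_self_nonneg _) (hpos c)

theorem IsMaximalSemireal.exists_root_of_irreducible (hR : IsMaximalSemireal R)
    {p : Polynomial R} (hp : Irreducible p) {a b : R} (h : p.eval a * p.eval b < 0) :
    ∃ r, p.eval r = 0 := by
  induction hd : p.natDegree using Nat.strong_induction_on generalizing p with
  | _ d ih =>
    by_contra hroot
    have hneg : IsSumSq (-1 : AdjoinRoot p) := by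
      by_contra h'
      exact hroot (hR.exists_root p hp h')
    obtain ⟨t, ht, hdeg, hpos⟩ := AdjoinRoot.exists_mk_eq_of_isSumSq hp.ne_zero hneg
    obtain ⟨q, hq⟩ : p ∣ 1 + t := by
      rw [← AdjoinRoot.mk_eq_zero, map_add, ht, map_one, add_neg_cancel]
    have hpq : ∀ c, 0 < p.eval c * q.eval c := fun c => by
      rw [← Polynomial.eval_mul, ← hq, Polynomial.eval_add, Polynomial.eval_one]
      have := hpos c
      linarith
    have hq0 : q ≠ 0 := by
      rintro rfl
      simpa using hpq 0
    have hqneg : q.eval a * q.eval b < 0 := by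
      have := mul_pos (hpq a) (hpq b)
      rw [mul_mul_mul_comm] at this
      exact neg_of_mul_pos_right this h.le
    obtain ⟨r, hr, hrq, hrneg⟩ := Polynomial.exists_irreducible_dvd_of_eval_mul_eval_neg hqneg
    have hqdeg : p.natDegree + q.natDegree ≤ 2 * (p.natDegree - 1) := by
      rw [← Polynomial.natDegree_mul hp.ne_zero hq0, ← hq]
      exact (Polynomial.natDegree_add_le _ _).trans (max_le (by simp) hdeg)
    have hppos : 0 < p.natDegree := hp.natDegree_pos
    obtain ⟨c, hc⟩ := ih r.natDegree
      ((Polynomial.natDegree_le_of_dvd hrq hq0).trans_lt (by omega)) hr hrneg rfl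
    have := hpq c
    rw [Polynomial.eval_eq_zero_of_dvd_of_eval_eq_zero hrq hc, mul_zero] at this
    exact lt_irrefl _ this

theorem IsMaximalSemireal.polynomialIVT (hR : IsMaximalSemireal R) : PolynomialIVT R := by
  intro p a b hab h
  obtain ⟨q, hq, hqp, hneg⟩ := Polynomial.exists_irreducible_dvd_of_eval_mul_eval_neg h
  obtain ⟨r, hr⟩ := hR.exists_root_of_irreducible hq hneg
  obtain ⟨u, rfl⟩ := (Polynomial.irreducible_X_sub_C r).associated_of_dvd hq
    (Polynomial.dvd_iff_isRoot.2 hr)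
  obtain ⟨k, _, hk⟩ := Polynomial.isUnit_iff.1 u.isUnit
  simp only [← hk, Polynomial.eval_mul, Polynomial.eval_sub, Polynomial.eval_X,
    Polynomial.eval_C] at hneg
  refine ⟨r, ?_, ?_, Polynomial.eval_eq_zero_of_dvd_of_eval_eq_zero hqp hr⟩
  · by_contra! hra
    nlinarith [mul_nonneg (mul_nonneg (sub_nonneg.2 hra) (sub_nonneg.2 (hra.trans hab.le)))
      (mul_self_nonneg k)]
  · by_contra! hbr
    nlinarith [mul_nonneg (mul_nonneg (sub_nonneg.2 hbr) (sub_nonneg.2 (hab.le.trans hbr)))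
      (mul_self_nonneg k)]

/-- Every field in which `-1` is not a sum of squares embeds into an ordered field with polynomial
intermediate values. -/
theorem exists_polynomialIVT {F : Type u} [Field F] (hF : ¬ IsSumSq (-1 : F)) :
    ∃ (R : Type u) (_ : Field R) (_ : LinearOrder R) (_ : IsStrictOrderedRing R) (_ : F →+* R),
      PolynomialIVT R := by
  obtain ⟨R, _, φ, hR⟩ := exists_isMaximalSemireal hF
  obtain ⟨_, _⟩ := hR.exists_linearOrder
  exact ⟨R, _, _, inferInstance, φ, hR.polynomialIVT⟩

end RealClosure

section RealNullstellensatz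

variable {A : Type*} [CommRing A]

/-- The multiplicative set of all `p ^ (2 * l) + s` with `s` a sum of squares. -/
def evenPowAddSumSq (p : A) : Submonoid A where
  carrier := {a | ∃ (l : ℕ) (s : A), IsSumSq s ∧ a = p ^ (2 * l) + s}
  one_mem' := ⟨0, 0, .zero, by simp⟩
  mul_mem' := by
    rintro _ _ ⟨l, s, hs, rfl⟩ ⟨m, t, ht, rfl⟩
    have hpow : ∀ k, IsSumSq (p ^ (2 * k)) := fun k => by
      rw [two_mul, pow_add]
      exact .mul_self _
    exact ⟨l + m, p ^ (2 * l) * t + s * p ^ (2 * m) + s * t,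
      (((hpow l).mul ht).add (hs.mul (hpow m))).add (hs.mul ht), by ring⟩

theorem mem_evenPowAddSumSq {p a : A} :
    a ∈ evenPowAddSumSq p ↔ ∃ (l : ℕ) (s : A), IsSumSq s ∧ a = p ^ (2 * l) + s :=
  Iff.rfl

/-- An ideal is real if it contains all summands of the sums of squares it contains. -/
def Ideal.IsRealIdeal (J : Ideal A) : Prop :=
  ∀ a s, IsSumSq s → a * a + s ∈ J → a ∈ J

theorem exists_isRealIdeal [IsNoetherianRing A] {I : Ideal A} {p : A}
    (h : Disjoint (I : Set A) (evenPowAddSumSq p)) :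
    ∃ J : Ideal A, I ≤ J ∧ J.IsPrime ∧ J.IsRealIdeal ∧ p ∉ J := by
  obtain ⟨J, ⟨hIJ, hJ⟩, hJmax⟩ := (wellFounded_gt (α := Ideal A)).has_min
    {J | I ≤ J ∧ Disjoint (J : Set A) (evenPowAddSumSq p)} ⟨I, le_rfl, h⟩
  have hmax : ∀ a ∉ J, ∃ m ∈ evenPowAddSumSq p, ∃ c, m - a * c ∈ J := by
    intro a ha
    have hlt : ¬ Disjoint ((J ⊔ Ideal.span {a} : Ideal A) : Set A) (evenPowAddSumSq p) := fun hd =>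
      hJmax _ ⟨hIJ.trans le_sup_left, hd⟩ (left_lt_sup.2 fun hle =>
        ha (hle (Ideal.mem_span_singleton_self a)))
    obtain ⟨m, hm, hmM⟩ := Set.not_disjoint_iff.1 hlt
    obtain ⟨j, hj, k, hk, rfl⟩ := Submodule.mem_sup.1 hm
    obtain ⟨c, rfl⟩ := Ideal.mem_span_singleton.1 hk
    exact ⟨_, hmM, c, by simpa using hj⟩
  have hdisj : ∀ m ∈ evenPowAddSumSq p, m ∉ J := fun m hm hmJ =>
    Set.disjoint_left.1 hJ hmJ hm
  refine ⟨J, hIJ, ⟨fun h => hdisj 1 (one_mem _) (h ▸ Submodule.mem_top), ?_⟩, ?_, fun hp => ?_⟩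
  · intro a b hab
    by_contra! hcon
    obtain ⟨m, hm, c, hmc⟩ := hmax a hcon.1
    obtain ⟨m', hm', c', hmc'⟩ := hmax b hcon.2
    refine hdisj _ (mul_mem hm hm') ?_
    rw [show m * m' = (m - a * c) * m' + a * c * (m' - b * c') + c * c' * (a * b) by ring]
    exact add_mem (add_mem (J.mul_mem_right _ hmc) (J.mul_mem_left _ hmc')) (J.mul_mem_left _ hab)
  · intro a s hs has
    by_contra ha
    obtain ⟨m, hm, c, hmc⟩ := hmax a ha
    obtain ⟨l, t, ht, hlt⟩ := mem_evenPowAddSumSq.1 (mul_mem hm hm)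
    refine hdisj (m * m + s * (c * c)) ⟨l, t + s * (c * c), ht.add (hs.mul (.mul_self c)),
      by rw [hlt, add_assoc]⟩ ?_
    rw [show m * m + s * (c * c) = (m - a * c) * (m + a * c) + (c * c) * (a * a + s) by ring]
    exact add_mem (J.mul_mem_right _ hmc) (J.mul_mem_left _ has)
  · exact hdisj (p ^ 2) ⟨1, 0, .zero, by simp⟩ (J.pow_mem_of_mem hp 2 two_pos)

theorem IsSumSq.exists_of_surjective {B : Type*} [CommRing B] {f : A →+* B}
    (hf : Function.Surjective f) {b : B} (hb : IsSumSq b) : ∃ a, IsSumSq a ∧ f a = b := by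
  induction hb with
  | zero => exact ⟨0, .zero, map_zero f⟩
  | sq_add x _ ih =>
    obtain ⟨a, ha, rfl⟩ := ih
    obtain ⟨y, rfl⟩ := hf x
    exact ⟨y * y + a, ha.sq_add y, by simp⟩

theorem Ideal.IsRealIdeal.not_isSumSq_fractionRing {J : Ideal A} [J.IsPrime]
    (hJ : J.IsRealIdeal) : ¬ IsSumSq (-1 : FractionRing (A ⧸ J)) := by
  have key : ∀ y : FractionRing (A ⧸ J), IsSumSq y → ∃ d s : A ⧸ J, d ≠ 0 ∧ IsSumSq s ∧
      y * (algebraMap _ _ d * algebraMap _ _ d) = algebraMap _ _ s := by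
    intro y hy
    induction hy with
    | zero => exact ⟨1, 0, one_ne_zero, .zero, by simp⟩
    | sq_add x _ ih =>
      obtain ⟨d, s, hd, hs, h⟩ := ih
      obtain ⟨u, v, hv, rfl⟩ := IsFractionRing.div_surjective (A := A ⧸ J) x
      have hv0 : v ≠ 0 := nonZeroDivisors.ne_zero hv
      have hv' : algebraMap (A ⧸ J) (FractionRing (A ⧸ J)) v ≠ 0 := by simpa using hv0
      refine ⟨v * d, (u * d) * (u * d) + s * (v * v), mul_ne_zero hv0 hd,
        (hs.mul (.mul_self v)).sq_add _, ?_⟩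
      simp only [map_mul, map_add, ← h]
      field_simp
  intro hneg
  obtain ⟨d, s, hd, hs, h⟩ := key _ hneg
  have hds : d * d + s = 0 := by
    apply IsFractionRing.injective (A ⧸ J) (FractionRing (A ⧸ J))
    rw [map_add, map_mul, ← h, map_zero]
    ring
  obtain ⟨t, ht, rfl⟩ := hs.exists_of_surjective Ideal.Quotient.mk_surjective
  obtain ⟨a, rfl⟩ := Ideal.Quotient.mk_surjective d
  rw [← map_mul, ← map_add, Ideal.Quotient.eq_zero_iff_mem] at hds
  exact hd (Ideal.Quotient.eq_zero_iff_mem.2 (hJ a t ht hds))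

/-- The real Nullstellensatz. -/
theorem real_nullstellensatz {n : ℕ} (I : Ideal (MvPolynomial (Fin n) ℝ))
    (p : MvPolynomial (Fin n) ℝ)
    (hp : ∀ x : Fin n → ℝ, (∀ q ∈ I, eval x q = 0) → eval x p = 0) :
    ∃ (l : ℕ) (s : MvPolynomial (Fin n) ℝ), IsSumSq s ∧ p ^ (2 * l) + s ∈ I := by
  by_contra! hcon
  obtain ⟨J, hIJ, hprime, hreal, hpJ⟩ := exists_isRealIdeal (I := I) (p := p) <| by
    rw [Set.disjoint_left]
    rintro _ hI ⟨l, s, hs, rfl⟩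
    exact hcon l s hs hI
  obtain ⟨R, _, _, _, φ, hR⟩ := exists_polynomialIVT hreal.not_isSumSq_fractionRing
  let θ : MvPolynomial (Fin n) ℝ →+* R :=
    (φ.comp (algebraMap _ (FractionRing (MvPolynomial (Fin n) ℝ ⧸ J)))).comp (Ideal.Quotient.mk J)
  have hθ : ∀ q, eval₂ (θ.comp C) (fun i => θ (X i)) q = θ q := fun q => by
    have : eval₂Hom (θ.comp C) (fun i => θ (X i)) = θ := ringHom_ext (by simp) (by simp)
    exact congr($this q)
  have hker : ∀ q, θ q = 0 ↔ q ∈ J := fun q => by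
    simp [θ, Ideal.Quotient.eq_zero_iff_mem]
  obtain ⟨G, hG⟩ := (isNoetherianRing_iff_ideal_fg _).1 inferInstance I
  classical
  obtain ⟨y, hy⟩ := exists_forall_sign_eval_eq hR (θ.comp C) (fun i => θ (X i)) (insert p G)
  have hy0 : ∀ q ∈ insert p G, eval y q = 0 ↔ q ∈ J := fun q hq => by
    rw [← sign_eq_zero_iff, ← hy q hq, sign_eq_zero_iff, hθ, hker]
  refine hpJ ((hy0 p (Finset.mem_insert_self _ _)).1 (hp y fun q hq => ?_))
  have hle : I ≤ RingHom.ker (eval y) := by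
    rw [← hG, Ideal.span_le]
    intro g hg
    refine (hy0 g (Finset.mem_insert_of_mem hg)).2 (hIJ ?_)
    rw [← hG]
    exact Ideal.subset_span hg
  exact hle hq

end RealNullstellensatz

section Lasserre

variable {n m₁ m₂ : ℕ} {h : Fin m₁ → MvPolynomial (Fin n) ℝ} {g : Fin m₂ → MvPolynomial (Fin n) ℝ}
  {k : ℕ} {p q : MvPolynomial (Fin n) ℝ}

theorem isSOS_iff_isSumSq : IsSOS p ↔ IsSumSq p := by
  constructor
  · rintro ⟨m, q, rfl⟩
    exact IsSumSq.sum_sq _ _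
  · intro hp
    induction hp with
    | zero => exact ⟨0, Fin.elim0, by simp⟩
    | sq_add a _ ih =>
      obtain ⟨m, q, rfl⟩ := ih
      exact ⟨m + 1, Fin.cons a q, by simp [Fin.sum_univ_succ, sq]⟩

theorem isSumSq_C {c : ℝ} (hc : 0 ≤ c) : IsSumSq (C c : MvPolynomial (Fin n) ℝ) := by
  rw [← Real.mul_self_sqrt hc, C_mul]
  exact .mul_self _

theorem totalDegree_C_mul_le (c : ℝ) (p : MvPolynomial (Fin n) ℝ) :
    (C c * p).totalDegree ≤ p.totalDegree :=
  (totalDegree_mul _ _).trans (by simp)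

theorem truncIdeal_add (hp : p ∈ truncIdeal h k) (hq : q ∈ truncIdeal h k) :
    p + q ∈ truncIdeal h k := by
  obtain ⟨φ, hφ, rfl⟩ := hp
  obtain ⟨ψ, hψ, rfl⟩ := hq
  refine ⟨φ + ψ, fun i => ?_, by simp [add_mul, Finset.sum_add_distrib]⟩
  rw [Pi.add_apply, add_mul]
  exact (totalDegree_add _ _).trans (max_le (hφ i) (hψ i))

theorem truncQM_add (hp : p ∈ truncQM g k) (hq : q ∈ truncQM g k) : p + q ∈ truncQM g k := by
  obtain ⟨σ, hσ, rfl⟩ := hp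
  obtain ⟨τ, hτ, rfl⟩ := hq
  refine ⟨σ + τ, fun i => ⟨?_, ?_⟩, by simp only [Pi.add_apply, add_mul, Finset.sum_add_distrib]⟩
  · have h1 := (hσ i).1
    have h2 := (hτ i).1
    rw [isSOS_iff_isSumSq] at *
    exact h1.add h2
  · rw [Pi.add_apply, add_mul]
    exact (totalDegree_add _ _).trans (max_le (hσ i).2 (hτ i).2)

theorem truncIdeal_C_mul (c : ℝ) (hp : p ∈ truncIdeal h k) : C c * p ∈ truncIdeal h k := by
  obtain ⟨φ, hφ, rfl⟩ := hp
  refine ⟨fun i => C c * φ i, fun i => ?_, by simp [Finset.mul_sum, mul_assoc]⟩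
  rw [mul_assoc]
  exact (totalDegree_C_mul_le _ _).trans (hφ i)

theorem truncQM_C_mul {c : ℝ} (hc : 0 ≤ c) (hp : p ∈ truncQM g k) : C c * p ∈ truncQM g k := by
  obtain ⟨σ, hσ, rfl⟩ := hp
  refine ⟨fun i => C c * σ i, fun i => ⟨?_, ?_⟩, by simp only [Finset.mul_sum, mul_assoc]⟩
  · rw [isSOS_iff_isSumSq]
    exact (isSumSq_C hc).mul (isSOS_iff_isSumSq.1 (hσ i).1)
  · rw [mul_assoc]
    exact (totalDegree_C_mul_le _ _).trans (hσ i).2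

theorem zero_mem_truncIdeal : 0 ∈ truncIdeal h k := ⟨0, by simp, by simp⟩

theorem zero_mem_truncQM : 0 ∈ truncQM g k :=
  ⟨0, fun _ => ⟨isSOS_iff_isSumSq.2 .zero, by simp⟩, by simp⟩

/-- The polynomials certified nonnegative on the feasible set at level `k`. -/
def certificates (h : Fin m₁ → MvPolynomial (Fin n) ℝ) (g : Fin m₂ → MvPolynomial (Fin n) ℝ)
    (k : ℕ) : Set (MvPolynomial (Fin n) ℝ) :=
  truncIdeal h k + truncQM g k

theorem certificates_add (hp : p ∈ certificates h g k) (hq : q ∈ certificates h g k) :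
    p + q ∈ certificates h g k := by
  obtain ⟨a, ha, b, hb, rfl⟩ := hp
  obtain ⟨c, hc, d, hd, rfl⟩ := hq
  exact ⟨a + c, truncIdeal_add ha hc, b + d, truncQM_add hb hd, by simp only; ring⟩

theorem certificates_C_mul {c : ℝ} (hc : 0 ≤ c) (hp : p ∈ certificates h g k) :
    C c * p ∈ certificates h g k := by
  obtain ⟨a, ha, b, hb, rfl⟩ := hp
  exact ⟨_, truncIdeal_C_mul c ha, _, truncQM_C_mul hc hb, by simp only; ring⟩

theorem certificates_mono {l : ℕ} (hkl : k ≤ l) : certificates h g k ⊆ certificates h g l := by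
  rintro _ ⟨a, ⟨φ, hφ, rfl⟩, b, ⟨σ, hσ, rfl⟩, rfl⟩
  exact ⟨_, ⟨φ, fun i => (hφ i).trans (by omega), rfl⟩, _,
    ⟨σ, fun i => ⟨(hσ i).1, (hσ i).2.trans (by omega)⟩, rfl⟩, rfl⟩

theorem certificates_of_isSumSq (hp : IsSumSq p) (hdeg : p.totalDegree ≤ 2 * k) :
    p ∈ certificates h g k := by
  refine ⟨0, zero_mem_truncIdeal, p, ⟨Fin.cons p 0, fun j => ?_, by simp [Fin.sum_univ_succ]⟩,
    zero_add p⟩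
  refine Fin.cases ?_ (fun j => ?_) j
  · simpa [hdeg] using isSOS_iff_isSumSq.2 hp
  · simpa using isSOS_iff_isSumSq.2 .zero

theorem certificates_C {c : ℝ} (hc : 0 ≤ c) : C c ∈ certificates h g k :=
  certificates_of_isSumSq (isSumSq_C hc) (by simp)

theorem exists_mem_certificates_add (hp : ∃ k, p ∈ certificates h g k)
    (hq : ∃ k, q ∈ certificates h g k) : ∃ k, p + q ∈ certificates h g k := by
  obtain ⟨k, hp⟩ := hp
  obtain ⟨l, hq⟩ := hq
  exact ⟨max k l, certificates_add (certificates_mono (le_max_left _ _) hp)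
    (certificates_mono (le_max_right _ _) hq)⟩

theorem exists_mem_certificates_of_isSumSq (hp : IsSumSq p) : ∃ k, p ∈ certificates h g k :=
  ⟨p.totalDegree, certificates_of_isSumSq hp (by omega)⟩

theorem exists_mem_certificates_of_mem_span (hp : p ∈ Ideal.span (Set.range h)) :
    ∃ k, p ∈ certificates h g k := by
  obtain ⟨φ, rfl⟩ := Ideal.mem_span_range_iff_exists_fun.1 hp
  refine ⟨∑ i, (φ i * h i).totalDegree, _, ⟨φ, fun i => ?_, rfl⟩, 0, zero_mem_truncQM, add_zero _⟩
  have := Finset.single_le_sum (f := fun i => (φ i * h i).totalDegree) (fun _ _ => Nat.zero_le _)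
    (Finset.mem_univ i)
  omega

theorem exists_mem_certificates_mul (hp : IsSumSq p) (j : Fin m₂) :
    ∃ k, p * g j ∈ certificates h g k := by
  refine ⟨(p * g j).totalDegree, 0, zero_mem_truncIdeal, p * g j,
    ⟨Fin.cons 0 (Pi.single j p), fun i => ?_, ?_⟩, zero_add _⟩
  · refine Fin.cases ?_ (fun i => ?_) i
    · simpa using isSOS_iff_isSumSq.2 .zero
    · rcases eq_or_ne i j with rfl | hij
      · simpa using ⟨isSOS_iff_isSumSq.2 hp, by omega⟩
      · simpa [hij] using isSOS_iff_isSumSq.2 .zero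
  · rw [Fin.sum_univ_succ, Finset.sum_eq_single j] <;> simp +contextual

theorem eval_nonneg_of_isSumSq (hp : IsSumSq p) (x : Fin n → ℝ) : 0 ≤ eval x p :=
  (hp.map (eval x)).nonneg

theorem eval_nonneg_of_mem_certificates (hp : p ∈ certificates h g k) {x : Fin n → ℝ}
    (hx : x ∈ feasSet h g) : 0 ≤ eval x p := by
  obtain ⟨_, ⟨φ, _, rfl⟩, _, ⟨σ, hσ, rfl⟩, rfl⟩ := hp
  have hσ' := fun j => eval_nonneg_of_isSumSq (isSOS_iff_isSumSq.1 (hσ j).1) x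
  simp only [map_add, map_sum, map_mul, hx.1, mul_zero, Finset.sum_const_zero, zero_add]
  refine Finset.sum_nonneg fun j _ => mul_nonneg (hσ' j) ?_
  refine Fin.cases ?_ (fun j => ?_) j
  · simp
  · simpa using hx.2 j

theorem certificates_C_add_C_mul_of_sq {v : MvPolynomial (Fin n) ℝ} (hv : v.totalDegree ≤ k)
    (hsq : ∀ ε > 0, ∀ c ≤ 0, C ε + C c * v ^ 2 ∈ certificates h g k) {ε : ℝ} (hε : 0 < ε)
    (c : ℝ) : C ε + C c * v ∈ certificates h g k := by
  have hdeg : (1 + C (c / ε) * v).totalDegree ≤ k :=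
    (totalDegree_add _ _).trans (max_le (by simp) ((totalDegree_C_mul_le _ _).trans hv))
  have h1 : (1 + C (c / ε) * v) * (1 + C (c / ε) * v) ∈ certificates h g k :=
    certificates_of_isSumSq (.mul_self _) ((totalDegree_mul _ _).trans (by omega))
  have h2 := hsq (ε / 2) (by positivity) (-(c ^ 2 / (2 * ε))) (by simp; positivity)
  convert certificates_add (certificates_C_mul (half_pos hε).le h1) h2 using 1
  have e1 : (C ε : MvPolynomial (Fin n) ℝ) = C (ε / 2) + C (ε / 2) := by
    rw [← C_add, add_halves]
  have e2 : (C c : MvPolynomial (Fin n) ℝ) = 2 * C (ε / 2) * C (c / ε) := by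
    rw [← map_ofNat C 2, ← C_mul, ← C_mul]
    congr 1
    field_simp
  have e3 : (C (-(c ^ 2 / (2 * ε))) : MvPolynomial (Fin n) ℝ) = - (C (ε / 2) * C (c / ε) ^ 2) := by
    rw [← C_pow, ← C_mul, ← C_neg]
    congr 1
    field_simp
  rw [e1, e2, e3]
  ring

theorem certificates_C_add_C_mul (m : ℕ) {v : MvPolynomial (Fin n) ℝ}
    (hv : v.totalDegree * 2 ^ (m + 1) ≤ k) (hneg : -v ^ 2 ^ (m + 1) ∈ certificates h g k)
    {ε : ℝ} (hε : 0 < ε) (c : ℝ) : C ε + C c * v ∈ certificates h g k := by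
  have hv' : v.totalDegree ≤ k := (Nat.le_mul_of_pos_right _ (by positivity)).trans hv
  induction m generalizing v c ε with
  | zero =>
    refine certificates_C_add_C_mul_of_sq hv' (fun ε hε c hc => ?_) hε c
    convert certificates_add (certificates_C hε.le)
      (certificates_C_mul (neg_nonneg.2 hc) hneg) using 1
    simp
  | succ m ih =>
    have hle : (v ^ 2).totalDegree * 2 ^ (m + 1) ≤ k := by
      refine (Nat.mul_le_mul_right _ (totalDegree_pow _ _)).trans (le_trans (le_of_eq ?_) hv)
      ring
    refine certificates_C_add_C_mul_of_sq hv' (fun ε hε c _ => ih hle ?_ hε c ?_) hε c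
    · rwa [← pow_mul, ← pow_succ']
    · exact (Nat.le_mul_of_pos_right _ (by positivity)).trans hle

theorem exists_interpolation {V : Set (Fin n → ℝ)} (hV : V.Finite) (u : Fin n → ℝ) :
    ∃ φ : MvPolynomial (Fin n) ℝ, eval u φ = 1 ∧ ∀ v ∈ V, v ≠ u → eval v φ = 0 := by
  classical
  let d : (Fin n → ℝ) → MvPolynomial (Fin n) ℝ := fun v => ∑ i, (X i - C (v i)) ^ 2
  have hd : ∀ v w, eval w (d v) = 0 ↔ w = v := fun v w => by
    simp only [d, map_sum, map_pow, map_sub, eval_X, eval_C]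
    rw [Finset.sum_eq_zero_iff_of_nonneg fun _ _ => sq_nonneg _]
    simp [sub_eq_zero, funext_iff]
  let P := ∏ v ∈ hV.toFinset.erase u, d v
  have hP : eval u P ≠ 0 := by
    simp only [P, map_prod, Finset.prod_ne_zero_iff, Finset.mem_erase]
    exact fun v hv h0 => hv.1 ((hd _ _).1 h0).symm
  refine ⟨C (eval u P)⁻¹ * P, by simp [hP], fun v hv hne => ?_⟩
  have : eval v P = 0 := by
    rw [map_prod]
    exact Finset.prod_eq_zero (Finset.mem_erase.2 ⟨hne, hV.mem_toFinset.2 hv⟩) ((hd _ _).2 rfl)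
  simp [this]

theorem exists_mem_certificates_eq_on_realVariety (hV : (realVariety h).Finite)
    {f : MvPolynomial (Fin n) ℝ} (hf : ∀ x ∈ feasSet h g, 0 ≤ eval x f) :
    ∃ q, (∃ k, q ∈ certificates h g k) ∧ ∀ x ∈ realVariety h, eval x q = eval x f := by
  classical
  have hpoint : ∀ u ∈ realVariety h, ∃ a, (∃ k, a ∈ certificates h g k) ∧
      eval u a = eval u f ∧ ∀ v ∈ realVariety h, v ≠ u → eval v a = 0 := by
    intro u hu
    obtain ⟨φ, hφu, hφ⟩ := exists_interpolation hV u
    by_cases hfu : 0 ≤ eval u f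
    · refine ⟨C (eval u f) * (φ * φ), exists_mem_certificates_of_isSumSq
        ((isSumSq_C hfu).mul (.mul_self φ)), by simp [hφu], fun v hv hne => by simp [hφ v hv hne]⟩
    · obtain ⟨j, hj⟩ : ∃ j, eval u (g j) < 0 := by
        by_contra! hcon
        exact hfu (hf u ⟨hu, hcon⟩)
      refine ⟨C (eval u f / eval u (g j)) * (φ * φ) * g j, exists_mem_certificates_mul
        ((isSumSq_C (div_nonneg_of_nonpos (not_le.1 hfu).le hj.le)).mul (.mul_self φ)) j,
        by simp [hφu, hj.ne], fun v hv hne => by simp [hφ v hv hne]⟩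
  choose! a ha hau hav using hpoint
  refine ⟨∑ u ∈ hV.toFinset, a u, ?_, fun x hx => ?_⟩
  · refine Finset.sum_induction a (fun p => ∃ k, p ∈ certificates h g k)
      (fun _ _ => exists_mem_certificates_add) (exists_mem_certificates_of_isSumSq .zero) ?_
    exact fun u hu => ha u (hV.mem_toFinset.1 hu)
  · rw [map_sum, Finset.sum_eq_single_of_mem x (hV.mem_toFinset.2 hx), hau x hx]
    exact fun u hu hne => hav u (hV.mem_toFinset.1 hu) x hx hne.symm

theorem exists_neg_pow_mem_certificates (hp : ∀ x ∈ realVariety h, eval x p = 0) :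
    ∃ m k, -p ^ 2 ^ (m + 1) ∈ certificates h g k := by
  obtain ⟨l, s, hs, hmem⟩ := real_nullstellensatz (Ideal.span (Set.range h)) p fun x hx =>
    hp x fun i => hx _ (Ideal.subset_span ⟨i, rfl⟩)
  obtain ⟨r, hr⟩ : ∃ r, 2 ^ (l + 1) = 2 * l + (r + r) := by
    have : l < 2 ^ l := Nat.lt_two_pow_self
    exact ⟨2 ^ l - l, by rw [pow_succ]; omega⟩
  obtain ⟨k, hk⟩ := exists_mem_certificates_add (g := g)
    (exists_mem_certificates_of_mem_span (neg_mem (Ideal.mul_mem_right (p ^ (r + r)) _ hmem)))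
    (exists_mem_certificates_of_isSumSq (hs.mul (.mul_self (p ^ r))))
  refine ⟨l, k, ?_⟩
  convert hk using 1
  rw [hr]
  ring

/-- Polynomials nonnegative on the feasible set are certified up to arbitrarily small constants at
a fixed level. -/
theorem exists_forall_add_C_mem_certificates (hV : (realVariety h).Finite)
    {f : MvPolynomial (Fin n) ℝ} (hf : ∀ x ∈ feasSet h g, 0 ≤ eval x f) :
    ∃ N, ∀ k ≥ N, ∀ ε > 0, f + C ε ∈ certificates h g k := by
  obtain ⟨q, ⟨k₁, hq⟩, hqf⟩ := exists_mem_certificates_eq_on_realVariety hV hf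
  obtain ⟨m, k₂, hk₂⟩ := exists_neg_pow_mem_certificates (g := g) (p := f - q) (h := h)
    fun x hx => by simp [hqf x hx]
  refine ⟨max (max k₁ k₂) ((f - q).totalDegree * 2 ^ (m + 1)), fun k hk ε hε => ?_⟩
  simp only [ge_iff_le, max_le_iff] at hk
  convert certificates_add (certificates_mono hk.1.1 hq) (certificates_C_add_C_mul m hk.2
    (certificates_mono hk.1.2 hk₂) hε 1) using 1
  rw [C_1]
  ring

theorem le_lasserreBound {f : MvPolynomial (Fin n) ℝ} {r : ℝ}
    (hr : f - C r ∈ certificates h g k) : (r : EReal) ≤ lasserreBound f h g k :=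
  le_sSup ⟨r, rfl, hr⟩

theorem lasserreBound_le_fMin (f : MvPolynomial (Fin n) ℝ) :
    lasserreBound f h g k ≤ fMin f (feasSet h g) := by
  refine sSup_le ?_
  rintro _ ⟨r, rfl, hr⟩
  refine le_iInf₂ fun x hx => ?_
  have := eval_nonneg_of_mem_certificates hr hx
  simpa using this

end Lasserre

/-- If the real variety `V_ℝ(h)` is finite, then Lasserre's hierarchy
has finite convergence: `f_k = f_min` for all `k` big enough. -/
theorem lasserre_finite_convergence_of_finite_realVariety
    {n m₁ m₂ : ℕ} (f : MvPolynomial (Fin n) ℝ)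
    (h : Fin m₁ → MvPolynomial (Fin n) ℝ) (g : Fin m₂ → MvPolynomial (Fin n) ℝ)
    (hfin : (realVariety h).Finite) :
    ∃ N : ℕ, ∀ k ≥ N, lasserreBound f h g k = fMin f (feasSet h g) := by
  rcases (feasSet h g).eq_empty_or_nonempty with hK | hK
  · obtain ⟨N₁, hN₁⟩ := exists_forall_add_C_mem_certificates (g := g) hfin (f := f) (by simp [hK])
    obtain ⟨N₂, hN₂⟩ := exists_forall_add_C_mem_certificates (g := g) hfin (f := C (-2))
      (by simp [hK])
    refine ⟨max N₁ N₂, fun k hk => le_antisymm (lasserreBound_le_fMin f) ?_⟩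
    rw [ge_iff_le, max_le_iff] at hk
    refine EReal.ge_of_forall_gt_iff_ge.1 fun z _ => ?_
    refine le_trans (EReal.coe_le_coe_iff.2 (le_max_left z (-1))) (le_lasserreBound ?_)
    convert certificates_add (hN₁ k hk.1 1 one_pos) (certificates_C_mul
      (neg_le_iff_add_nonneg.1 (le_max_right z (-1))) (hN₂ k hk.2 1 one_pos)) using 1
    rw [← C_add, ← C_mul, add_assoc, ← C_add, sub_eq_add_neg, ← C_neg]
    congr 2
    ring
  · obtain ⟨x, hx, hmin⟩ := Set.exists_min_image (feasSet h g) (fun x => eval x f)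
      (hfin.subset fun _ hx => hx.1) hK
    obtain ⟨N, hN⟩ := exists_forall_add_C_mem_certificates hfin (g := g) (f := f - C (eval x f))
      fun y hy => by simpa using hmin y hy
    refine ⟨N, fun k hk => le_antisymm (lasserreBound_le_fMin f) ?_⟩
    refine (iInf₂_le x hx).trans (EReal.ge_of_forall_gt_iff_ge.1 fun z hz => le_lasserreBound ?_)
    convert hN k hk (eval x f - z) (sub_pos.2 (EReal.coe_lt_coe_iff.1 hz)) using 1
    rw [C_sub]
    ring
end

section
/- Let f ∈ ℝ[x₁,…,xₙ] and let h = (h₁,…,h_{m₁}), g = (g₁,…,g_{m₂}) be tuples of polynomials in ℝ[x₁,…,xₙ]. If the real variety V_ℝ(h) is empty, then there exists N ∈ ℕ such that for every γ ∈ ℝ one has f − γ ∈ ⟨h⟩_{2N} + Q_N(g); consequently f_k = +∞ for all k ≥ N. -/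
open MvPolynomial Pointwise

universe u v

section

open Polynomial

theorem exists_linearOrder_of_isSquare_or_isSquare_neg (R : Type*) [Field R] [IsSemireal R]
    (hR : ∀ x : R, IsSquare x ∨ IsSquare (-x)) :
    ∃ _ : LinearOrder R, IsStrictOrderedRing R := by
  classical
  have key : ∀ {x : R}, IsSquare x → IsSquare (-x) → x = 0 := by
    rintro x ⟨a, rfl⟩ ⟨b, hb⟩
    by_contra hne
    have ha : a ≠ 0 := by rintro rfl; simp at hne
    refine IsSemireal.one_add_ne_zero (IsSumSq.mul_self (b / a)) ?_
    field_simp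
    linear_combination -hb
  have hsum : ∀ x : R, IsSumSq x → IsSquare x := by
    intro x hx
    induction hx with
    | zero => exact ⟨0, by simp⟩
    | sq_add a hs ih =>
      rename_i s
      rcases hR (a * a + s) with h | h
      · exact h
      · have hsq : IsSumSq s := hs
        obtain ⟨b, hb⟩ := h
        by_cases ha : a = 0
        · simpa [ha] using ih
        · exfalso
          have h1 : IsSumSq ((s + b * b) * ((1 / a) * (1 / a))) :=
            (hsq.add (.mul_self b)).mul (.mul_self _)
          refine IsSemireal.one_add_ne_zero h1 ?_
          field_simp
          linear_combination -hb
  let cone : RingCone R :=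
    { carrier := {x | IsSquare x}
      mul_mem' := fun ha hb => IsSquare.mul ha hb
      one_mem' := ⟨1, by simp⟩
      add_mem' := fun ha hb => hsum _ (ha.isSumSq.add hb.isSumSq)
      zero_mem' := ⟨0, by simp⟩
      eq_zero_of_mem_of_neg_mem' := fun ha hb => key ha hb }
  have : HasMemOrNegMem cone := ⟨fun x => hR x⟩
  let lo : LinearOrder R := .mkOfAddGroupCone cone
  have : IsOrderedRing R := .mkOfCone cone
  exact ⟨lo, IsOrderedRing.toIsStrictOrderedRing R⟩

theorem Polynomial.exists_irreducible_odd_natDegree_dvd {K : Type*} [Field K] {f : K[X]}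
    (hf : Odd f.natDegree) : ∃ q, Irreducible q ∧ Odd q.natDegree ∧ q ∣ f := by
  induction f using WfDvdMonoid.induction_on_irreducible with
  | zero => simp at hf
  | unit u hu => simp [natDegree_eq_zero_of_isUnit hu] at hf
  | mul a i ha hi ih =>
    rw [natDegree_mul hi.ne_zero ha] at hf
    by_cases h : Odd i.natDegree
    · exact ⟨i, hi, h, dvd_mul_right _ _⟩
    · have : Odd a.natDegree := by
        rw [Nat.odd_add] at hf
        by_contra h'
        exact h (hf.mpr (Nat.not_odd_iff_even.mp h'))
      obtain ⟨q, hq, hq', hqa⟩ := ih this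
      exact ⟨q, hq, hq', hqa.mul_left _⟩

instance Real.isRealClosed : IsRealClosed ℝ :=
  IsRealClosed.of_linearOrderedField (fun {x} hx => ⟨√x, (Real.mul_self_sqrt hx).symm⟩) <| by
    intro f hf
    obtain ⟨q, hq, hodd, hqf⟩ := exists_irreducible_odd_natDegree_dvd hf
    have h2 := hq.natDegree_le_two
    have h1 : q.natDegree = 1 := by
      obtain ⟨k, hk⟩ := hodd
      omega
    obtain ⟨x, hx⟩ :=
        exists_root_of_degree_eq_one (degree_eq_iff_natDegree_eq_of_pos one_pos |>.mpr h1)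
    exact ⟨x, hx.dvd hqf⟩

theorem IsSumSq.map_ringHom {A B : Type*} [Semiring A] [Semiring B] (φ : A →+* B) {s : A}
    (hs : IsSumSq s) : IsSumSq (φ s) := by
  induction hs with
  | zero => simp
  | sq_add a hs ih => simpa using .sq_add (φ a) ih

theorem IsSemireal.of_ringHom {A B : Type*} [Semiring A] [Semiring B] [IsSemireal B] (φ : A →+* B) :
    IsSemireal A :=
  ⟨fun {s} hs h => IsSemireal.one_add_ne_zero (hs.map_ringHom φ) (by
    have := congrArg φ h
    simpa using this)⟩

instance algebraicClosure.isRealClosed (K R : Type*) [Field K] [Field R] [Algebra K R]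
    [IsRealClosed R] : IsRealClosed (algebraicClosure K R) := by
  have : IsSemireal (algebraicClosure K R) := .of_ringHom (algebraMap _ R)
  have key : ∀ x : R, IsAlgebraic (algebraicClosure K R) x → ∃ y : algebraicClosure K R,
      (y : R) = x :=
    fun x hx => ⟨⟨x, mem_algebraicClosure_iff.mpr (hx.restrictScalars K)⟩, rfl⟩
  refine ⟨fun x => ?_, fun {f} hf => ?_⟩
  · have aux : ∀ x : algebraicClosure K R, IsSquare (x : R) → IsSquare x := by
      rintro x ⟨a, ha⟩
      have : IsAlgebraic (algebraicClosure K R) a := by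
        refine ⟨Polynomial.X ^ 2 - Polynomial.C x, X_pow_sub_C_ne_zero two_pos _, ?_⟩
        simp only [map_sub, map_pow, Polynomial.aeval_X, Polynomial.aeval_C]
        rw [show algebraMap (algebraicClosure K R) R x = (x : R) from rfl, ha]
        ring
      obtain ⟨y, rfl⟩ := key a this
      exact ⟨y, Subtype.ext ha⟩
    rcases IsRealClosed.isSquare_or_isSquare_neg (x : R) with h | h
    · exact .inl (aux x h)
    · exact .inr (aux (-x) h)
  · obtain ⟨a, ha⟩ := IsRealClosed.exists_isRoot_of_odd_natDegree
      (f := f.map (algebraMap (algebraicClosure K R) R)) (by simpa using hf)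
    have h0 : f ≠ 0 := by rintro rfl; simp at hf
    obtain ⟨y, rfl⟩ := key a ⟨f, h0, by simpa [IsRoot, eval_map_algebraMap] using ha⟩
    refine ⟨y, ?_⟩
    have : IsRoot (f.map (algebraMap (algebraicClosure K R) R))
        (algebraMap (algebraicClosure K R) R y) := ha
    exact this.of_map (algebraMap (algebraicClosure K R) R).injective

end

section

open Polynomial IntermediateField

theorem exists_sum_sq_adjoin {R L : Type*} [Field R] [Field L] [Algebra R L] {α : L}
    (hα : IsIntegral R α) {s : R⟮α⟯} (hs : IsSumSq s) :
    ∃ G : R[X], IsSumSq G ∧ G.natDegree ≤ 2 * ((minpoly R α).natDegree - 1) ∧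
      Polynomial.aeval α G = (s : L) := by
  induction hs with
  | zero => exact ⟨0, by simp⟩
  | sq_add a hs ih =>
    obtain ⟨G, hG, hdeg, hGs⟩ := ih
    have ha : (a : L) ∈ Algebra.adjoin R {α} := by
      rw [← adjoin_simple_toSubalgebra_of_isAlgebraic hα.isAlgebraic]
      exact a.2
    rw [Algebra.adjoin_singleton_eq_range_aeval] at ha
    obtain ⟨g, hg⟩ := ha
    have hmon := minpoly.monic hα
    have hgm : Polynomial.aeval α (g %ₘ minpoly R α) = (a : L) := by
      rw [← hg]
      exact aeval_modByMonic_eq_self_of_root (minpoly.aeval R α)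
    have hlt : (g %ₘ minpoly R α).natDegree < (minpoly R α).natDegree :=
      natDegree_modByMonic_lt _ hmon (minpoly.ne_one R α)
    refine ⟨_, .sq_add (g %ₘ minpoly R α) hG, ?_, ?_⟩
    · refine (natDegree_add_le _ _).trans (max_le ?_ hdeg)
      refine natDegree_mul_le.trans ?_
      omega
    · simp [hgm, hGs]

theorem Polynomial.isSumSq_leadingCoeff {R : Type*} [Field R] [LinearOrder R]
    [IsStrictOrderedRing R] {G : R[X]} (hG : IsSumSq G) :
    G = 0 ∨ (Even G.natDegree ∧ 0 < G.leadingCoeff) := by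
  induction hG with
  | zero => exact .inl rfl
  | sq_add a hs ih =>
    rename_i s
    by_cases ha : a = 0
    · simpa [ha] using ih
    have haa : Even (a * a).natDegree ∧ 0 < (a * a).leadingCoeff := by
      rw [natDegree_mul ha ha, leadingCoeff_mul]
      exact ⟨⟨_, rfl⟩, mul_self_pos.mpr (leadingCoeff_ne_zero.mpr ha)⟩
    right
    rcases ih with rfl | ⟨hev, hpos⟩
    · simpa using haa
    rcases lt_trichotomy (a * a).natDegree s.natDegree with h | h | h
    · rw [natDegree_add_eq_right_of_natDegree_lt h,
        leadingCoeff_add_of_degree_lt (degree_lt_degree h)]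
      exact ⟨hev, hpos⟩
    · have hne : (a * a).leadingCoeff + s.leadingCoeff ≠ 0 := (add_pos haa.2 hpos).ne'
      have hdeg : (a * a).degree = s.degree := by
        rw [degree_eq_natDegree (mul_ne_zero ha ha), h, degree_eq_natDegree]
        rintro rfl; simp at hpos
      rw [leadingCoeff_add_of_degree_eq hdeg hne]
      refine ⟨?_, add_pos haa.2 hpos⟩
      have := degree_add_eq_of_leadingCoeff_add_ne_zero hne
      rw [hdeg, max_self] at this
      rwa [natDegree_eq_of_degree_eq this]
    · rw [natDegree_add_eq_left_of_natDegree_lt h,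
        leadingCoeff_add_of_degree_lt' (degree_lt_degree h)]
      exact haa

/-- A semireal field all of whose proper simple algebraic extensions (inside an algebraically closed
field) fail to be semireal is real closed. -/
theorem IsRealClosed.of_forall_adjoin {R Ω : Type*} [Field R] [Field Ω] [Algebra R Ω]
    [IsAlgClosed Ω] [IsSemireal R]
    (hmax : ∀ α : Ω, IsIntegral R α → IsSemireal R⟮α⟯ → ∃ r, algebraMap R Ω r = α) :
    IsRealClosed R := by
  have hneg : ∀ α : Ω, IsIntegral R α → (∀ r, algebraMap R Ω r ≠ α) →
      ∃ G : R[X], IsSumSq G ∧ G.natDegree ≤ 2 * ((minpoly R α).natDegree - 1) ∧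
        Polynomial.aeval α (1 + G) = 0 := by
    intro α hα hne
    by_contra! hcon
    obtain ⟨r, hr⟩ := hmax α hα ⟨fun {s} hs h => by
      obtain ⟨G, hG, hdeg, hGs⟩ := exists_sum_sq_adjoin hα hs
      refine hcon G hG hdeg ?_
      have := congrArg (algebraMap R⟮α⟯ Ω) h
      simpa [hGs] using this⟩
    exact hne r hr
  have hsq : ∀ a : R, IsSquare a ∨ IsSumSq (-a) := by
    intro a
    obtain ⟨α, hα⟩ := IsAlgClosed.exists_pow_nat_eq (algebraMap R Ω a) two_pos
    have hint : IsIntegral R α :=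
        ⟨Polynomial.X ^ 2 - Polynomial.C a, monic_X_pow_sub_C a two_ne_zero, by simp [hα]⟩
    by_cases hr : ∃ r, algebraMap R Ω r = α
    · obtain ⟨r, rfl⟩ := hr
      left
      refine ⟨r, (algebraMap R Ω).injective ?_⟩
      rw [← hα]; simp [sq]
    right
    push Not at hr
    obtain ⟨G, hG, -, hroot⟩ := hneg α hint hr
    have key : ∀ G : R[X], IsSumSq G → ∃ u v w : R, IsSumSq u ∧ IsSumSq v ∧
        Polynomial.aeval α G = algebraMap R Ω (u + a * v) + algebraMap R Ω w * α := by
      intro G hG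
      induction hG with
      | zero => exact ⟨0, 0, 0, by simp⟩
      | sq_add g hs ih =>
        obtain ⟨u, v, w, hu, hv, h⟩ := ih
        obtain ⟨b, c, hbc⟩ : ∃ b c : R,
            Polynomial.aeval α g = algebraMap R Ω b + algebraMap R Ω c * α := by
          have hm := monic_X_pow_sub_C a two_ne_zero
          have h1 : Polynomial.aeval α (g %ₘ (Polynomial.X ^ 2 - Polynomial.C a)) =
              Polynomial.aeval α g :=
            aeval_modByMonic_eq_self_of_root (by simp [hα])
          have h2 : (g %ₘ (Polynomial.X ^ 2 - Polynomial.C a)).natDegree ≤ 1 := by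
            have := natDegree_modByMonic_lt g hm (by
              intro h; have := congrArg natDegree h; simp at this)
            simp at this
            omega
          obtain ⟨c, b, h3⟩ := exists_eq_X_add_C_of_natDegree_le_one h2
          refine ⟨b, c, ?_⟩
          rw [← h1, h3]; simp; ring
        refine ⟨b * b + u, c * c + v, 2 * b * c + w, .sq_add b hu, .sq_add c hv, ?_⟩
        simp only [map_add, map_mul, hbc, h, map_ofNat]
        linear_combination (algebraMap R Ω c) ^ 2 * hα
    obtain ⟨u, v, w, hu, hv, h⟩ := key G hG
    have h0 : algebraMap R Ω (1 + u + a * v) + algebraMap R Ω w * α = 0 := by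
      rw [← hroot]; simp [h]; ring
    have hw : w = 0 := by
      by_contra hw
      refine hr (-(1 + u + a * v) / w) ?_
      have : algebraMap R Ω w ≠ 0 := by simpa using hw
      rw [map_div₀, map_neg]
      field_simp
      linear_combination -h0
    have h1 : 1 + u + a * v = 0 := (algebraMap R Ω).injective (by simpa [hw] using h0)
    have hv0 : v ≠ 0 := by
      rintro rfl
      exact IsSemireal.one_add_ne_zero hu (by simpa using h1)
    have : -a = (1 + u) * v * ((1 / v) * (1 / v)) := by
      field_simp
      linear_combination -h1
    rw [this]
    exact ((IsSumSq.one.add hu).mul hv).mul (.mul_self _)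
  have hsq' : ∀ a : R, IsSquare a ∨ IsSquare (-a) := by
    intro a
    rcases hsq a with h | h
    · exact .inl h
    rcases hsq (-a) with h' | h'
    · exact .inr h'
    left
    rw [neg_neg] at h'
    by_cases ha : a = 0
    · exact ⟨0, by simp [ha]⟩
    exfalso
    refine IsSemireal.one_add_ne_zero ((h.mul h').mul (.mul_self (1 / a))) ?_
    field_simp
    ring
  refine ⟨hsq', ?_⟩
  obtain ⟨_, _⟩ := exists_linearOrder_of_isSquare_or_isSquare_neg R hsq'
  intro f hf
  induction hn : f.natDegree using Nat.strong_induction_on generalizing f with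
  | _ n ih =>
  obtain ⟨q, hq, hodd, hqf⟩ := exists_irreducible_odd_natDegree_dvd hf
  have hqn : q.natDegree ≤ n := hn ▸ natDegree_le_of_dvd hqf (by rintro rfl; simp at hf)
  suffices ∃ x, q.IsRoot x from this.imp fun x hx => hx.dvd hqf
  obtain ⟨α, hα⟩ := IsAlgClosed.exists_aeval_eq_zero Ω q hq.degree_pos.ne'
  have hint : IsIntegral R α := IsAlgebraic.isIntegral ⟨q, hq.ne_zero, hα⟩
  by_cases hr : ∃ r, algebraMap R Ω r = α
  · obtain ⟨r, rfl⟩ := hr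
    exact ⟨r, by simpa [Polynomial.aeval_algebraMap_apply] using hα⟩
  push Not at hr
  obtain ⟨G, hG, hdeg, hroot⟩ := hneg α hint hr
  have hmin : (minpoly R α).natDegree = q.natDegree := by
    have h1 := minpoly.dvd R α hα
    exact natDegree_eq_of_degree_eq (degree_eq_degree_of_associated
      ((minpoly.irreducible hint).associated_of_dvd hq h1))
  have hG1 : IsSumSq (1 + G) := IsSumSq.one.add hG
  have hG0 : 1 + G ≠ 0 := fun h => by
    have : IsSumSq (Polynomial.eval 0 G) := hG.map_ringHom (evalRingHom 0)
    refine IsSemireal.one_add_ne_zero this ?_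
    simpa using congrArg (Polynomial.eval 0) h
  obtain ⟨k, hk⟩ := (minpoly.dvd R α hroot)
  have hk0 : k ≠ 0 := by rintro rfl; simp [hk] at hG0
  have hev := ((isSumSq_leadingCoeff hG1).resolve_left hG0).1
  have hdk := congrArg natDegree hk
  rw [natDegree_mul (minpoly.ne_zero hint) hk0] at hdk
  have hdeg' : (1 + G).natDegree ≤ 2 * ((minpoly R α).natDegree - 1) := by
    refine (natDegree_add_le _ _).trans (max_le (by simp) hdeg)
  have hkodd : Odd k.natDegree := by
    rw [hdk, hmin, Nat.even_add'] at hev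
    exact hev.mp hodd
  have hq1 : 0 < q.natDegree := hodd.pos
  obtain ⟨x, hx⟩ := ih k.natDegree (by omega) hkodd rfl
  exfalso
  have : IsSumSq (Polynomial.eval x G) := hG.map_ringHom (evalRingHom x)
  refine IsSemireal.one_add_ne_zero this ?_
  have h := congrArg (Polynomial.eval x) hk
  simpa [hx.eq_zero] using h

theorem IsSumSq.exists_of_coe_iSup {K L : Type*} [Field K] [Field L] [Algebra K L]
    {ι : Type*} [Nonempty ι] {t : ι → IntermediateField K L} (dir : Directed (· ≤ ·) t)
    {s : L} {T : IntermediateField K L} (hT : T = iSup t) {x : T} (hx : IsSumSq x)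
    (hxs : (x : L) = s) :
    ∃ i, ∃ y : t i, IsSumSq y ∧ (y : L) = s := by
  induction hx generalizing s with
  | zero => exact ⟨Classical.arbitrary ι, 0, by simp, by simpa using hxs⟩
  | sq_add a hs ih =>
    obtain ⟨i, y, hy, hys⟩ := ih rfl
    have ha : (a : L) ∈ ⋃ i, (t i : Set L) := by
      rw [← coe_iSup_of_directed dir, ← hT]; exact a.2
    obtain ⟨j, hj⟩ := Set.mem_iUnion.mp ha
    obtain ⟨k, hik, hjk⟩ := dir i j
    refine ⟨k, ⟨a, hjk hj⟩ * ⟨a, hjk hj⟩ + inclusion hik y,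
      .sq_add _ (hy.map_ringHom (inclusion hik).toRingHom), ?_⟩
    rw [← hxs]
    simp [hys]

theorem IsSemireal.exists_isRealClosed (K : Type*) [Field K] [IsSemireal K] :
    ∃ R : IntermediateField K (AlgebraicClosure K), IsRealClosed R := by
  obtain ⟨R, hR⟩ := zorn_le₀ {E : IntermediateField K (AlgebraicClosure K) | IsSemireal E} (by
    intro c hc hchain
    rcases c.eq_empty_or_nonempty with rfl | hne
    · exact ⟨⊥, .of_ringHom (botEquiv K (AlgebraicClosure K)).toRingEquiv.toRingHom, by simp⟩
    have := hne.to_subtype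
    refine ⟨⨆ E : c, E.1, ⟨fun {s} hs h => ?_⟩, fun E hE => le_iSup (fun E : c => E.1) ⟨E, hE⟩⟩
    have hdir : Directed (· ≤ ·) (fun E : c => E.1) := hchain.directedOn.directed_val
    obtain ⟨i, y, hy, hys⟩ := hs.exists_of_coe_iSup hdir rfl rfl
    have := hc i.2
    refine this.one_add_ne_zero hy (Subtype.ext ?_)
    have h' := congrArg Subtype.val h
    simpa [hys] using h')
  have hsemi : IsSemireal R := hR.prop
  refine ⟨R, IsRealClosed.of_forall_adjoin (Ω := AlgebraicClosure K) fun α hα hs => ?_⟩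
  have hle : R ≤ (R⟮α⟯).restrictScalars K := fun x hx => by
    rw [mem_restrictScalars]
    exact (R⟮α⟯).algebraMap_mem ⟨x, hx⟩
  have := hR.le_of_ge (y := (R⟮α⟯).restrictScalars K) hs hle
  exact ⟨⟨α, this (by rw [mem_restrictScalars]; exact mem_adjoin_simple_self R α)⟩, rfl⟩

namespace IsRealClosed

variable {R : Type*} [Field R] [IsRealClosed R]

theorem finrank_eq_one_of_odd {L : Type*} [Field L] [Algebra R L] [FiniteDimensional R L]
    (h : Odd (Module.finrank R L)) : Module.finrank R L = 1 := by
  obtain ⟨α, hα⟩ := Field.exists_primitive_element R L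
  have hint : IsIntegral R α := .of_finite R α
  have hdeg : (minpoly R α).natDegree = Module.finrank R L := by
    rw [← adjoin.finrank hint, hα, finrank_top']
  rw [← hdeg] at h ⊢
  obtain ⟨x, hx⟩ := exists_isRoot_of_odd_natDegree h
  exact natDegree_eq_of_degree_eq_some
    (degree_eq_one_of_irreducible_of_root (minpoly.irreducible hint) hx)

/-- An element of the form `a + b i` in an extension of a real closed field is a square of an
element of the same form. -/
theorem exists_sq_eq_add_mul {L : Type*} [Field L] [Algebra R L] {i : L} (hi : i ^ 2 = -1)
    (a b : R) : ∃ c d : R, (algebraMap R L c + algebraMap R L d * i) ^ 2 =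
      algebraMap R L a + algebraMap R L b * i := by
  obtain ⟨_, _⟩ := exists_linearOrder_of_isSquare_or_isSquare_neg R isSquare_or_isSquare_neg
  suffices ∃ c d : R, c ^ 2 - d ^ 2 = a ∧ 2 * c * d = b by
    obtain ⟨c, d, rfl, rfl⟩ := this
    refine ⟨c, d, ?_⟩
    simp only [map_sub, map_mul, map_pow, map_ofNat]
    linear_combination (algebraMap R L d) ^ 2 * hi
  obtain ⟨N, hN0, hN⟩ : ∃ N : R, 0 ≤ N ∧ N ^ 2 = a ^ 2 + b ^ 2 := by
    obtain ⟨N, hN⟩ : IsSquare (a ^ 2 + b ^ 2) := .of_nonneg (by positivity)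
    exact ⟨|N|, abs_nonneg N, by rw [sq_abs, hN, sq]⟩
  have hNa : |a| ≤ N := abs_le_of_sq_le_sq (by nlinarith [sq_nonneg b]) hN0
  obtain ⟨h1, h2⟩ := abs_le.mp hNa
  obtain ⟨c, hc⟩ : IsSquare ((N + a) / 2) := .of_nonneg (by linarith)
  obtain ⟨d, hd⟩ : IsSquare ((N - a) / 2) := .of_nonneg (by linarith)
  have hsq : (2 * c * d) ^ 2 = b ^ 2 := by
    have : (2 * c * d) ^ 2 = 4 * (c * c) * (d * d) := by ring
    rw [this, ← hc, ← hd]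
    linear_combination hN
  rcases sq_eq_sq_iff_eq_or_eq_neg.mp hsq with h | h
  · exact ⟨c, d, by linear_combination -hc + hd, h⟩
  · exact ⟨c, -d, by linear_combination -hc + hd, by linear_combination -h⟩

theorem exists_sq_eq_of_finrank_eq_two {K M : Type*} [Field K] [CharZero K] [Field M] [Algebra K M]
    (h : Module.finrank K M = 2) :
    ∃ (x : M) (d : K), x ^ 2 = algebraMap K M d ∧ (∀ k : K, algebraMap K M k ≠ x) ∧
      ∀ y : M, ∃ u v : K, y = algebraMap K M u + algebraMap K M v * x := by
  have : FiniteDimensional K M := .of_finrank_pos (by omega)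
  obtain ⟨x, hx⟩ := Field.exists_primitive_element K M
  have hint : IsIntegral K x := .of_finite K x
  have hdeg : (minpoly K x).natDegree = 2 := by
    rw [← adjoin.finrank hint, hx, finrank_top', h]
  have hroot : x ^ 2 + algebraMap K M ((minpoly K x).coeff 1) * x +
      algebraMap K M ((minpoly K x).coeff 0) = 0 := by
    have h0 := minpoly.aeval K x
    have hm : (minpoly K x).coeff 2 = 1 := by
      have := minpoly.monic hint
      rwa [Monic, leadingCoeff, hdeg] at this
    rw [aeval_eq_sum_range, hdeg] at h0
    simp [Finset.sum_range_succ, hm, Algebra.smul_def] at h0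
    linear_combination h0
  set b := (minpoly K x).coeff 1
  set c := (minpoly K x).coeff 0
  refine ⟨x + algebraMap K M (b / 2), b ^ 2 / 4 - c, ?_, ?_, ?_⟩
  · have e1 : algebraMap K M b = 2 * algebraMap K M (b / 2) := by
      rw [← map_ofNat (algebraMap K M) 2, ← map_mul]; congr 1; field_simp
    have e2 : algebraMap K M (b ^ 2 / 4 - c) = (algebraMap K M (b / 2)) ^ 2 - algebraMap K M c := by
      rw [← map_pow, ← map_sub]; congr 1; ring
    rw [e2]
    linear_combination hroot - x * e1
  · intro k hk
    have hmem : x ∈ (algebraMap K M).range := ⟨k - b / 2, by rw [map_sub, hk]; ring⟩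
    have := (minpoly.natDegree_eq_one_iff (A := K) (x := x)).mpr hmem
    omega
  · intro y
    have hy : y ∈ Algebra.adjoin K {x} := by
      rw [← adjoin_simple_toSubalgebra_of_isAlgebraic hint.isAlgebraic, hx]; trivial
    rw [Algebra.adjoin_singleton_eq_range_aeval] at hy
    obtain ⟨g, hg⟩ := hy
    have h1 : Polynomial.aeval x (g %ₘ minpoly K x) = y := by
      rw [← hg]; exact aeval_modByMonic_eq_self_of_root (minpoly.aeval K x)
    have hlt := natDegree_modByMonic_lt g (minpoly.monic hint) (minpoly.ne_one K x)
    obtain ⟨v, u, h3⟩ := exists_eq_X_add_C_of_natDegree_le_one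
      (show (g %ₘ minpoly K x).natDegree ≤ 1 by omega)
    refine ⟨u - v * (b / 2), v, ?_⟩
    rw [← h1, h3]; simp; ring

theorem not_exists_quadratic_tower {M₁ M₂ : Type*} [Field M₁] [Field M₂] [Algebra R M₁]
    [Algebra M₁ M₂] (h₁ : Module.finrank R M₁ = 2) (h₂ : Module.finrank M₁ M₂ = 2) : False := by
  have : CharZero M₁ := charZero_of_injective_algebraMap (algebraMap R M₁).injective
  obtain ⟨x, d, hx, hxn, hspan⟩ := exists_sq_eq_of_finrank_eq_two h₁
  obtain ⟨y, w, hy, hyn, -⟩ := exists_sq_eq_of_finrank_eq_two h₂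
  have hd : ¬ IsSquare d := by
    rintro ⟨e, rfl⟩
    have : (x - algebraMap R M₁ e) * (x + algebraMap R M₁ e) = 0 := by
      rw [map_mul] at hx; linear_combination hx
    rcases mul_eq_zero.mp this with h | h
    · exact hxn e (by linear_combination -h)
    · exact hxn (-e) (by rw [map_neg]; linear_combination -h)
  obtain ⟨e, he⟩ := isSquare_neg_of_not_isSquare hd
  have he0 : e ≠ 0 := by
    rintro rfl
    exact hd ⟨0, by linear_combination -he⟩
  have he0' : algebraMap R M₁ e ≠ 0 := by simpa using he0
  have hxe : x ^ 2 = -(algebraMap R M₁ e) ^ 2 := by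
    rw [hx, ← map_pow, ← map_neg]; congr 1; linear_combination -he
  have hi : (x / algebraMap R M₁ e) ^ 2 = -1 := by
    rw [div_pow, hxe]; field_simp
  obtain ⟨u, v, huv⟩ := hspan w
  obtain ⟨c, f, hcf⟩ := exists_sq_eq_add_mul hi u (v * e)
  have hw : (algebraMap R M₁ c + algebraMap R M₁ f * (x / algebraMap R M₁ e)) ^ 2 = w := by
    rw [hcf, huv, map_mul]; field_simp
  generalize algebraMap R M₁ c + algebraMap R M₁ f * (x / algebraMap R M₁ e) = z at hw
  have : (y - algebraMap M₁ M₂ z) * (y + algebraMap M₁ M₂ z) = 0 := by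
    rw [← hw, map_pow] at hy; linear_combination hy
  rcases mul_eq_zero.mp this with h | h
  · exact hyn z (by linear_combination -h)
  · exact hyn (-z) (by rw [map_neg]; linear_combination -h)

theorem finrank_le_two_of_isGalois {L : Type*} [Field L] [Algebra R L] [FiniteDimensional R L]
    [IsGalois R L] : Module.finrank R L ≤ 2 := by
  have hcard : Nat.card (L ≃ₐ[R] L) = Module.finrank R L := IsGalois.card_aut_eq_finrank R L
  obtain ⟨k, m, hm, hkm⟩ := Nat.exists_eq_two_pow_mul_odd
    (n := Nat.card (L ≃ₐ[R] L)) Nat.card_pos.ne'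
  have key : ∀ H : Subgroup (L ≃ₐ[R] L), Module.finrank R (fixedField H) * Nat.card H =
      Nat.card (L ≃ₐ[R] L) := by
    intro H
    rw [← finrank_fixedField_eq_card H, Module.finrank_mul_finrank, hcard]
  have hm1 : m = 1 := by
    obtain ⟨H, hH⟩ := Sylow.exists_subgroup_card_pow_prime (G := L ≃ₐ[R] L) 2 (n := k)
      (by rw [hkm]; exact dvd_mul_right _ _)
    have h := key H
    rw [hH, hkm, mul_comm] at h
    have h' : Module.finrank R (fixedField H) = m := Nat.eq_of_mul_eq_mul_left (by positivity) h
    rw [← h']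
    exact finrank_eq_one_of_odd (h' ▸ hm)
  rw [hm1, mul_one] at hkm
  rw [← hcard, hkm]
  by_contra! hlt
  have hk : 2 ≤ k := by
    by_contra! hk
    interval_cases k <;> simp at hlt
  obtain ⟨l, rfl⟩ := Nat.exists_eq_add_of_le' hk
  obtain ⟨H₂, hH₂⟩ := Sylow.exists_subgroup_card_pow_prime (G := L ≃ₐ[R] L) 2 (n := l)
    (by rw [hkm]; exact pow_dvd_pow 2 (by omega))
  obtain ⟨H₁, hH₁, hle⟩ := Sylow.exists_subgroup_card_pow_prime_le (G := L ≃ₐ[R] L) 2 (n := l)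
    (m := l + 1) (by rw [hkm]; exact pow_dvd_pow 2 (by omega)) H₂ hH₂ (by omega)
  have hf : fixedField H₁ ≤ fixedField H₂ := fixedField_antitone hle
  have h1 := key H₁
  have h2 := key H₂
  rw [hH₁, hkm] at h1
  rw [hH₂, hkm] at h2
  have e1 : Module.finrank R (fixedField H₁) = 2 := by
    refine Nat.eq_of_mul_eq_mul_right (show 0 < 2 ^ (l + 1) by positivity) ?_
    rw [h1]; ring
  have e2 : Module.finrank R (fixedField H₂) = 4 := by
    refine Nat.eq_of_mul_eq_mul_right (show 0 < 2 ^ l by positivity) ?_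
    rw [h2]; ring
  let := (inclusion hf).toRingHom.toAlgebra
  have : IsScalarTower R (fixedField H₁) (fixedField H₂) :=
    .of_algebraMap_eq fun x => ((inclusion hf).commutes x).symm
  have e3 := Module.finrank_mul_finrank R (fixedField H₁) (fixedField H₂)
  exact not_exists_quadratic_tower (R := R) e1
    (show Module.finrank (fixedField H₁) (fixedField H₂) = 2 by rw [e1, e2] at e3; omega)

theorem natDegree_le_two_of_irreducible {q : R[X]} (hq : Irreducible q) : q.natDegree ≤ 2 := by
  have : IsGalois R q.SplittingField :=
    IsGalois.of_separable_splitting_field (p := q) hq.separable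
  have h := finrank_le_two_of_isGalois (R := R) (L := q.SplittingField)
  obtain ⟨α, hα⟩ := (SplittingField.splits q).exists_eval_eq_zero
    (by rw [degree_map]; exact hq.degree_pos.ne')
  rw [eval_map_algebraMap] at hα
  have hint : IsIntegral R α := .of_finite R α
  have hmin : (minpoly R α).natDegree = q.natDegree :=
    natDegree_eq_of_degree_eq (degree_eq_degree_of_associated
      ((minpoly.irreducible hint).associated_of_dvd hq (minpoly.dvd R α hα)))
  rw [← hmin]
  exact (minpoly.natDegree_le α).trans h

/-- The monic irreducible polynomials over a real closed field. -/
theorem eq_X_sub_C_or_of_irreducible {q : R[X]} (hq : Irreducible q) (hm : q.Monic) :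
    (∃ z, q = Polynomial.X - Polynomial.C z) ∨
      ∃ b e, e ≠ 0 ∧ q = (Polynomial.X - Polynomial.C b) ^ 2 + Polynomial.C (e ^ 2) := by
  have h2 := natDegree_le_two_of_irreducible hq
  have h1 := hq.natDegree_pos
  interval_cases hn : q.natDegree
  · left
    refine ⟨-q.coeff 0, ?_⟩
    rw [hm.eq_X_add_C hn]; simp
  · right
    have hq2 : q.coeff 2 = 1 := by rwa [Monic, leadingCoeff, hn] at hm
    have hform : q = (Polynomial.X - Polynomial.C (-q.coeff 1 / 2)) ^ 2 +
        Polynomial.C (q.coeff 0 - (q.coeff 1) ^ 2 / 4) := by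
      have hq' := q.as_sum_range_C_mul_X_pow
      rw [hn] at hq'
      simp [Finset.sum_range_succ, hq2] at hq'
      have e : Polynomial.C (q.coeff 1) = 2 * Polynomial.C (q.coeff 1 / 2) := by
        rw [← C_ofNat, ← Polynomial.C_mul]; congr 1; field_simp
      have e' : Polynomial.C ((q.coeff 1) ^ 2 / 4) = Polynomial.C (q.coeff 1 / 2) ^ 2 := by
        rw [← Polynomial.C_pow]; congr 1; ring
      conv_lhs => rw [hq']
      rw [Polynomial.C_sub, e', neg_div, Polynomial.C_neg]
      linear_combination Polynomial.X * e
    have hroot : ∀ x, q.eval x ≠ 0 := by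
      intro x hx
      have h := natDegree_eq_of_degree_eq_some (n := 1) (degree_eq_one_of_irreducible_of_root hq hx)
      omega
    generalize q.coeff 0 - (q.coeff 1) ^ 2 / 4 = d at hform
    generalize -q.coeff 1 / 2 = b at hform
    have hd : ¬ IsSquare (-d) := by
      rintro ⟨e, he⟩
      refine hroot (b + e) ?_
      rw [hform]; simp; linear_combination -he
    obtain ⟨e, rfl⟩ : IsSquare d := .of_not_isSquare_neg hd
    refine ⟨b, e, ?_, by rw [hform, sq e]⟩
    rintro rfl
    exact hd ⟨0, by simp⟩

end IsRealClosed

namespace IsRealClosed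

theorem monotone_ringHom {R R' : Type*} [Field R] [LinearOrder R] [IsStrictOrderedRing R]
    [IsRealClosed R] [Field R'] [LinearOrder R'] [IsStrictOrderedRing R'] (φ : R →+* R') :
    StrictMono φ := by
  refine Monotone.strictMono_of_injective (fun a b hab => ?_) φ.injective
  obtain ⟨c, hc⟩ : IsSquare (b - a) := .of_nonneg (sub_nonneg.mpr hab)
  rw [← sub_nonneg, ← map_sub, hc, map_mul]
  exact mul_self_nonneg _

variable {R R' : Type*} [Field R] [LinearOrder R] [IsStrictOrderedRing R] [IsRealClosed R]
  [Field R'] [LinearOrder R'] [IsStrictOrderedRing R'] [Algebra R R']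

theorem sign_algebraMap (r : R) :
    SignType.sign (algebraMap R R' r) = SignType.sign r := by
  have h := monotone_ringHom (algebraMap R R')
  rcases lt_trichotomy r 0 with hr | rfl | hr
  · rw [sign_neg hr, sign_neg (by simpa using h hr)]
  · simp
  · rw [sign_pos hr, sign_pos (by simpa using h hr)]

/-- The sign of a polynomial is constant on the gaps between its roots, even across an extension. -/
theorem sign_aeval_eq_sign_eval {u : R[X]} (hu : u ≠ 0) {a : R} {t : R'}
    (h : ∀ z ∈ u.roots, (z < a ∧ algebraMap R R' z < t) ∨ (a < z ∧ t < algebraMap R R' z)) :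
    SignType.sign (Polynomial.aeval t u) = SignType.sign (u.eval a) := by
  induction u using WfDvdMonoid.induction_on_irreducible with
  | zero => simp at hu
  | unit u hunit =>
    obtain ⟨c, -, rfl⟩ := isUnit_iff.mp hunit
    simp [sign_algebraMap]
  | mul p i hp hi ih =>
    rw [map_mul, Polynomial.eval_mul, sign_mul, sign_mul,
      ih hp fun z hz => h z (by rw [roots_mul hu]; exact Multiset.mem_add.mpr (.inr hz))]
    congr 1
    have hlc : i.leadingCoeff ≠ 0 := leadingCoeff_ne_zero.mpr hi.ne_zero
    have hassoc : Associated i (i * Polynomial.C i.leadingCoeff⁻¹) :=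
      associated_mul_unit_right _ _ (isUnit_C.mpr (inv_ne_zero hlc).isUnit)
    have hcls := eq_X_sub_C_or_of_irreducible (hassoc.irreducible hi)
      (monic_mul_leadingCoeff_inv hi.ne_zero)
    have hi' : i = Polynomial.C i.leadingCoeff * (i * Polynomial.C i.leadingCoeff⁻¹) := by
      rw [mul_left_comm, ← Polynomial.C_mul, mul_inv_cancel₀ hlc, Polynomial.C_1, mul_one]
    generalize i * Polynomial.C i.leadingCoeff⁻¹ = q at hcls hi'
    generalize i.leadingCoeff = c at hlc hi'
    subst hi'
    rw [map_mul, Polynomial.eval_mul, sign_mul, sign_mul, Polynomial.aeval_C, Polynomial.eval_C,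
        sign_algebraMap]
    congr 1
    rcases hcls with ⟨z, rfl⟩ | ⟨b, e, he, rfl⟩
    · have hz := h z (by
        rw [mem_roots hu, IsRoot]; simp)
      simp only [map_sub, Polynomial.aeval_X, Polynomial.aeval_C, Polynomial.eval_sub,
          Polynomial.eval_X, Polynomial.eval_C]
      rcases hz with ⟨h1, h2⟩ | ⟨h1, h2⟩
      · rw [sign_pos (sub_pos.mpr h1), sign_pos (sub_pos.mpr h2)]
      · rw [sign_neg (sub_neg.mpr h1), sign_neg (sub_neg.mpr h2)]
    · have he' : algebraMap R R' e ≠ 0 := by simpa using he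
      simp only [map_add, map_pow, map_sub, Polynomial.aeval_X, Polynomial.aeval_C,
          Polynomial.eval_add, Polynomial.eval_pow, Polynomial.eval_sub, Polynomial.eval_X,
        Polynomial.eval_C]
      rw [sign_pos (by positivity), sign_pos (by positivity)]

theorem exists_eval_sign_eq (U : Finset R[X]) (hU : ∀ u ∈ U, u ≠ 0) {t : R'}
    (ht : ∀ r, algebraMap R R' r ≠ t) :
    ∃ a : R, ∀ u ∈ U, SignType.sign (Polynomial.aeval t u) = SignType.sign (u.eval a) := by
  classical
  let Z : Finset R := U.biUnion fun u => u.roots.toFinset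
  obtain ⟨a, hlo, hhi⟩ := Order.exists_between_finsets (Z.filter (algebraMap R R' · < t))
    (Z.filter (t < algebraMap R R' ·)) (fun x hx y hy =>
      (monotone_ringHom (algebraMap R R')).lt_iff_lt.mp
        ((Finset.mem_filter.mp hx).2.trans (Finset.mem_filter.mp hy).2))
  refine ⟨a, fun u hu => sign_aeval_eq_sign_eval (hU u hu) fun z hz => ?_⟩
  have hzZ : z ∈ Z := Finset.mem_biUnion.mpr ⟨u, hu, Multiset.mem_toFinset.mpr hz⟩
  rcases lt_or_gt_of_ne (ht z) with h | h
  · exact .inl ⟨hlo z (Finset.mem_filter.mpr ⟨hzZ, h⟩), h⟩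
  · exact .inr ⟨hhi z (Finset.mem_filter.mpr ⟨hzZ, h⟩), h⟩

/-- Finitely many rational functions over a real closed field can be specialized to elements of that
field without changing their signs. -/
theorem exists_algHom_adjoin_sign_eq {K : Type*} [Field K] [Algebra R K] [Algebra K R']
    [IsScalarTower R K R'] {t : K} (ht : Transcendental R t)
    (hK : ∀ d : K, ∃ u v : R[X], v ≠ 0 ∧ d * Polynomial.aeval t v = Polynomial.aeval t u)
    (T : Finset K) :
    ∃ φ : Algebra.adjoin R (T : Set K) →ₐ[R] R, ∀ d : Algebra.adjoin R (T : Set K), (d : K) ∈ T →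
      SignType.sign (algebraMap K R' d) = SignType.sign (φ d) := by
  classical
  choose u v hv huv using hK
  have haev : ∀ w : R[X], w ≠ 0 → Polynomial.aeval t w ≠ 0 := fun w hw h =>
    ht ⟨w, hw, h⟩
  have ht' : ∀ r, algebraMap R R' r ≠ algebraMap K R' t := by
    intro r hr
    rw [IsScalarTower.algebraMap_apply R K R'] at hr
    exact ht ((algebraMap K R').injective hr ▸ isAlgebraic_algebraMap r)
  obtain ⟨a, ha⟩ := exists_eval_sign_eq (((T.image u) ∪ (T.image v)).filter (· ≠ 0))
    (fun w hw => (Finset.mem_filter.mp hw).2) ht'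
  have hva : ∀ d ∈ T, (v d).eval a ≠ 0 := by
    intro d hd
    have h := ha (v d) (Finset.mem_filter.mpr
      ⟨Finset.mem_union_right _ (Finset.mem_image_of_mem v hd), hv d⟩)
    rw [← sign_ne_zero, ← h, sign_ne_zero, Polynomial.aeval_algebraMap_apply]
    simpa using haev _ (hv d)
  let c : R[X] := ∏ d ∈ T, v d
  have hc0 : c ≠ 0 := Finset.prod_ne_zero_iff.mpr fun d _ => hv d
  have hca : c.eval a ≠ 0 := by
    rw [Polynomial.eval_prod]; exact Finset.prod_ne_zero_iff.mpr hva
  let L := Localization.Away c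
  let f₁ : L →ₐ[R] K := IsLocalization.liftAlgHom (M := Submonoid.powers c)
      (f := Polynomial.aeval t) (by
    rintro ⟨_, n, rfl⟩
    simpa using (pow_ne_zero n (haev c hc0)).isUnit)
  let f₂ : L →ₐ[R] R := IsLocalization.liftAlgHom (M := Submonoid.powers c)
      (f := Polynomial.aeval a) (by
    rintro ⟨_, n, rfl⟩
    simpa [Polynomial.aeval_def] using (pow_ne_zero n hca).isUnit)
  have hf₁ : ∀ w : R[X], f₁ (algebraMap R[X] L w) = Polynomial.aeval t w := fun w => by
    simp [f₁, IsLocalization.liftAlgHom_apply]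
  have hf₂ : ∀ w : R[X], f₂ (algebraMap R[X] L w) = w.eval a := fun w => by
    simp [f₂, IsLocalization.liftAlgHom_apply]
  have hinj : Function.Injective f₁ := by
    rw [injective_iff_map_eq_zero]
    intro x hx
    obtain ⟨⟨w, s⟩, hws⟩ := IsLocalization.surj (Submonoid.powers c) x
    have h0 : Polynomial.aeval t w = 0 := by
      rw [← hf₁, ← hws, map_mul, hx, zero_mul]
    have hw : w = 0 := by
      by_contra hw; exact haev w hw h0
    rw [hw, map_zero] at hws
    exact (IsUnit.mul_left_eq_zero (IsLocalization.map_units L s)).mp hws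
  have hle : Algebra.adjoin R (T : Set K) ≤ f₁.range := by
    refine Algebra.adjoin_le fun d hd => ?_
    have hdT : d ∈ T := hd
    have hunit : IsUnit (algebraMap R[X] L (v d)) := by
      have h1 : IsUnit (algebraMap R[X] L c) :=
        IsLocalization.map_units L (⟨c, Submonoid.mem_powers c⟩ : Submonoid.powers c)
      exact isUnit_of_dvd_unit (map_dvd _ (Finset.dvd_prod_of_mem v hdT)) h1
    obtain ⟨l, hl⟩ := hunit.exists_left_inv
    refine ⟨algebraMap R[X] L (u d) * l, ?_⟩
    have hl' := congrArg f₁ hl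
    rw [map_mul, map_one, hf₁] at hl'
    change f₁ _ = d
    rw [map_mul, hf₁, ← huv]
    linear_combination d * hl'
  refine ⟨(f₂.comp (AlgEquiv.ofInjective f₁ hinj).symm.toAlgHom).comp (Subalgebra.inclusion hle),
    fun d hd => ?_⟩
  obtain ⟨l, hl⟩ := (AlgEquiv.ofInjective f₁ hinj).surjective (Subalgebra.inclusion hle d)
  have hld : f₁ l = d := congrArg Subtype.val hl
  have hφ : ((f₂.comp (AlgEquiv.ofInjective f₁ hinj).symm.toAlgHom).comp
      (Subalgebra.inclusion hle)) d = f₂ l := by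
    simp [← hl]
  rw [hφ]
  have hlu : l * algebraMap R[X] L (v d) = algebraMap R[X] L (u d) := hinj (by
    rw [map_mul, hf₁, hf₁, hld, huv])
  have h2 := congrArg f₂ hlu
  rw [map_mul, hf₂, hf₂] at h2
  have h1 := congrArg (algebraMap K R') (huv d)
  rw [map_mul] at h1
  have hsv := ha (v d) (Finset.mem_filter.mpr
      ⟨Finset.mem_union_right _ (Finset.mem_image_of_mem v hd), hv d⟩)
  have hsu : SignType.sign (Polynomial.aeval (algebraMap K R' t) (u d)) =
      SignType.sign ((u d).eval a) := by
    by_cases hu : u d = 0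
    · simp [hu]
    · exact ha (u d) (Finset.mem_filter.mpr
        ⟨Finset.mem_union_left _ (Finset.mem_image_of_mem u hd), hu⟩)
  rw [Polynomial.aeval_algebraMap_apply] at hsv hsu
  rw [← h1, ← h2, sign_mul, sign_mul, hsv] at hsu
  have hne : SignType.sign ((v d).eval a) ≠ 0 := sign_ne_zero.mpr (hva d hd)
  exact mul_right_cancel₀ hne hsu

end IsRealClosed

end

section

open Polynomial

theorem Polynomial.exists_sum_aroots_eq {A : Type*} [CommRing A] {p : A[X]} (hp : p.Monic)
    (f : A[X]) : ∃ τ : A, ∀ (Ω : Type v) [Field Ω] [Algebra A Ω],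
      (p.map (algebraMap A Ω)).Splits →
        ((p.aroots Ω).map fun z => Polynomial.aeval z f).sum = algebraMap A Ω τ := by
  let P : MvPolynomial (Fin p.natDegree) A := ∑ i, Polynomial.aeval (MvPolynomial.X i) f
  have hP : P.IsSymmetric := fun e => by
    simp only [P, map_sum]
    refine Fintype.sum_equiv e _ _ fun i => ?_
    rw [← aeval_algHom_apply, MvPolynomial.rename_X]
  obtain ⟨q, hq⟩ := MvPolynomial.esymmAlgHom_surjective A
    (Fintype.card_fin p.natDegree).le ⟨P, hP⟩
  have hq' := congrArg Subtype.val hq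
  rw [MvPolynomial.esymmAlgHom_apply] at hq'
  refine ⟨MvPolynomial.aeval
    (fun i : Fin p.natDegree => (-1) ^ ((i : ℕ) + 1) * p.coeff (p.natDegree - (i + 1))) q,
    fun Ω _ _ hs => ?_⟩
  have hcard : (p.aroots Ω).card = p.natDegree := by
    rw [aroots, ← hs.natDegree_eq_card_roots, hp.natDegree_map]
  let x : Fin p.natDegree → Ω := fun i => (p.aroots Ω).toList.get (i.cast (by simp [hcard]))
  have hx : Finset.univ.val.map x = p.aroots Ω := by
    rw [Fin.univ_val_map, ← Multiset.coe_toList (p.aroots Ω)]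
    congr 1
    apply List.ext_get
    · simp [hcard]
    · simp [x]
  have hsum : ((p.aroots Ω).map fun z => Polynomial.aeval z f).sum = MvPolynomial.aeval x P := by
    rw [← hx]
    simp only [P, map_sum, Multiset.map_map, Function.comp_def]
    rw [Finset.sum]
    congr 1
    refine Multiset.map_congr rfl fun i _ => ?_
    rw [← aeval_algHom_apply, MvPolynomial.aeval_X]
  rw [hsum]
  change MvPolynomial.aeval x (Subtype.val (⟨P, hP⟩ : MvPolynomial.symmetricSubalgebra _ A)) = _
  rw [← hq', ← AlgHom.comp_apply, MvPolynomial.comp_aeval, ← Algebra.ofId_apply Ω (_ : A),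
    ← AlgHom.comp_apply, MvPolynomial.comp_aeval]
  congr 2
  funext i
  rw [MvPolynomial.aeval_esymm_eq_multiset_esymm, hx, Algebra.ofId_apply]
  have hv := Polynomial.coeff_eq_esymm_roots_of_card (p := p.map (algebraMap A Ω))
    (by rw [hp.natDegree_map]; exact hcard) (k := p.natDegree - (i + 1))
    (by rw [hp.natDegree_map]; omega)
  rw [hp.natDegree_map, (hp.map _).leadingCoeff, one_mul,
    Nat.sub_sub_self (by omega), coeff_map] at hv
  rw [map_mul, hv, ← mul_assoc, map_pow, map_neg, map_one, ← mul_pow]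
  simp

/-- An identity between a sum over the roots of `p` and a scalar transports along ring maps. -/
theorem Polynomial.sum_aroots_eq_of_injective {A : Type*} {Ω₁ Ω₂ : Type v} [CommRing A] [Field Ω₁]
    [Field Ω₂] [Algebra A Ω₁] [Algebra A Ω₂] (hinj : Function.Injective (algebraMap A Ω₁))
    [IsAlgClosed Ω₁] [IsAlgClosed Ω₂] {p : A[X]} (hp : p.Monic) {f : A[X]} {d : A}
    (h : ((p.aroots Ω₁).map fun z => Polynomial.aeval z f).sum = algebraMap A Ω₁ d) :
    ((p.aroots Ω₂).map fun z => Polynomial.aeval z f).sum = algebraMap A Ω₂ d := by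
  obtain ⟨τ, hτ⟩ := exists_sum_aroots_eq.{v} hp f
  rw [hτ Ω₁ (IsAlgClosed.splits _)] at h
  rw [hτ Ω₂ (IsAlgClosed.splits _), hinj h]

/-- A family of functionals smaller than a family of vectors kills a nontrivial combination. -/
theorem Multiset.exists_ne_zero_forall_sum_eq_zero {K V ι : Type*} [Field K] [AddCommGroup V]
    [Module K V] [Fintype ι] (B : Multiset (V →ₗ[K] K)) (e : ι → V) (h : B.card < Fintype.card ι) :
    ∃ c : ι → K, c ≠ 0 ∧ ∀ b ∈ B, b (∑ i, c i • e i) = 0 := by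
  let Φ : (ι → K) →ₗ[K] (Fin B.toList.length → K) :=
    (LinearMap.pi fun j => B.toList.get j) ∘ₗ Fintype.linearCombination K e
  obtain ⟨c, hc, hc0⟩ := (Submodule.ne_bot_iff _).mp
    (LinearMap.ker_ne_bot_of_finrank_lt (f := Φ) (by simpa using h))
  refine ⟨c, hc0, fun b hb => ?_⟩
  obtain ⟨j, rfl⟩ := List.get_of_mem (Multiset.mem_toList.mpr hb)
  exact congrFun (LinearMap.mem_ker.mp hc) j

theorem Polynomial.sum_aroots_sq_sum_smul {R Ω ι : Type*} [Field R] [Field Ω] [Algebra R Ω]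
    {p : R[X]} [Fintype ι] [DecidableEq ι] {e : ι → R[X]} {d : ι → R}
    (h : ∀ i j, ((p.aroots Ω).map fun z => Polynomial.aeval z (e i * e j)).sum =
      algebraMap R Ω (if i = j then d i else 0)) (c : ι → R) :
    ((p.aroots Ω).map fun z => Polynomial.aeval z (∑ i, c i • e i) ^ 2).sum =
      algebraMap R Ω (∑ i, c i ^ 2 * d i) := by
  have h1 : ∀ z : Ω, Polynomial.aeval z (∑ i, c i • e i) ^ 2 =
      ∑ i, ∑ j, (c i * c j) • Polynomial.aeval z (e i * e j) := by
    intro z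
    rw [← map_pow, pow_two, Finset.sum_mul_sum]
    simp only [map_sum, smul_mul_smul_comm, map_smul]
  simp only [h1, Multiset.sum_map_sum]
  simp only [Algebra.smul_def, Multiset.sum_map_mul_left, h]
  simp only [← map_mul, ← map_sum]
  congr 1
  refine Finset.sum_congr rfl fun i _ => ?_
  simp [pow_two]

namespace IsRealClosed

variable {R : Type*} [Field R] [LinearOrder R] [IsStrictOrderedRing R] [IsRealClosed R]

/-- Hermite's quadratic form: the sum of the values of `f ^ 2` over the roots of `p` is a signed sum
of squares of linear forms in `f`, whose signature counts the roots in the base field. -/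
theorem exists_sum_aroots_sq_eq (Ω : Type*) [Field Ω] [IsAlgClosed Ω] [Algebra R Ω] {p : R[X]}
    (hp : p ≠ 0) : ∃ A B : Multiset (R[X] →ₗ[R] R), A.card + B.card = p.natDegree ∧
      B.card ≤ A.card ∧ ((∃ z, p.IsRoot z) ↔ B.card < A.card) ∧
      ∀ f, ((p.aroots Ω).map fun z => Polynomial.aeval z f ^ 2).sum =
        algebraMap R Ω ((A.map fun a => a f ^ 2).sum - (B.map fun b => b f ^ 2).sum) := by
  induction p using WfDvdMonoid.induction_on_irreducible with
  | zero => simp at hp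
  | unit u hunit =>
    obtain ⟨c, hc, rfl⟩ := isUnit_iff.mp hunit
    exact ⟨0, 0, by simp [IsRoot, hc.ne_zero]⟩
  | mul p i hp' hi ih =>
    obtain ⟨A, B, hdeg, hle, hroot, hsum⟩ := ih hp'
    have hlc : i.leadingCoeff ≠ 0 := leadingCoeff_ne_zero.mpr hi.ne_zero
    have hassoc : Associated i (i * Polynomial.C i.leadingCoeff⁻¹) :=
      associated_mul_unit_right _ _ (isUnit_C.mpr (inv_ne_zero hlc).isUnit)
    have hcls := eq_X_sub_C_or_of_irreducible (hassoc.irreducible hi)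
      (monic_mul_leadingCoeff_inv hi.ne_zero)
    have hi' : i = Polynomial.C i.leadingCoeff * (i * Polynomial.C i.leadingCoeff⁻¹) := by
      rw [mul_left_comm, ← Polynomial.C_mul, mul_inv_cancel₀ hlc, Polynomial.C_1, mul_one]
    generalize i * Polynomial.C i.leadingCoeff⁻¹ = q at hcls hi'
    generalize i.leadingCoeff = c at hlc hi'
    subst hi'
    have hq : q ≠ 0 := right_ne_zero_of_mul hi.ne_zero
    rw [natDegree_mul hi.ne_zero hp', natDegree_C_mul hlc, aroots_mul hp, aroots_C_mul _ hlc]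
    rcases hcls with ⟨z, rfl⟩ | ⟨b, e, he, rfl⟩
    · refine ⟨leval z ::ₘ A, B, ?_, ?_, ?_, fun f => ?_⟩
      · simp; omega
      · simp; omega
      · simp only [Multiset.card_cons]
        exact iff_of_true ⟨z, by simp⟩ (by omega)
      · rw [aroots_X_sub_C, Multiset.map_add, Multiset.sum_add, hsum]
        simp only [Multiset.map_singleton, Multiset.sum_singleton, Multiset.map_cons,
          Multiset.sum_cons, map_sub, map_add, map_pow, leval_apply]
        rw [Polynomial.aeval_algebraMap_apply, Polynomial.coe_aeval_eq_eval]
        ring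
    · obtain ⟨s, hs⟩ : IsSquare (2 : R) := .of_nonneg (by norm_num)
      set q := (Polynomial.X - Polynomial.C b) ^ 2 + Polynomial.C (e ^ 2) with hqdef
      have hqd : q.natDegree = 2 := by rw [hqdef]; compute_degree!
      have hqm : q.Monic := by rw [hqdef]; monicity!
      obtain ⟨I, hI⟩ := IsAlgClosed.exists_pow_nat_eq (-1 : Ω) (n := 2) (by norm_num)
      have hmap : q.map (algebraMap R Ω) =
          (Polynomial.X - Polynomial.C (algebraMap R Ω b + I * algebraMap R Ω e)) *
          (Polynomial.X - Polynomial.C (algebraMap R Ω b - I * algebraMap R Ω e)) := by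
        have hI' : (Polynomial.C I : Polynomial Ω) ^ 2 = -1 := by rw [← Polynomial.C_pow, hI]; simp
        simp only [hqdef, Polynomial.map_add, Polynomial.map_pow, Polynomial.map_sub,
            Polynomial.map_X, Polynomial.map_C,
          Polynomial.C_add, Polynomial.C_sub, Polynomial.C_mul, map_pow]
        linear_combination (Polynomial.C (algebraMap R Ω e)) ^ 2 * hI'
      have har : q.aroots Ω = {algebraMap R Ω b + I * algebraMap R Ω e} +
          {algebraMap R Ω b - I * algebraMap R Ω e} := by
        rw [aroots, hmap, roots_mul, roots_X_sub_C, roots_X_sub_C]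
        exact mul_ne_zero (X_sub_C_ne_zero _) (X_sub_C_ne_zero _)
      refine ⟨(s • (Polynomial.lcoeff R 0 + b • Polynomial.lcoeff R 1) ∘ₗ modByMonicHom q) ::ₘ A,
        ((s * e) • Polynomial.lcoeff R 1 ∘ₗ modByMonicHom q) ::ₘ B, ?_, ?_, ?_, fun f => ?_⟩
      · simp only [Multiset.card_cons]; omega
      · simp only [Multiset.card_cons]; omega
      · simp only [Multiset.card_cons]
        rw [add_lt_add_iff_right, ← hroot]
        refine exists_congr fun z => ?_
        have : q.eval z ≠ 0 := by
          simp only [hqdef, Polynomial.eval_add, Polynomial.eval_pow, Polynomial.eval_sub,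
              Polynomial.eval_X, Polynomial.eval_C]
          positivity
        simp [IsRoot, hlc, this]
      · rw [Multiset.map_add, Multiset.sum_add, hsum, har]
        have key : ∀ w : Ω, Polynomial.aeval w q = 0 → Polynomial.aeval w f =
            algebraMap R Ω ((f %ₘ q).coeff 0) + algebraMap R Ω ((f %ₘ q).coeff 1) * w := by
          intro w hw
          have hlt : (f %ₘ q).natDegree ≤ 1 := by
            have := natDegree_modByMonic_lt f hqm (by intro h; simp [h] at hqd)
            omega
          conv_lhs => rw [← modByMonic_add_div f q, map_add, map_mul, hw, zero_mul, add_zero,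
            eq_X_add_C_of_natDegree_le_one hlt]
          simp [add_comm]
        have hw : ∀ w : Ω, w ∈ q.aroots Ω → Polynomial.aeval w q = 0 :=
            fun w h => (mem_aroots.mp h).2
        simp only [Multiset.map_add, Multiset.map_singleton, Multiset.sum_add,
          Multiset.sum_singleton, Multiset.map_cons, Multiset.sum_cons]
        rw [key _ (hw _ (by simp [har])), key _ (hw _ (by simp [har]))]
        have hs' : algebraMap R Ω s * algebraMap R Ω s = 2 := by
          rw [← map_mul, ← hs]; exact map_ofNat _ 2
        simp only [LinearMap.smul_apply, LinearMap.comp_apply, LinearMap.add_apply,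
            Polynomial.lcoeff_apply,
          smul_eq_mul, map_sub, map_add, map_mul, map_pow]
        simp only [modByMonicHom, LinearMap.coe_mk, AddHom.coe_mk]
        linear_combination (2 * (algebraMap R Ω ((f %ₘ q).coeff 1)) ^ 2 * algebraMap R Ω e ^ 2) * hI
          - ((algebraMap R Ω ((f %ₘ q).coeff 0) + algebraMap R Ω b *
            algebraMap R Ω ((f %ₘ q).coeff 1)) ^ 2 -
            algebraMap R Ω e ^ 2 * algebraMap R Ω ((f %ₘ q).coeff 1) ^ 2) * hs'

variable {Ω ι : Type*} [Field Ω] [IsAlgClosed Ω] [Algebra R Ω] {p : R[X]} [Fintype ι]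
  [DecidableEq ι] {e : ι → R[X]} {d : ι → R}

theorem two_mul_card_le_natDegree (hp : p ≠ 0) (hroot : ∀ z, ¬ p.IsRoot z) (hd : ∀ i, 0 < d i)
    (h : ∀ i j, ((p.aroots Ω).map fun z => Polynomial.aeval z (e i * e j)).sum =
      algebraMap R Ω (if i = j then d i else 0)) :
    2 * Fintype.card ι ≤ p.natDegree := by
  obtain ⟨A, B, hdeg, hle, hroots, hsum⟩ := exists_sum_aroots_sq_eq Ω hp
  have hAB : ¬ B.card < A.card := fun hlt => by
    obtain ⟨z, hz⟩ := hroots.mpr hlt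
    exact hroot z hz
  by_contra! hlt
  obtain ⟨c, hc, hAc⟩ := A.exists_ne_zero_forall_sum_eq_zero e (by omega)
  have heq := (algebraMap R Ω).injective ((hsum _).symm.trans (sum_aroots_sq_sum_smul h c))
  rw [Multiset.sum_eq_zero (s := A.map _) (by
    intro x hx
    obtain ⟨a, ha, rfl⟩ := Multiset.mem_map.mp hx
    simp [hAc a ha]), zero_sub] at heq
  have hB : 0 ≤ (B.map fun b => b (∑ i, c i • e i) ^ 2).sum :=
    Multiset.sum_nonneg fun x hx => by
      obtain ⟨a, -, rfl⟩ := Multiset.mem_map.mp hx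
      exact sq_nonneg _
  obtain ⟨i, hi⟩ := Function.ne_iff.mp hc
  have hpos : 0 < ∑ i, c i ^ 2 * d i := by
    refine Finset.sum_pos' (fun i _ => mul_nonneg (sq_nonneg _) (hd i).le)
      ⟨i, Finset.mem_univ _, ?_⟩
    exact mul_pos (sq_pos_of_ne_zero hi) (hd i)
  linarith

theorem two_mul_card_lt_natDegree (hp : p ≠ 0) {z : R} (hz : p.IsRoot z) (hd : ∀ i, d i < 0)
    (h : ∀ i j, ((p.aroots Ω).map fun z => Polynomial.aeval z (e i * e j)).sum =
      algebraMap R Ω (if i = j then d i else 0)) :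
    2 * Fintype.card ι < p.natDegree := by
  obtain ⟨A, B, hdeg, hle, hroots, hsum⟩ := exists_sum_aroots_sq_eq Ω hp
  have hAB : B.card < A.card := hroots.mp ⟨z, hz⟩
  by_contra! hlt
  obtain ⟨c, hc, hBc⟩ := B.exists_ne_zero_forall_sum_eq_zero e (by omega)
  have heq := (algebraMap R Ω).injective ((hsum _).symm.trans (sum_aroots_sq_sum_smul h c))
  rw [Multiset.sum_eq_zero (s := B.map _) (by
    intro x hx
    obtain ⟨a, ha, rfl⟩ := Multiset.mem_map.mp hx
    simp [hBc a ha]), sub_zero] at heq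
  have hA : 0 ≤ (A.map fun b => b (∑ i, c i • e i) ^ 2).sum :=
    Multiset.sum_nonneg fun x hx => by
      obtain ⟨a, -, rfl⟩ := Multiset.mem_map.mp hx
      exact sq_nonneg _
  obtain ⟨i, hi⟩ := Function.ne_iff.mp hc
  have hpos : ∑ i, c i ^ 2 * d i < 0 := by
    refine Finset.sum_neg' (fun i _ => mul_nonpos_of_nonneg_of_nonpos (sq_nonneg _) (hd i).le)
      ⟨i, Finset.mem_univ _, ?_⟩
    exact mul_neg_of_pos_of_neg (sq_pos_of_ne_zero hi) (hd i)
  linarith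

end IsRealClosed

theorem Algebra.sum_aroots_minpoly_eq_trace {K F : Type*} (Ω : Type*) [Field K] [CharZero K]
    [Field F] [Algebra K F] [FiniteDimensional K F] [Field Ω] [IsAlgClosed Ω] [Algebra K Ω] {α : F}
    (hα : IntermediateField.adjoin K {α} = ⊤) (f : K[X]) :
    (((minpoly K α).aroots Ω).map fun z => Polynomial.aeval z f).sum =
      algebraMap K Ω (Algebra.trace K F (Polynomial.aeval α f)) := by
  classical
  have hint : IsIntegral K α := Algebra.IsIntegral.isIntegral α
  have hadj : Algebra.adjoin K {α} = ⊤ := by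
    rw [← IntermediateField.adjoin_simple_toSubalgebra_of_isAlgebraic hint.isAlgebraic, hα,
      IntermediateField.top_toSubalgebra]
  obtain ⟨pb, rfl⟩ : ∃ pb : PowerBasis K F, pb.gen = α :=
    ⟨PowerBasis.ofAdjoinEqTop hint hadj, PowerBasis.ofAdjoinEqTop_gen hint hadj⟩
  have hnodup : ((minpoly K pb.gen).aroots Ω).Nodup :=
    nodup_aroots_iff_of_splits (minpoly.ne_zero hint) (IsAlgClosed.splits _) |>.mpr
      (minpoly.irreducible hint).separable
  rw [trace_eq_sum_embeddings Ω, Fintype.sum_equiv pb.liftEquiv' _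
      (fun y => Polynomial.aeval (y : Ω) f) (fun σ => by
        rw [PowerBasis.liftEquiv'_apply_coe, aeval_algHom_apply]),
    Finset.sum_mem_multiset _ _ (fun y => Polynomial.aeval y f) fun _ => rfl,
    Finset.sum_eq_multiset_sum,
    Multiset.toFinset_val, Multiset.dedup_eq_self.mpr hnodup]

/-- An orthogonal basis for the trace form of a simple extension, expressed by polynomials. -/
theorem Algebra.exists_orthogonal_polynomials {K F : Type*} (Ω : Type*) [Field K] [CharZero K]
    [Field F] [Algebra K F] [FiniteDimensional K F] [Field Ω] [IsAlgClosed Ω] [Algebra K Ω] {α : F}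
    (hα : IntermediateField.adjoin K {α} = ⊤) :
    ∃ (e : Fin (minpoly K α).natDegree → K[X]) (d : Fin (minpoly K α).natDegree → K),
      (∀ i, d i ≠ 0) ∧ ∀ i j,
        (((minpoly K α).aroots Ω).map fun z => Polynomial.aeval z (e i * e j)).sum =
        algebraMap K Ω (if i = j then d i else 0) := by
  have hint : IsIntegral K α := Algebra.IsIntegral.isIntegral α
  rw [(Field.primitive_element_iff_minpoly_natDegree_eq K α).mp hα]
  have : Invertible (2 : K) := invertibleOfNonzero two_ne_zero
  obtain ⟨v, hv⟩ := LinearMap.BilinForm.exists_orthogonal_basis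
    (B := Algebra.traceForm K F) (LinearMap.BilinForm.isSymm_iff.mp (Algebra.traceForm_isSymm K))
  have hnd := LinearMap.BilinForm.iIsOrtho.not_isOrtho_basis_self_of_nondegenerate hv
    (traceForm_nondegenerate K F)
  have hsurj : ∀ x : F, ∃ f : K[X], Polynomial.aeval α f = x := by
    intro x
    have hx : x ∈ Algebra.adjoin K {α} := by
      rw [← IntermediateField.adjoin_simple_toSubalgebra_of_isAlgebraic hint.isAlgebraic, hα]
      trivial
    rwa [Algebra.adjoin_singleton_eq_range_aeval] at hx
  choose e he using fun i => hsurj (v i)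
  refine ⟨e, fun i => Algebra.traceForm K F (v i) (v i), hnd, fun i j => ?_⟩
  rw [Algebra.sum_aroots_minpoly_eq_trace Ω hα, map_mul, he, he]
  split_ifs with hij
  · rw [hij]; rfl
  · rw [← Algebra.traceForm_apply]
    exact congrArg _ (hv hij)

namespace IsRealClosed

variable {R R' : Type v} [Field R'] [LinearOrder R'] [IsStrictOrderedRing R'] [IsRealClosed R']
  [Field R] [LinearOrder R] [IsStrictOrderedRing R] [IsRealClosed R]

/-- A specialization that preserves the signs of the diagonal entries of Hermite's form preserves
the existence of roots. -/
theorem exists_aeval_eq_zero_of_sign_eq {A : Type*} [CommRing A] [Algebra A R] [Algebra A R']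
    {κ : Type*} [Fintype κ] [DecidableEq κ] (hinj : Function.Injective (algebraMap A R')) {p : A[X]}
    (hp : p.Monic) (hκ : Fintype.card κ = p.natDegree) {e : κ → A[X]} {d : κ → A}
    (hd : ∀ i, d i ≠ 0)
    (hsign : ∀ i, SignType.sign (algebraMap A R' (d i)) = SignType.sign (algebraMap A R (d i)))
    (hsum : ∀ i j,
      ((p.aroots (AlgebraicClosure R')).map fun z => Polynomial.aeval z (e i * e j)).sum =
      algebraMap A (AlgebraicClosure R') (if i = j then d i else 0))
    {z : R'} (hz : Polynomial.aeval z p = 0) : ∃ b : R, Polynomial.aeval b p = 0 := by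
  by_contra! hb
  have hinj' : Function.Injective (algebraMap A (AlgebraicClosure R')) := by
    rw [IsScalarTower.algebraMap_eq A R' (AlgebraicClosure R')]
    exact (algebraMap R' (AlgebraicClosure R')).injective.comp hinj
  have hneg := two_mul_card_lt_natDegree (Ω := AlgebraicClosure R')
    (ι := {i // algebraMap A R' (d i) < 0}) (p := p.map (algebraMap A R'))
    (e := fun i => (e i).map (algebraMap A R')) (d := fun i => algebraMap A R' (d i))
    (hp.map _).ne_zero (z := z) (by rwa [IsRoot, eval_map_algebraMap]) (fun i => i.2)
    (fun i j => by
      rw [aroots_map]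
      simp only [← Polynomial.map_mul, Polynomial.aeval_map_algebraMap, hsum,
        IsScalarTower.algebraMap_apply A R' (AlgebraicClosure R'), Subtype.ext_iff]
      split_ifs <;> simp)
  have hpos := two_mul_card_le_natDegree (Ω := AlgebraicClosure R)
    (ι := {i // 0 < algebraMap A R (d i)}) (p := p.map (algebraMap A R))
    (e := fun i => (e i).map (algebraMap A R)) (d := fun i => algebraMap A R (d i))
    (hp.map _).ne_zero (fun z => by rw [IsRoot, eval_map_algebraMap]; exact hb z) (fun i => i.2)
    (fun i j => by
      rw [aroots_map]
      simp only [← Polynomial.map_mul, Polynomial.aeval_map_algebraMap,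
        sum_aroots_eq_of_injective (Ω₂ := AlgebraicClosure R) hinj' hp (hsum i j),
        IsScalarTower.algebraMap_apply A R (AlgebraicClosure R), Subtype.ext_iff]
      split_ifs <;> simp)
  rw [hp.natDegree_map] at hneg hpos
  have hcompl : Fintype.card {i // 0 < algebraMap A R (d i)} =
      Fintype.card {i // ¬ algebraMap A R' (d i) < 0} := by
    refine Fintype.card_congr (Equiv.subtypeEquivRight fun i => ?_)
    rw [← sign_eq_one_iff, ← hsign, sign_eq_one_iff, not_lt]
    exact ⟨le_of_lt, fun h => h.lt_of_ne' fun h0 => hd i (hinj (by rw [h0, map_zero]))⟩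
  rw [hcompl, Fintype.card_subtype_compl, hκ] at hpos
  omega

theorem exists_aeval_eq_zero_of_dvd [Algebra R R'] {K : Type*} [Field K] [Algebra R K]
    [Algebra K R'] [IsScalarTower R K R'] {t : K} (ht : Transcendental R t)
    (hK : ∀ d : K, ∃ u v : R[X], v ≠ 0 ∧ d * Polynomial.aeval t v = Polynomial.aeval t u)
    {κ ι J : Type*} [Fintype κ]
    [DecidableEq κ] [Fintype ι] {p : K[X]} (hp : p.Monic) (hκ : Fintype.card κ = p.natDegree)
    {e : κ → K[X]} {d : κ → K} (hd : ∀ i, d i ≠ 0)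
    (hsum : ∀ i j,
      ((p.aroots (AlgebraicClosure R')).map fun z => Polynomial.aeval z (e i * e j)).sum =
      algebraMap K (AlgebraicClosure R') (if i = j then d i else 0))
    {z : R'} (hz : Polynomial.aeval z p = 0) {q : ι → K[X]} {h : J → MvPolynomial ι R}
    (hdvd : ∀ j, p ∣ MvPolynomial.aeval q (h j)) :
    ∃ y : ι → R, ∀ j, MvPolynomial.aeval y (h j) = 0 := by
  classical
  let T : Finset K := p.coeffs ∪ (Finset.univ.biUnion fun i => (e i).coeffs) ∪
    (Finset.univ.biUnion fun i => (q i).coeffs) ∪ Finset.univ.image d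
  obtain ⟨φ, hφ⟩ := exists_algHom_adjoin_sign_eq (R' := R') ht hK T
  let S := Algebra.adjoin R (T : Set K)
  let : Algebra S R := φ.toRingHom.toAlgebra
  have : IsScalarTower R S R := .of_algebraMap_eq fun r => (φ.commutes r).symm
  have hlift : ∀ f : K[X], f.coeffs ⊆ T → ∃ f' : S[X], f'.map (algebraMap S K) = f := by
    intro f hf
    rw [← mem_lifts, lifts_iff_coeffs_subset_range]
    exact fun c hc => ⟨⟨c, Algebra.subset_adjoin (hf hc)⟩, rfl⟩
  choose e' he' using fun i => hlift (e i) fun c hc => by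
    simp only [T, Finset.mem_union, Finset.mem_biUnion, Finset.mem_univ, true_and]
    exact .inl (.inl (.inr ⟨i, hc⟩))
  choose q' hq' using fun i => hlift (q i) fun c hc => by
    simp only [T, Finset.mem_union, Finset.mem_biUnion, Finset.mem_univ, true_and]
    exact .inl (.inr ⟨i, hc⟩)
  obtain ⟨p', hp'⟩ := hlift p fun c hc => by simp [T, hc]
  have hdT : ∀ i, d i ∈ T := fun i => by simp [T]
  let d' : κ → S := fun i => ⟨d i, Algebra.subset_adjoin (hdT i)⟩
  have hd' : ∀ i, algebraMap S K (d' i) = d i := fun i => rfl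
  have hSK : Function.Injective (algebraMap S K) := Subtype.val_injective
  have hmonic : p'.Monic := hSK.monic_map_iff.mpr (hp' ▸ hp)
  obtain ⟨b, hb⟩ := exists_aeval_eq_zero_of_sign_eq (R := R) (R' := R') (e := e') (d := d')
      (p := p')
    (z := z) (by
      rw [IsScalarTower.algebraMap_eq S K R']
      exact (algebraMap K R').injective.comp hSK) hmonic
    (by rw [hκ, ← hp', hmonic.natDegree_map])
    (fun i hi => hd i (by rw [← hd', hi, map_zero]))
    (fun i => by
      rw [IsScalarTower.algebraMap_apply S K R']
      exact hφ (d' i) (hdT i))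
    (fun i j => by
      have := hsum i j
      rw [← hp', aroots_map, ← he', ← he', ← hd'] at this
      simp only [← Polynomial.map_mul, Polynomial.aeval_map_algebraMap] at this
      refine this.trans ?_
      split_ifs
      · rfl
      · simp)
    (by rw [← Polynomial.aeval_map_algebraMap K, hp', hz])
  refine ⟨fun i => Polynomial.aeval b (q' i), fun j => ?_⟩
  have hdvd' : p' ∣ MvPolynomial.aeval q' (h j) := by
    rw [← map_dvd_map (algebraMap S K) hSK hmonic, hp']
    convert hdvd j using 1
    change Polynomial.mapAlgHom (IsScalarTower.toAlgHom R S K) _ = _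
    rw [← AlgHom.comp_apply, MvPolynomial.comp_aeval]
    congr 2
    funext i
    exact hq' i
  obtain ⟨w, hw⟩ := hdvd'
  have h0 : (Polynomial.aeval b : S[X] →ₐ[S] R).restrictScalars R (MvPolynomial.aeval q' (h j)) =
      0 := by
    rw [hw, AlgHom.restrictScalars_apply, map_mul, hb, zero_mul]
  rwa [← AlgHom.comp_apply, MvPolynomial.comp_aeval] at h0

theorem exists_aeval_eq_zero_of_isAlgebraic [Algebra R R'] {K : Type*} [Field K] [Algebra R K]
    [Algebra K R'] [IsScalarTower R K R'] {t : K} (ht : Transcendental R t)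
    (hK : ∀ d : K, ∃ u v : R[X], v ≠ 0 ∧ d * Polynomial.aeval t v = Polynomial.aeval t u)
    {ι J : Type*} [Finite ι]
    {z : ι → R'} (hz : ∀ i, IsAlgebraic K (z i)) {h : J → MvPolynomial ι R}
    (hzero : ∀ j, MvPolynomial.aeval z (h j) = 0) :
    ∃ y : ι → R, ∀ j, MvPolynomial.aeval y (h j) = 0 := by
  classical
  have := Fintype.ofFinite ι
  have : CharZero K := charZero_of_injective_algebraMap (algebraMap R K).injective
  let F := IntermediateField.adjoin K (Set.range z)
  have : FiniteDimensional K F := IntermediateField.finiteDimensional_adjoin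
    (by rintro _ ⟨i, rfl⟩; exact (hz i).isIntegral)
  obtain ⟨α, hα⟩ := Field.exists_primitive_element K F
  have hint : IsIntegral K α := Algebra.IsIntegral.isIntegral α
  obtain ⟨e, d, hd, hsum⟩ := Algebra.exists_orthogonal_polynomials (AlgebraicClosure R') hα
  have hsurj : ∀ i, ∃ f : K[X], Polynomial.aeval α f =
      ⟨z i, IntermediateField.subset_adjoin K _ ⟨i, rfl⟩⟩ := by
    intro i
    have hx : (⟨z i, IntermediateField.subset_adjoin K _ ⟨i, rfl⟩⟩ : F) ∈ Algebra.adjoin K {α} := by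
      rw [← IntermediateField.adjoin_simple_toSubalgebra_of_isAlgebraic hint.isAlgebraic, hα]
      trivial
    rwa [Algebra.adjoin_singleton_eq_range_aeval] at hx
  choose q hq using hsurj
  refine exists_aeval_eq_zero_of_dvd ht hK (minpoly.monic hint) (Fintype.card_fin _) hd hsum
    (z := (α : R')) (q := q) ?_ fun j => minpoly.dvd _ _ ?_
  · rw [← IntermediateField.algebraMap_apply, Polynomial.aeval_algebraMap_apply, minpoly.aeval,
      map_zero]
  · have : IsScalarTower R F R' := .of_algebraMap_eq fun r => by
      rw [IsScalarTower.algebraMap_apply R K R', IsScalarTower.algebraMap_apply R K F]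
      rfl
    apply (algebraMap F R').injective
    change ((IsScalarTower.toAlgHom R F R').comp
      ((Polynomial.aeval α : K[X] →ₐ[K] F).restrictScalars R)) _ = _
    rw [← AlgHom.comp_apply, MvPolynomial.comp_aeval, map_zero, ← hzero j]
    congr 2
    funext i
    exact congrArg (algebraMap F R') (hq i)

end IsRealClosed

namespace IsRealClosed

theorem exists_algebraMap_eq_of_isAlgebraic {R R' : Type*} [Field R] [LinearOrder R]
    [IsStrictOrderedRing R] [IsRealClosed R] [Field R'] [LinearOrder R'] [IsStrictOrderedRing R']
    [Algebra R R'] {x : R'} (hx : IsAlgebraic R x) : ∃ r, algebraMap R R' r = x := by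
  rcases eq_X_sub_C_or_of_irreducible (minpoly.irreducible hx.isIntegral)
    (minpoly.monic hx.isIntegral) with ⟨z, hz⟩ | ⟨b, e, he, hq⟩
  · have := minpoly.aeval R x
    rw [hz, map_sub, Polynomial.aeval_X, Polynomial.aeval_C, sub_eq_zero] at this
    exact ⟨z, this.symm⟩
  · have h0 := minpoly.aeval R x
    have he' : algebraMap R R' e ≠ 0 := by simpa using he
    simp only [hq, map_add, map_pow, map_sub, Polynomial.aeval_X, Polynomial.aeval_C] at h0
    have : 0 < (x - algebraMap R R' b) ^ 2 + algebraMap R R' e ^ 2 := by positivity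
    exact absurd h0 this.ne'

theorem exists_aeval_eq_zero_of_mem_adjoin {ι J : Type*} [Finite ι] {R' : Type v} [Field R']
    [LinearOrder R'] [IsStrictOrderedRing R'] [IsRealClosed R'] (s : Finset R') :
    ∀ {R : Type v} [Field R] [LinearOrder R] [IsStrictOrderedRing R] [IsRealClosed R]
      [Algebra R R'] {x : ι → R'} (_ : ∀ i, x i ∈ Algebra.adjoin R (s : Set R'))
      {h : J → MvPolynomial ι R} (_ : ∀ j, MvPolynomial.aeval x (h j) = 0),
      ∃ y : ι → R, ∀ j, MvPolynomial.aeval y (h j) = 0 := by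
  classical
  induction s using Finset.induction_on with
  | empty =>
    intro R _ _ _ _ _ x hx h hzero
    simp only [Finset.coe_empty, Algebra.adjoin_empty, Algebra.mem_bot, Set.mem_range] at hx
    choose y hy using hx
    refine ⟨y, fun j => (algebraMap R R').injective ?_⟩
    rw [← MvPolynomial.aeval_algebraMap_apply, map_zero, ← hzero j]
    congr 2
    exact funext hy
  | insert a s _ ih =>
    intro R _ _ _ _ _ x hx h hzero
    by_cases ha : IsAlgebraic R a
    · obtain ⟨r, rfl⟩ := exists_algebraMap_eq_of_isAlgebraic ha
      refine ih (fun i => ?_) hzero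
      rw [Finset.coe_insert, Algebra.adjoin_insert_algebraMap] at hx
      exact hx i
    let K := IntermediateField.adjoin R {a}
    let E := algebraicClosure K R'
    have : IsScalarTower R E R' := .of_algebraMap_eq fun r => rfl
    obtain ⟨y, hy⟩ := ih (R := E) (x := x) (h := fun j => (h j).map (algebraMap R E))
      (fun i => by
        refine (Algebra.adjoin_le
          (S := (Algebra.adjoin E (s : Set R')).restrictScalars R) ?_) (hx i)
        rw [Finset.coe_insert]
        refine Set.insert_subset ?_ Algebra.subset_adjoin
        have haK : a ∈ K := IntermediateField.mem_adjoin_simple_self R a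
        exact (Algebra.adjoin E (s : Set R')).algebraMap_mem
          (algebraMap K E ⟨a, haK⟩))
      (fun j => by rw [MvPolynomial.aeval_map_algebraMap, hzero j])
    have htr : Transcendental R (IntermediateField.AdjoinSimple.gen R a) := fun hgen => by
      exact ha (by simpa using hgen.algebraMap (A := R'))
    refine exists_aeval_eq_zero_of_isAlgebraic (R' := E) (K := K) htr ?_ (z := y) (fun i => ?_)
      fun j => by rw [← hy j, MvPolynomial.aeval_map_algebraMap]
    · rintro ⟨d, hd⟩
      obtain ⟨u, v, huv⟩ := IntermediateField.mem_adjoin_simple_iff R d |>.mp hd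
      by_cases hv : v = 0
      · refine ⟨0, 1, one_ne_zero, Subtype.ext ?_⟩
        simp [huv, hv]
      · have hva : Polynomial.aeval a v ≠ 0 := fun h0 => ha ⟨v, hv, h0⟩
        refine ⟨u, v, hv, (algebraMap K R').injective ?_⟩
        rw [map_mul, ← Polynomial.aeval_algebraMap_apply, ← Polynomial.aeval_algebraMap_apply,
          IntermediateField.AdjoinSimple.algebraMap_gen]
        change d * _ = _
        rw [huv, div_mul_cancel₀ _ hva]
    · exact Algebra.IsAlgebraic.isAlgebraic (y i)

/-- A polynomial system over a real closed field with a solution in a real closed extension has a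
solution. -/
theorem exists_aeval_eq_zero {ι J : Type*} [Finite ι] {R R' : Type v} [Field R] [LinearOrder R]
    [IsStrictOrderedRing R] [IsRealClosed R] [Field R'] [LinearOrder R'] [IsStrictOrderedRing R']
    [IsRealClosed R'] [Algebra R R'] {x : ι → R'} {h : J → MvPolynomial ι R}
    (hzero : ∀ j, MvPolynomial.aeval x (h j) = 0) :
    ∃ y : ι → R, ∀ j, MvPolynomial.aeval y (h j) = 0 :=
  exists_aeval_eq_zero_of_mem_adjoin (Set.finite_range x).toFinset
    (fun i => Algebra.subset_adjoin (by simp)) hzero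

end IsRealClosed

end

theorem IsSumSq.exists_map_eq {A B : Type*} [Semiring A] [Semiring B] {φ : A →+* B}
    (hφ : Function.Surjective φ) {s : B} (hs : IsSumSq s) : ∃ s', IsSumSq s' ∧ φ s' = s := by
  induction hs with
  | zero => exact ⟨0, .zero, map_zero _⟩
  | sq_add a hs ih =>
    obtain ⟨s', hs', rfl⟩ := ih
    obtain ⟨a, rfl⟩ := hφ a
    exact ⟨a * a + s', hs'.sq_add a, by simp⟩

/-- A semireal ring maps to a semireal field. -/
theorem IsSemireal.exists_ringHom_field (A : Type u) [CommRing A] [IsSemireal A] :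
    ∃ (k : Type u) (_ : Field k) (_ : IsSemireal k), Nonempty (A →+* k) := by
  let M : Submonoid A :=
    { carrier := {a | IsSumSq (a - 1)}
      one_mem' := by simp
      mul_mem' := fun {a b} ha hb => by
        have hab : a * b - 1 = (a - 1) * (b - 1) + ((a - 1) + (b - 1)) := by ring
        change IsSumSq (a * b - 1)
        exact hab ▸ (IsSumSq.mul ha hb).add (IsSumSq.add ha hb) }
  have hM0 : (0 : A) ∉ M := fun h0 => by
    have h0 : IsSumSq ((0 : A) - 1) := h0
    exact IsSemireal.not_isSumSq_neg_one A (by simpa using h0)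
  let L := Localization M
  have : Nontrivial L := by
    refine ⟨⟨0, 1, fun h01 => hM0 ?_⟩⟩
    rw [← map_zero (algebraMap A L), ← map_one (algebraMap A L),
        IsLocalization.eq_iff_exists M] at h01
    obtain ⟨c, hc⟩ := h01
    rw [mul_zero, mul_one] at hc
    exact hc ▸ c.2
  have hfrac : ∀ s : L, IsSumSq s →
      ∃ v ∈ M, ∃ S, IsSumSq S ∧ s * algebraMap A L v ^ 2 = algebraMap A L S := by
    intro s hs
    induction hs with
    | zero => exact ⟨1, one_mem _, 0, .zero, by simp⟩
    | sq_add a hs ih =>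
      obtain ⟨v, hv, S, hS, hvS⟩ := ih
      obtain ⟨⟨b, w⟩, hbw⟩ := IsLocalization.surj M a
      refine ⟨v * w, mul_mem hv w.2, b * v * (b * v) + S * (w * w),
        (IsSumSq.mul_self _).add (hS.mul (.mul_self _)), ?_⟩
      simp only [map_add, map_mul, ← hbw, ← hvS]
      ring
  obtain ⟨m, hm⟩ := Ideal.exists_maximal L
  let : Field (L ⧸ m) := Ideal.Quotient.field m
  refine ⟨L ⧸ m, inferInstance, ?_, ⟨(Ideal.Quotient.mk m).comp (algebraMap A L)⟩⟩
  refine .of_not_isSumSq_neg_one fun hneg => ?_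
  obtain ⟨s, hs, hs1⟩ := hneg.exists_map_eq Ideal.Quotient.mk_surjective
  obtain ⟨v, hv, S, hS, hvS⟩ := hfrac s hs
  have hmem : v ^ 2 + S ∈ M := by
    have h2 : IsSumSq (v ^ 2 - 1) := pow_mem hv 2
    change IsSumSq (v ^ 2 + S - 1)
    exact add_sub_right_comm (v ^ 2) S 1 ▸ h2.add hS
  refine hm.ne_top (Ideal.eq_top_of_isUnit_mem m ?_
    (IsLocalization.map_units L (⟨v ^ 2 + S, hmem⟩ : M)))
  rw [← Ideal.Quotient.eq_zero_iff_mem]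
  simp only [map_add, ← hvS, map_mul, map_pow, hs1]
  ring

/-- The weak real Nullstellensatz. -/
theorem MvPolynomial.exists_isSumSq_one_add_mem_span {σ : Type} {J : Type*} [Finite σ]
    {h : J → MvPolynomial σ ℝ} (hempty : ∀ x : σ → ℝ, ∃ j, MvPolynomial.eval x (h j) ≠ 0) :
    ∃ s : MvPolynomial σ ℝ, IsSumSq s ∧ 1 + s ∈ Ideal.span (Set.range h) := by
  let I := Ideal.span (Set.range h)
  suffices hns : ¬ IsSemireal (MvPolynomial σ ℝ ⧸ I) by
    rw [isSemireal_iff_not_isSumSq_neg_one, not_not] at hns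
    obtain ⟨s, hs, hs1⟩ := hns.exists_map_eq Ideal.Quotient.mk_surjective
    refine ⟨s, hs, ?_⟩
    rw [← Ideal.Quotient.eq_zero_iff_mem, map_add, hs1, map_one, add_neg_cancel]
  intro hsr
  obtain ⟨k, _, _, ⟨ψ⟩⟩ := IsSemireal.exists_ringHom_field (MvPolynomial σ ℝ ⧸ I)
  obtain ⟨R', hR'⟩ := IsSemireal.exists_isRealClosed k
  obtain ⟨_, _⟩ := exists_linearOrder_of_isSquare_or_isSquare_neg R'
    IsRealClosed.isSquare_or_isSquare_neg
  let Φ : MvPolynomial σ ℝ →+* R' := ((algebraMap k R').comp ψ).comp (Ideal.Quotient.mk I)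
  let : Algebra ℝ R' := (Φ.comp MvPolynomial.C).toAlgebra
  have hΦ : ∀ p, MvPolynomial.aeval (fun i => Φ (MvPolynomial.X i)) p = Φ p := by
    intro p
    exact congrArg (· p) (MvPolynomial.ringHom_ext (f := (MvPolynomial.aeval
      (fun i => Φ (MvPolynomial.X i)) : MvPolynomial σ ℝ →ₐ[ℝ] R').toRingHom) (g := Φ)
      (fun r => by simp; rfl) (fun i => by simp))
  obtain ⟨y, hy⟩ := IsRealClosed.exists_aeval_eq_zero (R := ℝ) (h := h)
    (x := fun i => Φ (MvPolynomial.X i)) fun j => by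
      have : h j ∈ I := Ideal.subset_span ⟨j, rfl⟩
      rw [hΦ]
      simp [Φ, Ideal.Quotient.eq_zero_iff_mem.mpr this]
  obtain ⟨j, hj⟩ := hempty y
  exact hj (by simpa [MvPolynomial.aeval_eq_eval] using hy j)

theorem IsSumSq.isSOS {n : ℕ} {p : MvPolynomial (Fin n) ℝ} (hp : IsSumSq p) : IsSOS p := by
  induction hp with
  | zero => exact ⟨0, Fin.elim0, by simp⟩
  | sq_add a hs ih =>
    obtain ⟨m, q, rfl⟩ := ih
    exact ⟨m + 1, Fin.cons a q, by simp [Fin.sum_univ_succ, pow_two]⟩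

theorem truncIdeal_mono {n m : ℕ} (h : Fin m → MvPolynomial (Fin n) ℝ) {k l : ℕ} (hkl : k ≤ l) :
    truncIdeal h k ⊆ truncIdeal h l := by
  rintro p ⟨φ, hφ, hp⟩
  exact ⟨φ, fun i => (hφ i).trans (by omega), hp⟩

theorem truncQM_mono {n m : ℕ} (g : Fin m → MvPolynomial (Fin n) ℝ) {k l : ℕ} (hkl : k ≤ l) :
    truncQM g k ⊆ truncQM g l := by
  rintro p ⟨σ, hσ, hp⟩
  exact ⟨σ, fun j => ⟨(hσ j).1, (hσ j).2.trans (by omega)⟩, hp⟩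

theorem IsSumSq.mem_truncQM {n m k : ℕ} {p : MvPolynomial (Fin n) ℝ} (hp : IsSumSq p)
    (hdeg : p.totalDegree ≤ 2 * k) (g : Fin m → MvPolynomial (Fin n) ℝ) : p ∈ truncQM g k := by
  refine ⟨Fin.cons p 0, fun j => ?_, by simp [Fin.sum_univ_succ]⟩
  refine Fin.cases ⟨by simpa using hp.isSOS, by simpa using hdeg⟩ (fun j => ?_) j
  exact ⟨by simpa using IsSumSq.zero.isSOS, by simp⟩

theorem exists_forall_sub_C_mem {n m₁ m₂ : ℕ} (f : MvPolynomial (Fin n) ℝ)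
    (h : Fin m₁ → MvPolynomial (Fin n) ℝ) (g : Fin m₂ → MvPolynomial (Fin n) ℝ)
    (hempty : realVariety h = ∅) :
    ∃ N : ℕ, ∀ γ : ℝ, f - C γ ∈ truncIdeal h N + truncQM g N := by
  obtain ⟨s, hs, hmem⟩ := MvPolynomial.exists_isSumSq_one_add_mem_span (h := h) fun x => by
    by_contra! hx
    exact Set.eq_empty_iff_forall_notMem.mp hempty x hx
  obtain ⟨c, hc⟩ := Ideal.mem_span_range_iff_exists_fun.mp hmem
  let a : MvPolynomial (Fin n) ℝ := C 2⁻¹ * (f + 1)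
  let b : MvPolynomial (Fin n) ℝ := C 2⁻¹ * (f - 1)
  have hf : f = a * a - b * b := by
    have h4 : (C 2⁻¹ : MvPolynomial (Fin n) ℝ) * C 2⁻¹ * 4 = 1 := by
      rw [← map_ofNat C 4, ← C_mul, ← C_mul]
      norm_num
    linear_combination (-f) * h4
  refine ⟨(a * a).totalDegree + (b * b).totalDegree + s.totalDegree +
    ∑ i, (c i * h i).totalDegree, fun γ => ?_⟩
  obtain ⟨ε, δ, hε, hδ, hγ⟩ : ∃ ε δ : ℝ, 0 ≤ ε ∧ 0 ≤ δ ∧ γ = δ - ε :=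
    ⟨γ⁻, γ⁺, negPart_nonneg γ, posPart_nonneg γ, (posPart_sub_negPart γ).symm⟩
  have hCsq : ∀ r : ℝ, 0 ≤ r → IsSumSq (C r : MvPolynomial (Fin n) ℝ) := fun r hr => by
    rw [← Real.mul_self_sqrt hr, C_mul]
    exact .mul_self _
  refine Set.mem_add.mpr ⟨∑ i, -(b * b + C δ) * c i * h i, ⟨_, fun i => ?_, rfl⟩,
    a * a + b * b * s + C ε + C δ * s, IsSumSq.mem_truncQM ?_ ?_ g, ?_⟩
  · have hi := Finset.single_le_sum (f := fun i => (c i * h i).totalDegree)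
      (fun _ _ => Nat.zero_le _) (Finset.mem_univ i)
    have h1 := totalDegree_mul (-(b * b + C δ)) (c i * h i)
    have h2 := totalDegree_add (b * b) (C δ)
    rw [totalDegree_neg] at h1
    rw [totalDegree_C] at h2
    rw [mul_assoc]
    omega
  · exact (((IsSumSq.mul_self a).add ((IsSumSq.mul_self b).mul hs)).add (hCsq ε hε)).add
      ((hCsq δ hδ).mul hs)
  · have h1 := totalDegree_add (a * a + b * b * s + C ε) (C δ * s)
    have h2 := totalDegree_add (a * a + b * b * s) (C ε)
    have h3 := totalDegree_add (a * a) (b * b * s)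
    have h4 := totalDegree_mul (b * b) s
    have h5 := totalDegree_mul (C δ) s
    rw [totalDegree_C] at h2 h5
    omega
  · have hsum : ∑ i, -(b * b + C δ) * c i * h i = -(b * b + C δ) * (1 + s) := by
      rw [← hc, Finset.mul_sum]
      exact Finset.sum_congr rfl fun i _ => mul_assoc _ _ _
    rw [hsum, hγ, C_sub]
    linear_combination -hf

/-- If the real variety `V_ℝ(h)` is empty, then there is `N` such that every `γ ∈ ℝ`
is feasible for the `N`-th SOS relaxation; consequently `f_k = +∞` for all `k ≥ N`. -/
theorem lasserre_infeasible_of_empty_realVariety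
    {n m₁ m₂ : ℕ} (f : MvPolynomial (Fin n) ℝ)
    (h : Fin m₁ → MvPolynomial (Fin n) ℝ) (g : Fin m₂ → MvPolynomial (Fin n) ℝ)
    (hempty : realVariety h = ∅) :
    ∃ N : ℕ, (∀ γ : ℝ, f - C γ ∈ truncIdeal h N + truncQM g N) ∧
      ∀ k ≥ N, lasserreBound f h g k = ⊤ := by
  obtain ⟨N, hN⟩ := exists_forall_sub_C_mem f h g hempty
  refine ⟨N, hN, fun k hk => ?_⟩
  rw [EReal.eq_top_iff_forall_lt]
  intro r
  refine lt_of_lt_of_le (EReal.coe_lt_coe_iff.mpr (lt_add_one r)) (le_sSup ⟨r + 1, rfl, ?_⟩)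
  exact Set.add_subset_add (truncIdeal_mono h hk) (truncQM_mono g hk) (hN _)
end
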